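/- arXiv:2112.15428 — 8 statements merged into one kernel-verified Lean document; each statement's English description precedes it below -/
import Mathlib

section
/- Let n be a finite type, let ℏ > 0 be a real constant, let J_s be a symmetric real n×n matrix and J_a an antisymmetric real n×n matrix, and let P : ℝ → Matrix n n ℝ be a differentiable matrix-valued function. Define P_s(t) = (P(t) + P(t)ᵀ)/2, P_a(t) = (P(t) − P(t)ᵀ)/2, the complex matrix ρ(t) = P_s(t) − i·P_a(t), and H = −ℏ·J_s + i·ℏ·J_a. Then P′(t) = −[J_s, P(t)ᵀ] + [J_a, P(t)] holds for all t if and only if i·ℏ·ρ′(t) = [H, ρ(t)] holds for all t. Moreover, the equation for P automatically implies the transposed equation (Pᵀ)′(t) = [J_s, P(t)] + [J_a, P(t)ᵀ] for all t. -/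
open Matrix

attribute [local instance] Matrix.normedAddCommGroup Matrix.normedSpace

/-- Entrywise complexification of a real matrix. -/
noncomputable def matCplx {n : Type*} (M : Matrix n n ℝ) : Matrix n n ℂ :=
  M.map (Complex.ofReal)

theorem matCplx_add {n : Type*} (A B : Matrix n n ℝ) :
    matCplx (A + B) = matCplx A + matCplx B :=
  Matrix.map_add _ Complex.ofReal_add A B

theorem matCplx_neg {n : Type*} (A : Matrix n n ℝ) : matCplx (-A) = -matCplx A := by
  ext i j
  simp [matCplx]

theorem matCplx_sub {n : Type*} (A B : Matrix n n ℝ) :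
    matCplx (A - B) = matCplx A - matCplx B :=
  Matrix.map_sub _ Complex.ofReal_sub A B

theorem matCplx_mul {n : Type*} [Fintype n] (A B : Matrix n n ℝ) :
    matCplx (A * B) = matCplx A * matCplx B :=
  Matrix.map_mul (f := Complex.ofRealHom)

/-- A complex matrix determines its entrywise real and imaginary parts. -/
theorem matCplx_add_I_smul_inj {n : Type*} {A B C D : Matrix n n ℝ} :
    matCplx A + Complex.I • matCplx B = matCplx C + Complex.I • matCplx D ↔
      A = C ∧ B = D := by
  constructor
  · intro h
    constructor
    · ext i j
      simpa [matCplx] using congrArg Complex.re (congrFun₂ h i j)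
    · ext i j
      simpa [matCplx] using congrArg Complex.im (congrFun₂ h i j)
  · rintro ⟨rfl, rfl⟩
    rfl

theorem hasDerivAt_matrix_iff {n E : Type*} [Fintype n] [NormedAddCommGroup E]
    [NormedSpace ℝ E] {F : ℝ → Matrix n n E} {D : Matrix n n E} {t : ℝ} :
    HasDerivAt F D t ↔ ∀ i j, HasDerivAt (fun s => F s i j) (D i j) t :=
  (hasDerivAt_pi (φ := F) (φ' := D)).trans (forall_congr' fun _ => hasDerivAt_pi)

theorem HasDerivAt.transpose_matrix {n : Type*} [Fintype n] {P : ℝ → Matrix n n ℝ}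
    {D : Matrix n n ℝ} {t : ℝ} (h : HasDerivAt P D t) :
    HasDerivAt (fun s => (P s)ᵀ) Dᵀ t :=
  hasDerivAt_matrix_iff.2 fun i j => hasDerivAt_matrix_iff.1 h j i

theorem HasDerivAt.matCplx {n : Type*} [Fintype n] {P : ℝ → Matrix n n ℝ}
    {D : Matrix n n ℝ} {t : ℝ} (h : HasDerivAt P D t) :
    HasDerivAt (fun s => _root_.matCplx (P s)) (_root_.matCplx D) t :=
  hasDerivAt_matrix_iff.2 fun i j => (hasDerivAt_matrix_iff.1 h i j).ofReal_comp

/-- A matrix equation holds iff its symmetric and antisymmetric parts agree. -/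
theorem eq_iff_symm_antisymm_parts {n : Type*} {D X Y : Matrix n n ℝ}
    (hX : Xᵀ = X) (hY : Yᵀ = -Y) :
    D = X + Y ↔ (2 : ℝ)⁻¹ • (D - Dᵀ) = Y ∧ (2 : ℝ)⁻¹ • (D + Dᵀ) = X := by
  constructor
  · rintro rfl
    rw [transpose_add, hX, hY]
    constructor <;> module
  · rintro ⟨rfl, rfl⟩
    module

/-- with `P_s = (P + Pᵀ)/2`, `P_a = (P - Pᵀ)/2`,
`ρ = P_s - i P_a` and `H = -ℏ J_s + i ℏ J_a`, the real equation
`P' = -[J_s, Pᵀ] + [J_a, P]` holds for all `t` iff the von Neumann equation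
`i ℏ ρ' = [H, ρ]` holds for all `t`; moreover the equation for `P` implies the
transposed equation `(Pᵀ)' = [J_s, P] + [J_a, Pᵀ]`. -/
theorem stmt1 {n : Type*} [Fintype n] [DecidableEq n]
    (ℏ : ℝ) (hℏ : 0 < ℏ)
    (Js Ja : Matrix n n ℝ) (hJs : Jsᵀ = Js) (hJa : Jaᵀ = -Ja)
    (P : ℝ → Matrix n n ℝ) (hP : Differentiable ℝ P)
    (Psym Pasym : ℝ → Matrix n n ℝ)
    (hPsym : ∀ t, Psym t = (2 : ℝ)⁻¹ • (P t + (P t)ᵀ))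
    (hPasym : ∀ t, Pasym t = (2 : ℝ)⁻¹ • (P t - (P t)ᵀ))
    (ρ : ℝ → Matrix n n ℂ)
    (hρ : ∀ t, ρ t = matCplx (Psym t) - Complex.I • matCplx (Pasym t))
    (H : Matrix n n ℂ)
    (hH : H = -((ℏ : ℂ) • matCplx Js) + Complex.I • ((ℏ : ℂ) • matCplx Ja)) :
    ((∀ t, deriv P t = -(Js * (P t)ᵀ - (P t)ᵀ * Js) + (Ja * P t - P t * Ja)) ↔
      (∀ t, (Complex.I * (ℏ : ℂ)) • deriv ρ t = H * ρ t - ρ t * H)) ∧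
    ((∀ t, deriv P t = -(Js * (P t)ᵀ - (P t)ᵀ * Js) + (Ja * P t - P t * Ja)) →
      (∀ t, deriv (fun s => (P s)ᵀ) t =
        (Js * P t - P t * Js) + (Ja * (P t)ᵀ - (P t)ᵀ * Ja))) := by
  have hD : ∀ t, HasDerivAt P (deriv P t) t := fun t => (hP t).hasDerivAt
  refine ⟨forall_congr' fun t => ?_, fun h t => ?_⟩
  · have hρ' : deriv ρ t = matCplx ((2 : ℝ)⁻¹ • (deriv P t + (deriv P t)ᵀ)) -
        Complex.I • matCplx ((2 : ℝ)⁻¹ • (deriv P t - (deriv P t)ᵀ)) := by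
      have hsym := ((hD t).add (hD t).transpose_matrix).const_smul (2 : ℝ)⁻¹
      have hasym := ((hD t).sub (hD t).transpose_matrix).const_smul (2 : ℝ)⁻¹
      have hρeq : ρ = fun s => matCplx ((2 : ℝ)⁻¹ • (P s + (P s)ᵀ)) -
          Complex.I • matCplx ((2 : ℝ)⁻¹ • (P s - (P s)ᵀ)) := by
        funext s
        rw [hρ, hPsym, hPasym]
      rw [hρeq]
      exact (hsym.matCplx.sub (hasym.matCplx.const_smul Complex.I)).deriv
    have hS : (Psym t)ᵀ = Psym t := by
      rw [hPsym, transpose_smul, transpose_add, transpose_transpose, add_comm]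
    have hA : (Pasym t)ᵀ = -Pasym t := by
      rw [hPasym, transpose_smul, transpose_sub, transpose_transpose, ← smul_neg, neg_sub]
    have hPt : P t = Psym t + Pasym t := by
      rw [hPsym, hPasym]
      module
    have hPtT : (P t)ᵀ = Psym t - Pasym t := by
      rw [hPsym, hPasym]
      module
    have hX : ((Js * Pasym t - Pasym t * Js) + (Ja * Psym t - Psym t * Ja))ᵀ =
        (Js * Pasym t - Pasym t * Js) + (Ja * Psym t - Psym t * Ja) := by
      simp only [transpose_add, transpose_sub, transpose_mul, hS, hA, hJs, hJa]
      noncomm_ring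
    have hY : (-(Js * Psym t - Psym t * Js) + (Ja * Pasym t - Pasym t * Ja))ᵀ =
        -(-(Js * Psym t - Psym t * Js) + (Ja * Pasym t - Pasym t * Ja)) := by
      simp only [transpose_add, transpose_neg, transpose_sub, transpose_mul, hS, hA, hJs, hJa]
      noncomm_ring
    have hreal : -(Js * (P t)ᵀ - (P t)ᵀ * Js) + (Ja * P t - P t * Ja) =
        ((Js * Pasym t - Pasym t * Js) + (Ja * Psym t - Psym t * Ja)) +
          (-(Js * Psym t - Psym t * Js) + (Ja * Pasym t - Pasym t * Ja)) := by
      rw [hPtT, hPt]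
      noncomm_ring
    have hlhs : (Complex.I * (ℏ : ℂ)) • deriv ρ t =
        (ℏ : ℂ) • (matCplx ((2 : ℝ)⁻¹ • (deriv P t - (deriv P t)ᵀ)) +
          Complex.I • matCplx ((2 : ℝ)⁻¹ • (deriv P t + (deriv P t)ᵀ))) := by
      rw [hρ', mul_comm, mul_smul, smul_sub Complex.I, smul_smul Complex.I Complex.I,
        Complex.I_mul_I]
      module
    have hrhs : H * ρ t - ρ t * H =
        (ℏ : ℂ) • (matCplx (-(Js * Psym t - Psym t * Js) + (Ja * Pasym t - Pasym t * Ja)) +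
          Complex.I • matCplx
            ((Js * Pasym t - Pasym t * Js) + (Ja * Psym t - Psym t * Ja))) := by
      rw [hH, hρ]
      simp only [matCplx_add, matCplx_sub, matCplx_neg, matCplx_mul, add_mul, mul_sub, sub_mul,
        mul_add, neg_mul, mul_neg, smul_mul_assoc, mul_smul_comm]
      match_scalars <;> ring_nf <;> simp [Complex.I_sq]
    have hℏ' : (ℏ : ℂ) ≠ 0 := Complex.ofReal_ne_zero.2 hℏ.ne'
    rw [hlhs, hrhs, smul_right_inj hℏ', matCplx_add_I_smul_inj, hreal,
      eq_iff_symm_antisymm_parts hX hY]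
  · refine (hD t).transpose_matrix.deriv.trans ?_
    rw [h t]
    simp only [transpose_add, transpose_neg, transpose_sub, transpose_mul, transpose_transpose,
      hJs, hJa]
    noncomm_ring
end

section
/- Let a₊, a₋, b₊, b₋ : ℝ → ℝ be functions with a₊(x) > 0, a₋(x) > 0, b₊(x) > 0, b₋(x) > 0 for all x, and let Z_one > 0 and Z_both > 0 be real numbers such that ∫ a₊(x)·b₊(x) dx = Z_one, ∫ a₋(x)·b₋(x) dx = Z_one, and ∫ (a₊(x) + a₋(x))·(b₊(x) + b₋(x)) dx = Z_both. Define P₊(x) := a₊(x)·b₊(x)/Z_one, P₋(x) := a₋(x)·b₋(x)/Z_one, and S₊(x) := (1/2)·log(a₊(x)/b₊(x)), S₋(x) := (1/2)·log(a₋(x)/b₋(x)). Then for every x ∈ ℝ, (a₊(x) + a₋(x))·(b₊(x) + b₋(x))/Z_both = (2·Z_one/Z_both) · [ (1/2)·(P₊(x) + P₋(x)) + √(P₊(x)·P₋(x)) · cosh(S₊(x) − S₋(x)) ]. -/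
open MeasureTheory Real

/-- The geometric mean of `a * b` and `c * d`, weighted by the hyperbolic cosine of the difference
of the half-logarithms of `a / b` and `c / d`, is the mean of the cross terms. -/
theorem sqrt_mul_cosh_half_log_sub {a b c d : ℝ} (ha : 0 < a) (hb : 0 < b) (hc : 0 < c)
    (hd : 0 < d) :
    Real.sqrt ((a * b) * (c * d)) *
        Real.cosh ((1 / 2) * Real.log (a / b) - (1 / 2) * Real.log (c / d)) =
      (a * d + c * b) / 2 := by
  obtain ⟨α, rfl⟩ : ∃ α, Real.exp α = a := ⟨_, Real.exp_log ha⟩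
  obtain ⟨β, rfl⟩ : ∃ β, Real.exp β = b := ⟨_, Real.exp_log hb⟩
  obtain ⟨γ, rfl⟩ : ∃ γ, Real.exp γ = c := ⟨_, Real.exp_log hc⟩
  obtain ⟨δ, rfl⟩ : ∃ δ, Real.exp δ = d := ⟨_, Real.exp_log hd⟩
  rw [← Real.exp_sub, ← Real.exp_sub, Real.log_exp, Real.log_exp, Real.cosh_eq]
  simp only [← Real.exp_add]
  rw [← Real.exp_half, ← mul_div_assoc, mul_add, ← Real.exp_add, ← Real.exp_add]
  ring_nf

/-- the two-slit identity
`(a₊ + a₋)(b₊ + b₋)/Z_both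
  = (2 Z_one / Z_both) [ (P₊ + P₋)/2 + √(P₊ P₋) cosh(S₊ - S₋) ]`. -/
theorem stmt9
    (aP aM bP bM : ℝ → ℝ)
    (haP : ∀ x, 0 < aP x) (haM : ∀ x, 0 < aM x)
    (hbP : ∀ x, 0 < bP x) (hbM : ∀ x, 0 < bM x)
    (Zone Zboth : ℝ) (hZone : 0 < Zone) (hZboth : 0 < Zboth)
    (hintP : ∫ x, aP x * bP x = Zone)
    (hintM : ∫ x, aM x * bM x = Zone)
    (hintBoth : ∫ x, (aP x + aM x) * (bP x + bM x) = Zboth)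
    (PP PM SP SM : ℝ → ℝ)
    (hPP : ∀ x, PP x = aP x * bP x / Zone)
    (hPM : ∀ x, PM x = aM x * bM x / Zone)
    (hSP : ∀ x, SP x = (1 / 2) * Real.log (aP x / bP x))
    (hSM : ∀ x, SM x = (1 / 2) * Real.log (aM x / bM x)) :
    ∀ x : ℝ, (aP x + aM x) * (bP x + bM x) / Zboth =
      (2 * Zone / Zboth) *
        ((1 / 2) * (PP x + PM x) +
          Real.sqrt (PP x * PM x) * Real.cosh (SP x - SM x)) := by
  intro x
  have hsqrt : Real.sqrt (PP x * PM x) =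
      Real.sqrt ((aP x * bP x) * (aM x * bM x)) / Zone := by
    rw [hPP, hPM, div_mul_div_comm, Real.sqrt_div' _ (mul_self_nonneg Zone),
      Real.sqrt_mul_self hZone.le]
  rw [hsqrt, hSP, hSM, div_mul_eq_mul_div (Real.sqrt _) Zone,
    sqrt_mul_cosh_half_log_sub (haP x) (hbP x) (haM x) (hbM x), hPP, hPM]
  field_simp
  ring
end

section
/- Let m > 0 and Γ > 0 be real constants, let V : ℝ → ℝ be twice continuously differentiable with V, V′ and V″ bounded, and let g : ℝ → ℂ be a Schwartz function. For ε > 0 define the kernel F_ε(x, x′) := √(m/(2·π·Γ·ε)) · exp(−m·(x − x′)²/(2·Γ·ε)) · exp(−(ε/(2·Γ))·(V(x) + V(x′))). Then for every x ∈ ℝ, the function ε ↦ (∫ F_ε(x, x′)·g(x′) dx′) − g(x) + (ε/Γ)·( −(Γ²/(2·m))·g″(x) + V(x)·g(x) ) is O(ε²) as ε → 0 from the right. -/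
open MeasureTheory Asymptotics Filter Real ProbabilityTheory

section Taylor

variable {E : Type*} [NormedAddCommGroup E] [NormedSpace ℝ E]

/-- If the derivative of `f` grows at most like `K |y - x| ^ n` away from `x`, then
`‖f y - f x‖` grows at most like `K |y - x| ^ (n + 1)`. -/
lemma norm_sub_le_pow_succ_of_norm_deriv_le_pow {f f' : ℝ → E} {K x : ℝ} {n : ℕ}
    (hf : ∀ y, HasDerivAt f (f' y) y) (hK : 0 ≤ K)
    (hb : ∀ y, ‖f' y‖ ≤ K * |y - x| ^ n) (y : ℝ) :
    ‖f y - f x‖ ≤ K * |y - x| ^ (n + 1) := by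
  have h := (convex_uIcc x y).norm_image_sub_le_of_norm_hasDerivWithin_le
    (f := f) (f' := f') (C := K * |y - x| ^ n) (x := x) (y := y)
    (fun t _ => (hf t).hasDerivWithinAt)
    (fun t ht => (hb t).trans (by
      have := Set.abs_sub_left_of_mem_uIcc ht
      gcongr)) Set.left_mem_uIcc Set.right_mem_uIcc
  rwa [Real.norm_eq_abs, mul_assoc, ← pow_succ] at h

/-- First order Taylor expansion with a bounded second derivative. -/
lemma norm_taylor_one_le {f f' f'' : ℝ → E} {K : ℝ}
    (hf : ∀ y, HasDerivAt f (f' y) y) (hf' : ∀ y, HasDerivAt f' (f'' y) y)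
    (hK : ∀ y, ‖f'' y‖ ≤ K) (x y : ℝ) :
    ‖f y - f x - (y - x) • f' x‖ ≤ K * (y - x) ^ 2 := by
  have hK0 : 0 ≤ K := (norm_nonneg _).trans (hK x)
  have h1 := norm_sub_le_pow_succ_of_norm_deriv_le_pow (x := x) (n := 0) hf' hK0
    (fun y => by simpa using hK y)
  have h2 := norm_sub_le_pow_succ_of_norm_deriv_le_pow (x := x) (n := 1) (K := K)
    (f := fun y => f y - (y - x) • f' x) (f' := fun y => f' y - f' x)
    (fun y => by simpa using (hf y).fun_sub (((hasDerivAt_id y).sub_const x).smul_const (f' x)))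
    hK0 h1 y
  simp only [sub_self, zero_smul, sub_zero, one_add_one_eq_two, sq_abs] at h2
  rwa [sub_right_comm]

/-- Third order Taylor expansion with a bounded fourth derivative. -/
lemma norm_taylor_three_le {f f₁ f₂ f₃ f₄ : ℝ → E} {K : ℝ}
    (hf : ∀ y, HasDerivAt f (f₁ y) y) (hf₁ : ∀ y, HasDerivAt f₁ (f₂ y) y)
    (hf₂ : ∀ y, HasDerivAt f₂ (f₃ y) y) (hf₃ : ∀ y, HasDerivAt f₃ (f₄ y) y)
    (hK : ∀ y, ‖f₄ y‖ ≤ K) (x y : ℝ) :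
    ‖f y - f x - (y - x) • f₁ x - ((y - x) ^ 2 / 2) • f₂ x - ((y - x) ^ 3 / 6) • f₃ x‖
      ≤ K * (y - x) ^ 4 := by
  have hK0 : 0 ≤ K := (norm_nonneg _).trans (hK x)
  have hid : ∀ y, HasDerivAt (fun y : ℝ => y - x) 1 y := fun y => (hasDerivAt_id y).sub_const x
  have hsq : ∀ y, HasDerivAt (fun y : ℝ => (y - x) ^ 2 / 2) (y - x) y := fun y =>
    (((hid y).fun_pow 2).div_const 2).congr_deriv (by norm_num)
  have hcube : ∀ y, HasDerivAt (fun y : ℝ => (y - x) ^ 3 / 6) ((y - x) ^ 2 / 2) y := fun y =>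
    (((hid y).fun_pow 3).div_const 6).congr_deriv (by norm_num; ring)
  have h1 := norm_sub_le_pow_succ_of_norm_deriv_le_pow (x := x) (n := 2) (K := K)
    (f := fun y => f₁ y - (y - x) • f₂ x - ((y - x) ^ 2 / 2) • f₃ x)
    (f' := fun y => f₂ y - f₂ x - (y - x) • f₃ x)
    (fun y => by
      simpa using ((hf₁ y).fun_sub ((hid y).smul_const (f₂ x))).fun_sub ((hsq y).smul_const (f₃ x)))
    hK0 (fun y => by simpa using norm_taylor_one_le hf₂ hf₃ hK x y)
  have h2 := norm_sub_le_pow_succ_of_norm_deriv_le_pow (x := x) (n := 3) (K := K)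
    (f := fun y => f y - (y - x) • f₁ x - ((y - x) ^ 2 / 2) • f₂ x - ((y - x) ^ 3 / 6) • f₃ x)
    (f' := fun y => f₁ y - f₁ x - (y - x) • f₂ x - ((y - x) ^ 2 / 2) • f₃ x)
    (fun y => by
      simpa using (((hf y).fun_sub ((hid y).smul_const (f₁ x))).fun_sub
        ((hsq y).smul_const (f₂ x))).fun_sub
        ((hcube y).smul_const (f₃ x)))
    hK0 (fun y => by
      convert h1 y using 2
      simp only [sub_self, zero_smul, ne_eq, OfNat.ofNat_ne_zero, not_false_eq_true, zero_pow,
        zero_div, sub_zero]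
      abel) y
  have h4 : |y - x| ^ 4 = (y - x) ^ 4 := (by decide : Even 4).pow_abs _
  simp only [sub_self, zero_smul, ne_eq, OfNat.ofNat_ne_zero, not_false_eq_true, zero_pow,
    zero_div, sub_zero, Nat.reduceAdd, h4] at h2
  convert h2 using 2
  abel

end Taylor

section GaussianMoments

lemma integrable_pow_gaussianReal (n : ℕ) (μ : ℝ) (v : NNReal) :
    Integrable (fun z : ℝ => z ^ n) (gaussianReal μ v) := by
  have h : MemLp id n (gaussianReal μ v) := memLp_id_gaussianReal' n (by simp)
  refine (integrable_norm_iff (by fun_prop)).1 ?_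
  simpa using h.integrable_norm_pow'

lemma integral_odd_pow_gaussianReal {n : ℕ} (hn : Odd n) (v : NNReal) :
    ∫ z : ℝ, z ^ n ∂(gaussianReal 0 v) = 0 := by
  have h : ∫ z : ℝ, z ^ n ∂(gaussianReal 0 v) = -∫ z : ℝ, z ^ n ∂(gaussianReal 0 v) := by
    conv_lhs => rw [← neg_zero, ← gaussianReal_map_neg, integral_map (by fun_prop) (by fun_prop)]
    simp only [hn.neg_pow, integral_neg]
  linarith

lemma integral_sq_gaussianReal (v : NNReal) :
    ∫ z : ℝ, z ^ 2 ∂(gaussianReal 0 v) = v := by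
  have h := variance_fun_id_gaussianReal (μ := 0) (v := v)
  rw [variance_eq_integral (by fun_prop)] at h
  simpa using h

variable {E : Type*} [NormedAddCommGroup E] [NormedSpace ℝ E] [CompleteSpace E]

lemma norm_integral_gaussianReal_sub_le {f : ℝ → E} {x s K : ℝ} {a : E}
    (hi : Integrable (fun z => f (x + s * z)) (gaussianReal 0 1))
    (hf : ∀ y, ‖f y - f x - (y - x) • a‖ ≤ K * (y - x) ^ 2) :
    ‖(∫ z, f (x + s * z) ∂(gaussianReal 0 1)) - f x‖ ≤ K * s ^ 2 := by
  have i1 : Integrable (fun z : ℝ => (s * z) • a) (gaussianReal 0 1) := by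
    simpa using ((integrable_pow_gaussianReal 1 0 1).const_mul s).smul_const a
  have e1 : ∫ z : ℝ, (s * z) • a ∂(gaussianReal 0 1) = 0 := by
    rw [integral_smul_const, integral_const_mul, integral_id_gaussianReal]
    simp
  have key : (∫ z, f (x + s * z) ∂(gaussianReal 0 1)) - f x
      = ∫ z, (f (x + s * z) - f x - (s * z) • a) ∂(gaussianReal 0 1) := by
    have i0 : Integrable (fun z => f (x + s * z) - f x) (gaussianReal 0 1) :=
      hi.sub (integrable_const _)
    rw [integral_sub i0 i1, integral_sub hi (integrable_const _), e1]
    simp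
  rw [key]
  calc _ ≤ ∫ z : ℝ, K * s ^ 2 * z ^ 2 ∂(gaussianReal 0 1) :=
        norm_integral_le_of_norm_le ((integrable_pow_gaussianReal 2 0 1).const_mul _)
          (ae_of_all _ fun z => by
            have := hf (x + s * z)
            rwa [add_sub_cancel_left, mul_pow, ← mul_assoc] at this)
    _ = K * s ^ 2 := by
        rw [integral_const_mul, integral_sq_gaussianReal]
        simp

lemma norm_integral_gaussianReal_sub_sub_le {f : ℝ → E} {x s K : ℝ} {a b c : E}
    (hi : Integrable (fun z => f (x + s * z)) (gaussianReal 0 1))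
    (hf : ∀ y, ‖f y - f x - (y - x) • a - ((y - x) ^ 2 / 2) • b - ((y - x) ^ 3 / 6) • c‖
      ≤ K * (y - x) ^ 4) :
    ‖(∫ z, f (x + s * z) ∂(gaussianReal 0 1)) - f x - (s ^ 2 / 2) • b‖
      ≤ K * (∫ z : ℝ, z ^ 4 ∂(gaussianReal 0 1)) * s ^ 4 := by
  have i1 : Integrable (fun z : ℝ => (s * z) • a) (gaussianReal 0 1) := by
    simpa using ((integrable_pow_gaussianReal 1 0 1).const_mul s).smul_const a
  have e1 : ∫ z : ℝ, (s * z) • a ∂(gaussianReal 0 1) = 0 := by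
    rw [integral_smul_const, integral_const_mul, integral_id_gaussianReal]
    simp
  have i2 : Integrable (fun z : ℝ => ((s * z) ^ 2 / 2) • b) (gaussianReal 0 1) := by
    simp only [mul_pow]
    exact (((integrable_pow_gaussianReal 2 0 1).const_mul _).div_const _).smul_const b
  have e2 : ∫ z : ℝ, ((s * z) ^ 2 / 2) • b ∂(gaussianReal 0 1) = (s ^ 2 / 2) • b := by
    simp only [mul_pow]
    rw [integral_smul_const, integral_div, integral_const_mul, integral_sq_gaussianReal]
    simp
  have i3 : Integrable (fun z : ℝ => ((s * z) ^ 3 / 6) • c) (gaussianReal 0 1) := by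
    simp only [mul_pow]
    exact (((integrable_pow_gaussianReal 3 0 1).const_mul _).div_const _).smul_const c
  have e3 : ∫ z : ℝ, ((s * z) ^ 3 / 6) • c ∂(gaussianReal 0 1) = 0 := by
    simp only [mul_pow]
    rw [integral_smul_const, integral_div, integral_const_mul,
      integral_odd_pow_gaussianReal (by decide)]
    simp
  have key : (∫ z, f (x + s * z) ∂(gaussianReal 0 1)) - f x - (s ^ 2 / 2) • b
      = ∫ z, (f (x + s * z) - f x - (s * z) • a - ((s * z) ^ 2 / 2) • b
          - ((s * z) ^ 3 / 6) • c) ∂(gaussianReal 0 1) := by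
    have i0 : Integrable (fun z => f (x + s * z) - f x) (gaussianReal 0 1) :=
      hi.sub (integrable_const _)
    have i01 : Integrable (fun z => f (x + s * z) - f x - (s * z) • a) (gaussianReal 0 1) :=
      i0.sub i1
    have i012 : Integrable (fun z => f (x + s * z) - f x - (s * z) • a - ((s * z) ^ 2 / 2) • b)
        (gaussianReal 0 1) := i01.sub i2
    rw [integral_sub i012 i3, integral_sub i01 i2, integral_sub i0 i1,
      integral_sub hi (integrable_const _), e1, e2, e3]
    simp
  rw [key]
  calc _ ≤ ∫ z : ℝ, K * s ^ 4 * z ^ 4 ∂(gaussianReal 0 1) :=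
        norm_integral_le_of_norm_le ((integrable_pow_gaussianReal 4 0 1).const_mul _)
          (ae_of_all _ fun z => by
            have := hf (x + s * z)
            simp only [add_sub_cancel_left] at this
            rwa [mul_pow s z 4, ← mul_assoc] at this)
    _ = _ := by
        rw [integral_const_mul]
        ring

omit [CompleteSpace E] in
/-- Integration against the heat kernel, written as a Gaussian expectation. -/
lemma integral_heatKernel_smul_eq {m Γ ε : ℝ} (hm : 0 < m) (hΓ : 0 < Γ) (hε : 0 < ε)
    {x : ℝ} {f : ℝ → E} (hf : Continuous f) :
    ∫ y, (√(m / (2 * π * Γ * ε)) * exp (-(m * (x - y) ^ 2) / (2 * Γ * ε))) • f y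
      = ∫ z, f (x + √(Γ * ε / m) * z) ∂(gaussianReal 0 1) := by
  have hv : 0 < Γ * ε / m := by positivity
  have hmap : (gaussianReal 0 1).map (fun z => x + √(Γ * ε / m) * z)
      = gaussianReal x (Γ * ε / m).toNNReal := by
    have : (fun z => x + √(Γ * ε / m) * z) = (x + ·) ∘ (√(Γ * ε / m) * ·) := rfl
    rw [this, ← Measure.map_map (by fun_prop) (by fun_prop), gaussianReal_map_const_mul,
      gaussianReal_map_const_add]
    congr 1
    · simp
    · ext
      simp [Real.sq_sqrt hv.le, hv.le]
  rw [← integral_map (φ := fun z => x + √(Γ * ε / m) * z) (f := f) (by fun_prop)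
    hf.aestronglyMeasurable, hmap, integral_gaussianReal_eq_integral_smul (by simpa using hv)]
  refine integral_congr_ae (ae_of_all _ fun y => ?_)
  simp only [gaussianPDFReal, Real.coe_toNNReal _ hv.le]
  congr 2
  · rw [← Real.sqrt_inv]
    congr 1
    field_simp
  · congr 1
    field_simp
    ring

end GaussianMoments

lemma Continuous.integrable_comp_affine_gaussianReal {f : ℝ → ℂ} (hf : Continuous f) {C : ℝ}
    (hC : ∀ y, ‖f y‖ ≤ C) (x s : ℝ) :
    Integrable (fun z => f (x + s * z)) (gaussianReal 0 1) :=
  .of_bound (by fun_prop) C (ae_of_all _ fun _ => hC _)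

/-- Expansion of the potential factor `exp (-(ε / (2 Γ)) (V x + V y))` to first order. -/
lemma norm_integral_exp_potential_sub_le {V : ℝ → ℝ} {g : ℝ → ℂ} {C G ε Γ : ℝ}
    (hV : Continuous V) (hVb : ∀ y, |V y| ≤ C) (hg : Continuous g) (hgb : ∀ y, ‖g y‖ ≤ G)
    (hΓ : 0 < Γ) (hε : 0 < ε) (hsmall : ε * C / Γ ≤ 1) (x s : ℝ) :
    ‖(∫ z, (exp (-(ε / (2 * Γ)) * (V x + V (x + s * z))) : ℂ) * g (x + s * z)
          ∂(gaussianReal 0 1))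
        - (∫ z, g (x + s * z) ∂(gaussianReal 0 1))
        + ((ε / (2 * Γ) : ℝ) : ℂ) *
          ∫ z, ((V x + V (x + s * z) : ℝ) : ℂ) * g (x + s * z) ∂(gaussianReal 0 1)‖
      ≤ (ε * C / Γ) ^ 2 * G := by
  have hC0 : 0 ≤ C := (abs_nonneg _).trans (hVb x)
  have hG0 : 0 ≤ G := (norm_nonneg _).trans (hgb x)
  have hsum : ∀ y, |V x + V y| ≤ 2 * C := fun y =>
    (abs_add_le _ _).trans (by linarith [hVb x, hVb y])
  have ht : ∀ y, |-(ε / (2 * Γ)) * (V x + V y)| ≤ ε * C / Γ := fun y => by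
    rw [abs_mul, abs_neg, abs_of_pos (by positivity)]
    calc _ ≤ ε / (2 * Γ) * (2 * C) := by gcongr; exact hsum y
      _ = _ := by field_simp
  have hpt : ∀ y, ‖(exp (-(ε / (2 * Γ)) * (V x + V y)) : ℂ) * g y - g y
      + ((ε / (2 * Γ) : ℝ) : ℂ) * (((V x + V y : ℝ) : ℂ) * g y)‖ ≤ (ε * C / Γ) ^ 2 * G := fun y => by
    have e : (exp (-(ε / (2 * Γ)) * (V x + V y)) : ℂ) * g y - g y
        + ((ε / (2 * Γ) : ℝ) : ℂ) * (((V x + V y : ℝ) : ℂ) * g y)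
        = ((exp (-(ε / (2 * Γ)) * (V x + V y)) - 1 - -(ε / (2 * Γ)) * (V x + V y) : ℝ) : ℂ)
          * g y := by
      push_cast
      ring
    rw [e, norm_mul, Complex.norm_real]
    gcongr
    · exact (Real.norm_exp_sub_one_sub_id_le ((ht y).trans hsmall)).trans (by
        rw [Real.norm_eq_abs]
        gcongr
        exact ht y)
    · exact hgb y
  have i1 := Continuous.integrable_comp_affine_gaussianReal hg hgb x s
  have i2 := Continuous.integrable_comp_affine_gaussianReal
    (f := fun y => ((V x + V y : ℝ) : ℂ) * g y) (C := 2 * C * G) (by fun_prop)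
    (fun y => by
      rw [norm_mul, Complex.norm_real]
      gcongr
      exacts [hsum y, hgb y]) x s
  have i3 := Continuous.integrable_comp_affine_gaussianReal
    (f := fun y => (exp (-(ε / (2 * Γ)) * (V x + V y)) : ℂ) * g y)
    (C := exp (ε * C / Γ) * G) (by fun_prop)
    (fun y => by
      rw [norm_mul, Complex.norm_real, Real.norm_eq_abs, Real.abs_exp]
      gcongr
      exacts [(le_abs_self _).trans (ht y), hgb y]) x s
  have i31 : Integrable (fun z => (exp (-(ε / (2 * Γ)) * (V x + V (x + s * z))) : ℂ)
      * g (x + s * z) - g (x + s * z)) (gaussianReal 0 1) := i3.sub i1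
  rw [← integral_sub i3 i1, ← integral_const_mul, ← integral_add i31 (i2.const_mul _)]
  refine (norm_integral_le_of_norm_le_const (ae_of_all _ fun z => hpt (x + s * z))).trans ?_
  simp

/-- Quantitative form of the short-time expansion, for a function `g` with bounded derivatives
`g₁`, `g₂`, `g₃`, `g₄` and a potential `V` with bounded derivatives `V₁`, `V₂`. -/
lemma norm_integral_shortTimeKernel_sub_le {m Γ : ℝ} (hm : 0 < m) (hΓ : 0 < Γ)
    {V V₁ V₂ : ℝ → ℝ} {C C₁ C₂ : ℝ}
    (hV : ∀ y, HasDerivAt V (V₁ y) y) (hV₁ : ∀ y, HasDerivAt V₁ (V₂ y) y)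
    (hC : ∀ y, |V y| ≤ C) (hC₁ : ∀ y, |V₁ y| ≤ C₁) (hC₂ : ∀ y, |V₂ y| ≤ C₂)
    {g g₁ g₂ g₃ g₄ : ℝ → ℂ} {G G₁ G₂ G₄ : ℝ}
    (hg : ∀ y, HasDerivAt g (g₁ y) y) (hg₁ : ∀ y, HasDerivAt g₁ (g₂ y) y)
    (hg₂ : ∀ y, HasDerivAt g₂ (g₃ y) y) (hg₃ : ∀ y, HasDerivAt g₃ (g₄ y) y)
    (hG : ∀ y, ‖g y‖ ≤ G) (hG₁ : ∀ y, ‖g₁ y‖ ≤ G₁) (hG₂ : ∀ y, ‖g₂ y‖ ≤ G₂)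
    (hG₄ : ∀ y, ‖g₄ y‖ ≤ G₄) {ε : ℝ} (hε : 0 < ε) (hsmall : ε * C / Γ ≤ 1) (x : ℝ) :
    ‖(∫ y, ((√(m / (2 * π * Γ * ε)) * exp (-(m * (x - y) ^ 2) / (2 * Γ * ε)) *
            exp (-(ε / (2 * Γ)) * (V x + V y)) : ℝ) : ℂ) * g y) - g x +
        ((ε / Γ : ℝ) : ℂ) * (-((Γ ^ 2 / (2 * m) : ℝ) : ℂ) * g₂ x + (V x : ℂ) * g x)‖
      ≤ ((C / Γ) ^ 2 * G + G₄ * (∫ z : ℝ, z ^ 4 ∂(gaussianReal 0 1)) * (Γ / m) ^ 2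
          + 1 / (2 * Γ) * ((C₂ * G + C₁ * G₁ + (C₁ * G₁ + 2 * C * G₂)) * (Γ / m))) * ε ^ 2 := by
  have hVc : Continuous V := continuous_iff_continuousAt.2 fun y => (hV y).continuousAt
  have hgc : Continuous g := continuous_iff_continuousAt.2 fun y => (hg y).continuousAt
  have hsum : ∀ y, |V x + V y| ≤ 2 * C := fun y =>
    (abs_add_le _ _).trans (by linarith [hC x, hC y])
  have hmul : ∀ {r R S : ℝ} {w : ℂ}, |r| ≤ R → ‖w‖ ≤ S → ‖(r : ℂ) * w‖ ≤ R * S :=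
    fun {r R S w} hr hw => by
      rw [norm_mul, Complex.norm_real]
      exact mul_le_mul hr hw (norm_nonneg _) ((abs_nonneg _).trans hr)
  have hh : ∀ y, HasDerivAt (fun y => ((V x + V y : ℝ) : ℂ) * g y)
      ((V₁ y : ℂ) * g y + ((V x + V y : ℝ) : ℂ) * g₁ y) y :=
    fun y => (((hV y).const_add (V x)).ofReal_comp).fun_mul (hg y)
  have hh' : ∀ y, HasDerivAt (fun y => (V₁ y : ℂ) * g y + ((V x + V y : ℝ) : ℂ) * g₁ y)
      (((V₂ y : ℂ) * g y + (V₁ y : ℂ) * g₁ y)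
        + ((V₁ y : ℂ) * g₁ y + ((V x + V y : ℝ) : ℂ) * g₂ y)) y :=
    fun y => ((hV₁ y).ofReal_comp.fun_mul (hg y)).fun_add
      ((((hV y).const_add (V x)).ofReal_comp).fun_mul (hg₁ y))
  have hT := norm_taylor_one_le hh hh' (K := (C₂ * G + C₁ * G₁) + (C₁ * G₁ + 2 * C * G₂))
    (fun y => norm_add_le_of_le
      (norm_add_le_of_le (hmul (hC₂ y) (hG y)) (hmul (hC₁ y) (hG₁ y)))
      (norm_add_le_of_le (hmul (hC₁ y) (hG₁ y)) (hmul (hsum y) (hG₂ y)))) x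
  have hTg := norm_taylor_three_le hg hg₁ hg₂ hg₃ hG₄ x
  have hv : 0 ≤ Γ * ε / m := by positivity
  set s := √(Γ * ε / m) with hs
  have hs2 : s ^ 2 = Γ * ε / m := Real.sq_sqrt hv
  have hs4 : s ^ 4 = (Γ * ε / m) ^ 2 := by rw [← hs2]; ring
  have A := norm_integral_exp_potential_sub_le hVc hC hgc hG hΓ hε hsmall x s
  have B := norm_integral_gaussianReal_sub_sub_le
    (hgc.integrable_comp_affine_gaussianReal hG x s) hTg
  have H := norm_integral_gaussianReal_sub_le
    (Continuous.integrable_comp_affine_gaussianReal (by fun_prop)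
      (fun y => hmul (hsum y) (hG y)) x s) hT
  have hI : ∫ y, ((√(m / (2 * π * Γ * ε)) * exp (-(m * (x - y) ^ 2) / (2 * Γ * ε)) *
            exp (-(ε / (2 * Γ)) * (V x + V y)) : ℝ) : ℂ) * g y
      = ∫ z, (exp (-(ε / (2 * Γ)) * (V x + V (x + s * z))) : ℂ) * g (x + s * z)
          ∂(gaussianReal 0 1) := by
    rw [hs, ← integral_heatKernel_smul_eq (f := fun y =>
      (exp (-(ε / (2 * Γ)) * (V x + V y)) : ℂ) * g y) hm hΓ hε (by fun_prop)]
    refine integral_congr_ae (ae_of_all _ fun y => ?_)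
    simp only [Complex.real_smul, Complex.ofReal_mul, mul_assoc]
  rw [hI]
  rw [hs2] at B H
  rw [hs4] at B
  generalize (∫ z, (exp (-(ε / (2 * Γ)) * (V x + V (x + s * z))) : ℂ) * g (x + s * z)
          ∂(gaussianReal 0 1)) = I₀ at A ⊢
  generalize (∫ z, g (x + s * z) ∂(gaussianReal 0 1)) = I₁ at A B
  generalize (∫ z, ((V x + V (x + s * z) : ℝ) : ℂ) * g (x + s * z)
          ∂(gaussianReal 0 1)) = I₂ at A H
  generalize (∫ z : ℝ, z ^ 4 ∂(gaussianReal 0 1)) = M at B ⊢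
  have hm0 : (m : ℂ) ≠ 0 := by exact_mod_cast hm.ne'
  have hΓ0 : (Γ : ℂ) ≠ 0 := by exact_mod_cast hΓ.ne'
  have key : I₀ - g x + ((ε / Γ : ℝ) : ℂ) *
        (-((Γ ^ 2 / (2 * m) : ℝ) : ℂ) * g₂ x + (V x : ℂ) * g x)
      = (I₀ - I₁ + ((ε / (2 * Γ) : ℝ) : ℂ) * I₂)
        + (I₁ - g x - (Γ * ε / m / 2) • g₂ x)
        - ((ε / (2 * Γ) : ℝ) : ℂ) * (I₂ - ((V x + V x : ℝ) : ℂ) * g x) := by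
    rw [Complex.real_smul]
    push_cast
    field_simp
    ring
  rw [key]
  refine (norm_sub_le_of_le (norm_add_le_of_le A B)
    (hmul (abs_of_pos (by positivity)).le H)).trans (le_of_eq ?_)
  ring

/-- for the kernel
`F_ε(x, x') = √(m/(2πΓε)) exp(-m(x-x')²/(2Γε)) exp(-(ε/(2Γ))(V x + V x'))`,
one has `∫ F_ε(x, x') g(x') dx' = g(x) - (ε/Γ)(H g)(x) + O(ε²)` as `ε → 0⁺`,
where `H g = -(Γ²/(2m)) g'' + V g`. -/
theorem stmt11
    (m Γ : ℝ) (hm : 0 < m) (hΓ : 0 < Γ)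
    (V : ℝ → ℝ) (hV : ContDiff ℝ 2 V)
    (hVb : ∃ C, ∀ x, |V x| ≤ C)
    (hV'b : ∃ C, ∀ x, |deriv V x| ≤ C)
    (hV''b : ∃ C, ∀ x, |deriv (deriv V) x| ≤ C)
    (g : SchwartzMap ℝ ℂ)
    (F : ℝ → ℝ → ℝ → ℝ)
    (hF : ∀ ε x x', F ε x x' =
      Real.sqrt (m / (2 * Real.pi * Γ * ε)) *
        Real.exp (-(m * (x - x') ^ 2) / (2 * Γ * ε)) *
        Real.exp (-(ε / (2 * Γ)) * (V x + V x'))) :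
    ∀ x : ℝ,
      (fun ε : ℝ =>
          (∫ x', (F ε x x' : ℂ) * g x') - g x +
            ((ε / Γ : ℝ) : ℂ) *
              (-((Γ ^ 2 / (2 * m) : ℝ) : ℂ) * deriv (deriv (g : ℝ → ℂ)) x +
                (V x : ℂ) * g x))
        =O[nhdsWithin 0 (Set.Ioi 0)] (fun ε : ℝ => ε ^ 2) := by
  intro x
  obtain ⟨C, hC⟩ := hVb
  obtain ⟨C₁, hC₁⟩ := hV'b
  obtain ⟨C₂, hC₂⟩ := hV''b
  let D := SchwartzMap.derivCLM ℝ ℂ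
  have hD : ∀ (f : SchwartzMap ℝ ℂ) y, HasDerivAt f (D f y) y := fun f y => f.hasDerivAt y
  have hb : ∀ (f : SchwartzMap ℝ ℂ) y, ‖f y‖ ≤ SchwartzMap.seminorm ℝ 0 0 f :=
    SchwartzMap.norm_le_seminorm ℝ
  have hVd : ∀ y, HasDerivAt V (deriv V y) y := fun y =>
    (hV.differentiable (by norm_num) y).hasDerivAt
  have hVd' : ∀ y, HasDerivAt (deriv V) (deriv (deriv V) y) y := fun y =>
    (((contDiff_succ_iff_deriv (n := 1)).1 hV).2.2.differentiable (by norm_num) y).hasDerivAt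
  have hsmall : ∀ᶠ ε in nhdsWithin (0 : ℝ) (Set.Ioi 0), ε * C / Γ ≤ 1 := by
    have : Tendsto (fun ε : ℝ => ε * C / Γ) (nhds 0) (nhds 0) := by
      have : Continuous fun ε : ℝ => ε * C / Γ := by fun_prop
      simpa using this.tendsto 0
    exact (this.mono_left nhdsWithin_le_nhds).eventually_le_const one_pos
  refine IsBigO.of_bound ?const ?bound
  case bound =>
    filter_upwards [hsmall, self_mem_nhdsWithin] with ε hε1 hε
    rw [Real.norm_of_nonneg (sq_nonneg ε)]
    simp only [hF]
    exact norm_integral_shortTimeKernel_sub_le hm hΓ hVd hVd' hC hC₁ hC₂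
      (hD g) (hD (D g)) (hD (D (D g))) (hD (D (D (D g))))
      (hb g) (hb _) (hb _) (hb _) hε hε1 x
end

section
/- Let m, ℏ, e, c > 0 be real constants, let V : ℝ³ → ℝ and A : ℝ³ → ℝ³ be smooth functions all of whose derivatives up to order 2 are bounded, and let ψ : ℝ³ → ℂ be a Schwartz function. For ε > 0 define the complex kernel C_ε(x, x′) := (m/(2·π·ℏ·ε))^{3/2} · exp( −(ε/ℏ)·[ m·‖x − x′‖²/(2·ε²) + V((x + x′)/2) − i·(e/c)·((x − x′)/ε)·A((x + x′)/2) ] ), where · between vectors denotes the Euclidean inner product. Then for every x ∈ ℝ³, the function ε ↦ (∫ C_ε(x, x′)·ψ(x′) dx′) − ψ(x) − (ε/ℏ)·[ (ℏ²/(2·m))·( Δψ(x) − (e/(ℏ·c))²·‖A(x)‖²·ψ(x) − i·(e/(ℏ·c))·( 2·A(x)·∇ψ(x) + (div A)(x)·ψ(x) ) ) − V(x)·ψ(x) ] is O(ε²) as ε → 0 from the right. -/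
open MeasureTheory Asymptotics Filter Real
open scoped RealInnerProductSpace

noncomputable section

local notation "E3" => EuclideanSpace ℝ (Fin 3)

/-- Laplacian of `ψ : ℝ³ → ℂ`, as the sum of second directional derivatives
along the standard orthonormal basis. -/
def lap3 (ψ : EuclideanSpace ℝ (Fin 3) → ℂ) (x : EuclideanSpace ℝ (Fin 3)) : ℂ :=
  ∑ i : Fin 3,
    fderiv ℝ (fun y => fderiv ℝ ψ y (EuclideanSpace.single i 1)) x
      (EuclideanSpace.single i 1)

/-- Divergence of a vector field `A : ℝ³ → ℝ³`. -/
def div3 (A : EuclideanSpace ℝ (Fin 3) → EuclideanSpace ℝ (Fin 3))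
    (x : EuclideanSpace ℝ (Fin 3)) : ℝ :=
  ∑ i : Fin 3,
    ⟪fderiv ℝ A x (EuclideanSpace.single i 1), EuclideanSpace.single i 1⟫

section GaussianWeight

variable {E : Type*} [NormedAddCommGroup E] [InnerProductSpace ℝ E] {b : ℝ}

/-- The density of the centred Gaussian probability measure with variance `1 / (2 * b)` in every
direction. -/
def gaussianWeight (b : ℝ) (u : E) : ℝ :=
  (b / π) ^ (Module.finrank ℝ E / 2 : ℝ) * rexp (-b * ‖u‖ ^ 2)

theorem gaussianWeight_nonneg (hb : 0 < b) (u : E) : 0 ≤ gaussianWeight b u := by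
  unfold gaussianWeight
  positivity

theorem gaussianWeight_neg (u : E) : gaussianWeight b (-u) = gaussianWeight b u := by
  simp [gaussianWeight]

theorem continuous_gaussianWeight : Continuous (gaussianWeight b : E → ℝ) := by
  unfold gaussianWeight
  fun_prop

theorem hasFDerivAt_gaussianWeight (u : E) :
    HasFDerivAt (gaussianWeight b : E → ℝ) (gaussianWeight b u • (-(2 * b)) • innerSL ℝ u) u := by
  have h := (((hasStrictFDerivAt_norm_sq u).hasFDerivAt.const_mul (-b)).exp).const_mul
    ((b / π) ^ (Module.finrank ℝ E / 2 : ℝ))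
  refine h.congr_fderiv ?_
  ext v
  simp [gaussianWeight]
  ring

variable [FiniteDimensional ℝ E] [MeasurableSpace E] [BorelSpace E]
  {F : Type*} [NormedAddCommGroup F] [NormedSpace ℝ F]

theorem integral_gaussianWeight (hb : 0 < b) : ∫ u : E, gaussianWeight b u = 1 := by
  unfold gaussianWeight
  rw [integral_const_mul, GaussianFourier.integral_rexp_neg_mul_sq_norm hb,
    ← mul_rpow (by positivity) (by positivity), div_mul_div_cancel₀ pi_ne_zero, div_self hb.ne',
    one_rpow]

theorem integrable_rexp_neg_mul_sq_norm (hb : 0 < b) :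
    Integrable fun u : E => rexp (-b * ‖u‖ ^ 2) := by
  by_contra h
  have h0 := GaussianFourier.integral_rexp_neg_mul_sq_norm (V := E) hb
  rw [integral_undef h] at h0
  have : 0 < (π / b) ^ (Module.finrank ℝ E / 2 : ℝ) := by positivity
  exact this.ne h0

theorem integrable_gaussianWeight_mul (hb : 0 < b) :
    Integrable fun u : E => gaussianWeight b u * (1 + ‖u‖ ^ 4) := by
  have hint := (integrable_rexp_neg_mul_sq_norm (E := E) (half_pos hb)).const_mul
    ((b / π) ^ (Module.finrank ℝ E / 2 : ℝ) * (1 + 8 / b ^ 2))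
  refine hint.mono' (continuous_gaussianWeight.mul (by fun_prop)).aestronglyMeasurable
    (.of_forall fun u => ?_)
  rw [norm_of_nonneg (mul_nonneg (gaussianWeight_nonneg hb u) (by positivity)), gaussianWeight,
    mul_assoc, mul_assoc]
  refine mul_le_mul_of_nonneg_left ?_ (by positivity)
  have hexp := Real.quadratic_le_exp_of_nonneg (x := b / 2 * ‖u‖ ^ 2) (by positivity)
  have hsplit : rexp (-b * ‖u‖ ^ 2) = rexp (-(b / 2) * ‖u‖ ^ 2) * rexp (-(b / 2 * ‖u‖ ^ 2)) := by
    rw [← Real.exp_add]; ring_nf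
  rw [hsplit, mul_assoc, mul_comm]
  refine mul_le_mul_of_nonneg_right ?_ (Real.exp_pos _).le
  rw [Real.exp_neg, inv_mul_le_iff₀ (Real.exp_pos _), mul_comm]
  have h4 : ‖u‖ ^ 4 = 8 / b ^ 2 * ((b / 2 * ‖u‖ ^ 2) ^ 2 / 2) := by field_simp; ring
  have h1 : 0 ≤ b / 2 * ‖u‖ ^ 2 := by positivity
  have h8 : 0 ≤ 8 / b ^ 2 := by positivity
  nlinarith [sq_nonneg (b / 2 * ‖u‖ ^ 2), mul_le_mul_of_nonneg_left hexp h8, mul_nonneg h8 h1]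

theorem integrable_gaussianWeight_smul (hb : 0 < b) {f : E → F} (hf : Continuous f) (C : ℝ)
    (hC : ∀ u, ‖f u‖ ≤ C * (1 + ‖u‖ ^ 4)) : Integrable fun u => gaussianWeight b u • f u := by
  refine ((integrable_gaussianWeight_mul hb).const_mul C).mono'
    (continuous_gaussianWeight.smul hf).aestronglyMeasurable (.of_forall fun u => ?_)
  rw [norm_smul, norm_of_nonneg (gaussianWeight_nonneg hb u)]
  nlinarith [mul_le_mul_of_nonneg_left (hC u) (gaussianWeight_nonneg hb u)]

theorem integrable_gaussianWeight_smul_of_bounded (hb : 0 < b) {f : E → F} (hf : Continuous f)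
    {M : ℝ} (hM : ∀ u, ‖f u‖ ≤ M) : Integrable fun u => gaussianWeight b u • f u := by
  refine integrable_gaussianWeight_smul hb hf M fun u => (hM u).trans ?_
  have := (norm_nonneg _).trans (hM u)
  nlinarith [mul_nonneg this (pow_nonneg (norm_nonneg u) 4)]

theorem integrable_gaussianWeight_bilin (hb : 0 < b) (B : E →L[ℝ] E →L[ℝ] F) :
    Integrable fun u => gaussianWeight b u • B u u := by
  refine integrable_gaussianWeight_smul hb (by fun_prop) ‖B‖ fun u => (B.le_opNorm₂ u u).trans ?_
  rw [mul_assoc]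
  gcongr
  nlinarith [sq_nonneg (‖u‖ ^ 2 - 1)]

theorem integrable_gaussianWeight_inner_smul (hb : 0 < b) (L : E →L[ℝ] F) (v : E) :
    Integrable fun u => gaussianWeight b u • ⟪u, v⟫ • L u := by
  simpa [real_inner_comm] using integrable_gaussianWeight_bilin hb ((innerSL ℝ v).smulRight L)

/-- Integration by parts against the Gaussian weight, for a linear function. -/
theorem integral_gaussianWeight_inner_smul (hb : 0 < b) (L : E →L[ℝ] F) [CompleteSpace F] (v : E) :
    ∫ u, gaussianWeight b u • ⟪u, v⟫ • L u = (2 * b)⁻¹ • L v := by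
  have hint₁ : Integrable fun u : E => gaussianWeight b u • L v :=
    integrable_gaussianWeight_smul_of_bounded hb continuous_const fun _ => le_rfl
  have hint₂ : Integrable fun u => gaussianWeight b u • L u := by
    refine integrable_gaussianWeight_smul hb (by fun_prop) ‖L‖ fun u => (L.le_opNorm u).trans ?_
    gcongr
    nlinarith [sq_nonneg (‖u‖ ^ 2 - 1), sq_nonneg (‖u‖ - 1)]
  have hint₃ := integrable_gaussianWeight_inner_smul hb L v
  have hkey := integral_bilinear_hasFDerivAt_right_eq_neg_left_of_integrable
    (μ := (volume : Measure E)) (f := gaussianWeight b) (g := L) (g' := fun _ => L) (v := v)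
    (B := ContinuousLinearMap.lsmul ℝ ℝ)
    (f' := fun u => gaussianWeight b u • (-(2 * b)) • innerSL ℝ u)
    (by
      refine (hint₃.smul (-(2 * b))).congr (.of_forall fun u => ?_)
      simp [smul_smul]
      ring_nf)
    (by simpa using hint₁) (by simpa using hint₂)
    (fun u _ => hasFDerivAt_gaussianWeight u) (fun u _ => L.hasFDerivAt)
  simp only [ContinuousLinearMap.lsmul_apply, integral_smul_const, integral_gaussianWeight hb,
    one_smul] at hkey
  have hneg : ∀ u, (gaussianWeight b u • (-(2 * b)) • innerSL ℝ u) v • L u =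
      (-(2 * b)) • (gaussianWeight b u • ⟪u, v⟫ • L u) := fun u => by
    simp [smul_smul]
    ring_nf
  simp only [hneg] at hkey
  rw [integral_smul, neg_smul, neg_neg] at hkey
  rw [hkey, smul_smul, inv_mul_cancel₀ (by positivity), one_smul]

theorem integral_gaussianWeight_bilin (hb : 0 < b) [CompleteSpace F] {ι : Type*} [Fintype ι]
    (v : OrthonormalBasis ι ℝ E) (B : E →L[ℝ] E →L[ℝ] F) :
    ∫ u, gaussianWeight b u • B u u = (2 * b)⁻¹ • ∑ i, B (v i) (v i) := by
  have hsum : ∀ u, gaussianWeight b u • B u u =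
      ∑ i, gaussianWeight b u • ⟪u, v i⟫ • B.flip (v i) u := fun u => by
    rw [← Finset.smul_sum]
    congr 1
    conv_lhs => arg 2; rw [← v.sum_repr' u]
    simp only [map_sum, map_smul, ContinuousLinearMap.flip_apply, real_inner_comm]
  simp_rw [hsum]
  rw [integral_finsetSum _ fun i _ => integrable_gaussianWeight_inner_smul hb _ _, Finset.smul_sum]
  exact Finset.sum_congr rfl fun i _ => integral_gaussianWeight_inner_smul hb (B.flip (v i)) (v i)

end GaussianWeight

section Taylor

open scoped ContDiff

variable {E : Type*} [NormedAddCommGroup E] [NormedSpace ℝ E]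
  {F : Type*} [NormedAddCommGroup F] [NormedSpace ℝ F]

theorem fderiv_comp_neg (f : E → F) (x : E) :
    fderiv ℝ (fun y => f (-y)) x = -fderiv ℝ f (-x) := by
  ext v
  have h := (ContinuousLinearEquiv.neg ℝ (M := E)).comp_right_fderiv (f := f) (x := x)
  exact (DFunLike.congr_fun h v).trans (by simp)

theorem Function.Even.odd_fderiv {f : E → F} (hf : f.Even) : (fderiv ℝ f).Odd := fun x => by
  have h := fderiv_comp_neg f x
  simp only [hf.eq] at h
  rw [h, neg_neg]

theorem Function.Odd.even_fderiv {f : E → F} (hf : f.Odd) : (fderiv ℝ f).Even := fun x => by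
  have h := fderiv_comp_neg f x
  have hneg : (fun y => f (-y)) = fun y => -f y := funext hf
  rw [hneg, fderiv_fun_neg] at h
  exact (neg_injective h).symm

theorem Function.Odd.map_zero_of_real {E : Type*} [NormedAddCommGroup E] {f : E → F}
    (hf : f.Odd) : f 0 = 0 := by
  have h := hf 0
  rw [neg_zero] at h
  rwa [eq_neg_iff_add_eq_zero, ← two_smul ℝ, smul_eq_zero_iff_right two_ne_zero] at h

theorem isBigO_norm_pow_succ_of_fderiv {f : E → F} {n : ℕ} (hf : Differentiable ℝ f)
    (h0 : f 0 = 0) (h : fderiv ℝ f =O[nhds 0] fun x => ‖x‖ ^ n) :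
    f =O[nhds 0] fun x => ‖x‖ ^ (n + 1) := by
  obtain ⟨C, hC, hbound⟩ := h.exists_nonneg
  obtain ⟨δ, hδ, hball⟩ := Metric.eventually_nhds_iff_ball.mp hbound.bound
  refine IsBigO.of_bound C (Metric.eventually_nhds_iff_ball.mpr ⟨δ, hδ, fun x hx => ?_⟩)
  have hmv := (convex_closedBall (0 : E) ‖x‖).norm_image_sub_le_of_norm_fderiv_le (𝕜 := ℝ)
    (f := f) (C := C * ‖x‖ ^ n) (x := 0) (y := x) (fun y _ => hf y) (fun y hy => ?_)
    (by simp) (by simp)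
  · simpa [h0, pow_succ, mul_assoc] using hmv
  · rw [mem_closedBall_zero_iff] at hy
    rw [mem_ball_zero_iff] at hx
    refine (hball y (mem_ball_zero_iff.mpr (hy.trans_lt hx))).trans ?_
    rw [norm_pow, norm_norm]
    gcongr

theorem Function.Even.isBigO_norm_sq {f : E → F} (hf : f.Even) (hsmooth : ContDiff ℝ ∞ f)
    (h0 : f 0 = 0) : f =O[nhds 0] fun x => ‖x‖ ^ 2 := by
  have h1 : ContDiff ℝ ∞ (fderiv ℝ f) := hsmooth.fderiv_right le_rfl
  refine isBigO_norm_pow_succ_of_fderiv (hsmooth.differentiable (by simp)) h0 ?_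
  refine isBigO_norm_pow_succ_of_fderiv (h1.differentiable (by simp))
    hf.odd_fderiv.map_zero_of_real ?_
  simpa using (h1.continuous_fderiv (by simp)).continuousAt.isBigO_one ℝ

theorem Function.Odd.isBigO_norm_pow_three {f : E → F} (hf : f.Odd) (hsmooth : ContDiff ℝ ∞ f)
    (h1 : fderiv ℝ f 0 = 0) : f =O[nhds 0] fun x => ‖x‖ ^ 3 :=
  isBigO_norm_pow_succ_of_fderiv (hsmooth.differentiable (by simp)) hf.map_zero_of_real
    (hf.even_fderiv.isBigO_norm_sq (hsmooth.fderiv_right le_rfl) h1)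

theorem Function.Even.isBigO_norm_pow_four {f : E → F} (hf : f.Even) (hsmooth : ContDiff ℝ ∞ f)
    (h0 : f 0 = 0) (h2 : fderiv ℝ (fderiv ℝ f) 0 = 0) : f =O[nhds 0] fun x => ‖x‖ ^ 4 :=
  isBigO_norm_pow_succ_of_fderiv (hsmooth.differentiable (by simp)) h0
    (hf.odd_fderiv.isBigO_norm_pow_three (hsmooth.fderiv_right le_rfl) h2)

/-- The remainder of the second order Taylor expansion at `0` of the even part of `f`. -/
def evenRemainder (f : E → F) (x : E) : F :=
  (2 : ℝ)⁻¹ • (f x + f (-x)) - f 0 - (2 : ℝ)⁻¹ • fderiv ℝ (fderiv ℝ f) 0 x x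

theorem even_evenRemainder (f : E → F) : (evenRemainder f).Even := fun x => by
  simp [evenRemainder, add_comm]

theorem fderiv_bilin_diag (B : E →L[ℝ] E →L[ℝ] F) :
    fderiv ℝ (fun x => B x x) = fun x => B x + B.flip x := by
  ext x v
  rw [fderiv_clm_apply B.differentiableAt differentiableAt_fun_id]
  simp

theorem fderiv_oddPart_sub_half {f : E → F} (hf : DifferentiableAt ℝ f 0) (L : E →L[ℝ] F) :
    fderiv ℝ (fun x => (2 : ℝ)⁻¹ • (f x - f (-x)) - (2 : ℝ)⁻¹ • L x) 0 =
      fderiv ℝ f 0 - (2 : ℝ)⁻¹ • L := by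
  have hneg : DifferentiableAt ℝ (fun x => f (-x)) 0 :=
    DifferentiableAt.comp (0 : E) (by rwa [neg_zero]) differentiableAt_fun_id.neg
  rw [fderiv_fun_sub ((hf.fun_sub hneg).fun_const_smul _) (by fun_prop),
    fderiv_fun_const_smul (hf.fun_sub hneg), fderiv_fun_const_smul (by fun_prop),
    fderiv_fun_sub hf hneg, fderiv_comp_neg, neg_zero, L.fderiv,
    sub_neg_eq_add, ← two_smul ℝ, smul_smul, inv_mul_cancel₀ two_ne_zero, one_smul]

theorem fderiv_fderiv_evenRemainder {f : E → F} (hf : ContDiff ℝ ∞ f) :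
    fderiv ℝ (fderiv ℝ (evenRemainder f)) 0 = 0 := by
  have h1 : ContDiff ℝ ∞ (fderiv ℝ f) := hf.fderiv_right le_rfl
  have hd := hf.differentiable (by simp)
  have hsymm : IsSymmSndFDerivAt ℝ f 0 :=
    hf.contDiffAt.isSymmSndFDerivAt (by simpa using ENat.LEInfty.out)
  set B := fderiv ℝ (fderiv ℝ f) 0 with hB
  have hfst : fderiv ℝ (evenRemainder f) = fun x =>
      (2 : ℝ)⁻¹ • (fderiv ℝ f x - fderiv ℝ f (-x)) - (2 : ℝ)⁻¹ • (B + B.flip) x := by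
    funext x
    unfold evenRemainder
    rw [fderiv_fun_sub (by fun_prop) (by fun_prop), fderiv_sub_const,
      fderiv_fun_const_smul (by fun_prop), fderiv_fun_const_smul (by fun_prop),
      fderiv_fun_add (by fun_prop) (by fun_prop), fderiv_comp_neg, fderiv_bilin_diag,
      ← sub_eq_add_neg]
    rfl
  rw [hfst, fderiv_oddPart_sub_half (h1.differentiable (by simp) 0)]
  ext v w
  have hvw : B w v = B v w := hsymm.eq w v
  simp [hvw, ← hB]
  module

theorem contDiff_evenRemainder {f : E → F} (hf : ContDiff ℝ ∞ f) :
    ContDiff ℝ ∞ (evenRemainder f) := by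
  unfold evenRemainder
  fun_prop

theorem exists_norm_evenRemainder_le {f : E → F} (hf : ContDiff ℝ ∞ f) {M : ℝ}
    (hM : ∀ x, ‖f x‖ ≤ M) : ∃ C, ∀ x, ‖evenRemainder f x‖ ≤ C * ‖x‖ ^ 4 := by
  obtain ⟨C, hC, hbound⟩ := ((even_evenRemainder f).isBigO_norm_pow_four (contDiff_evenRemainder hf)
    (by simp [evenRemainder, ← two_smul ℝ (f 0), smul_smul])
    (fderiv_fderiv_evenRemainder hf)).exists_nonneg
  obtain ⟨δ, hδ, hball⟩ := Metric.eventually_nhds_iff_ball.mp hbound.bound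
  set B := fderiv ℝ (fderiv ℝ f) 0
  have hM0 : 0 ≤ M := (norm_nonneg _).trans (hM 0)
  refine ⟨C + (2 * M / δ ^ 4 + ‖B‖ / δ ^ 2), fun x => ?_⟩
  rcases lt_or_ge ‖x‖ δ with hx | hx
  · refine (hball x (mem_ball_zero_iff.mpr hx)).trans ?_
    rw [norm_pow, norm_norm]
    gcongr
    exact le_add_of_nonneg_right (by positivity)
  · have hR : ‖evenRemainder f x‖ ≤ 2 * M + ‖B‖ * ‖x‖ ^ 2 := by
      have h1 := norm_sub_le ((2 : ℝ)⁻¹ • (f x + f (-x)) - f 0) ((2 : ℝ)⁻¹ • B x x)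
      have h2 := norm_sub_le ((2 : ℝ)⁻¹ • (f x + f (-x))) (f 0)
      have h3 := norm_add_le (f x) (f (-x))
      have h4 := B.le_opNorm₂ x x
      rw [norm_smul _ (B x x)] at h1
      rw [norm_smul] at h2
      have h5 : ‖(2 : ℝ)⁻¹‖ = 2⁻¹ := by norm_num
      rw [h5] at h1 h2
      have := hM x
      have := hM (-x)
      have := hM 0
      have := norm_nonneg (B x x)
      change ‖(2 : ℝ)⁻¹ • (f x + f (-x)) - f 0 - (2 : ℝ)⁻¹ • B x x‖ ≤ _
      nlinarith
    have hq : 1 ≤ ‖x‖ ^ 2 / δ ^ 2 := by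
      rw [one_le_div (by positivity)]
      gcongr
    have hq2 : 1 ≤ ‖x‖ ^ 4 / δ ^ 4 := by
      rw [one_le_div (by positivity)]
      gcongr
    calc ‖evenRemainder f x‖ ≤ 2 * M * 1 + ‖B‖ * ‖x‖ ^ 2 * 1 := by simpa using hR
      _ ≤ 2 * M * (‖x‖ ^ 4 / δ ^ 4) + ‖B‖ * ‖x‖ ^ 2 * (‖x‖ ^ 2 / δ ^ 2) := by gcongr
      _ = (2 * M / δ ^ 4 + ‖B‖ / δ ^ 2) * ‖x‖ ^ 4 := by ring
      _ ≤ _ := mul_le_mul_of_nonneg_right (le_add_of_nonneg_left hC) (by positivity)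

end Taylor

section Expansion

open scoped ContDiff

variable {E : Type*} [NormedAddCommGroup E] [InnerProductSpace ℝ E] [FiniteDimensional ℝ E]
  [MeasurableSpace E] [BorelSpace E] {F : Type*} [NormedAddCommGroup F] [NormedSpace ℝ F] {b : ℝ}

theorem integral_gaussianWeight_smul_comp_smul (hb : 0 < b) {f : E → F} (hf : Continuous f)
    {M : ℝ} (hM : ∀ x, ‖f x‖ ≤ M) (s : ℝ) :
    ∫ u, gaussianWeight b u • f (s • u) =
      ∫ u, gaussianWeight b u • (2 : ℝ)⁻¹ • (f (s • u) + f (-(s • u))) := by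
  have hint : Integrable fun u => gaussianWeight b u • f (s • u) :=
    integrable_gaussianWeight_smul_of_bounded hb (by fun_prop) fun u => hM _
  have hint' : Integrable fun u => gaussianWeight b u • f (-(s • u)) :=
    integrable_gaussianWeight_smul_of_bounded hb (by fun_prop) fun u => hM _
  have hneg : ∫ u, gaussianWeight b u • f (-(s • u)) = ∫ u, gaussianWeight b u • f (s • u) := by
    rw [← integral_neg_eq_self]
    simp [gaussianWeight_neg]
  simp_rw [smul_comm _ (2 : ℝ)⁻¹, smul_add]
  rw [integral_add (hint.fun_smul _) (hint'.fun_smul _), integral_smul, integral_smul, hneg,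
    ← smul_add, ← two_smul ℝ, smul_smul, inv_mul_cancel₀ two_ne_zero, one_smul]

/-- Averaging a bounded smooth function against a Gaussian of variance `s ^ 2 / (2 * b)` is the
identity plus a multiple of the Laplacian, up to an error of order `s ^ 4`. -/
theorem exists_norm_integral_gaussianWeight_sub_le (hb : 0 < b) [CompleteSpace F]
    {ι : Type*} [Fintype ι] (v : OrthonormalBasis ι ℝ E) {f : E → F} (hf : ContDiff ℝ ∞ f)
    {M : ℝ} (hM : ∀ x, ‖f x‖ ≤ M) :
    ∃ C, ∀ s : ℝ, ‖(∫ u, gaussianWeight b u • f (s • u)) - f 0 -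
      (s ^ 2 / (4 * b)) • ∑ i, fderiv ℝ (fderiv ℝ f) 0 (v i) (v i)‖ ≤ C * s ^ 4 := by
  obtain ⟨C, hC⟩ := exists_norm_evenRemainder_le hf hM
  set B := fderiv ℝ (fderiv ℝ f) 0 with hB
  have hint4 : Integrable fun u : E => gaussianWeight b u • ‖u‖ ^ 4 :=
    integrable_gaussianWeight_smul hb (by fun_prop) 1 fun u => by
      rw [norm_pow, norm_norm, one_mul]
      exact le_add_of_nonneg_left zero_le_one
  refine ⟨C * ∫ u : E, gaussianWeight b u • ‖u‖ ^ 4, fun s => ?_⟩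
  have hconst : Integrable fun u : E => gaussianWeight b u • f 0 :=
    integrable_gaussianWeight_smul_of_bounded hb continuous_const fun _ => le_rfl
  have hquad := (integrable_gaussianWeight_bilin hb B).fun_smul (s ^ 2 / 2)
  have hremBound : ∀ u, ‖gaussianWeight b u • evenRemainder f (s • u)‖ ≤
      (C * s ^ 4) * (gaussianWeight b u • ‖u‖ ^ 4) := fun u => by
    rw [norm_smul, norm_of_nonneg (gaussianWeight_nonneg hb u)]
    have h := mul_le_mul_of_nonneg_left (hC (s • u)) (gaussianWeight_nonneg hb u)
    refine h.trans_eq ?_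
    rw [norm_smul, mul_pow, norm_eq_abs, Even.pow_abs (by decide), smul_eq_mul]
    ring
  have hrem : Integrable fun u => gaussianWeight b u • evenRemainder f (s • u) :=
    (hint4.const_mul (C * s ^ 4)).mono'
      (continuous_gaussianWeight.smul
        ((contDiff_evenRemainder hf).continuous.comp (by fun_prop))).aestronglyMeasurable
      (.of_forall hremBound)
  have hsplit : ∀ u, gaussianWeight b u • (2 : ℝ)⁻¹ • (f (s • u) + f (-(s • u))) =
      gaussianWeight b u • f 0 + (s ^ 2 / 2) • gaussianWeight b u • B u u +
        gaussianWeight b u • evenRemainder f (s • u) := fun u => by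
    simp only [evenRemainder, ← hB, map_smul, smul_apply]
    module
  rw [integral_gaussianWeight_smul_comp_smul hb hf.continuous hM]
  simp_rw [hsplit]
  rw [integral_add (hconst.fun_add hquad) hrem, integral_add hconst hquad, integral_smul_const,
    integral_gaussianWeight hb, one_smul, integral_smul, integral_gaussianWeight_bilin hb v,
    smul_smul]
  have hcoef : s ^ 2 / 2 * (2 * b)⁻¹ = s ^ 2 / (4 * b) := by field_simp; norm_num
  rw [hcoef, add_assoc, add_sub_cancel_left, add_sub_cancel_left]
  refine (norm_integral_le_integral_norm _).trans ?_
  refine (integral_mono hrem.norm (hint4.const_mul (C * s ^ 4)) hremBound).trans_eq ?_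
  rw [integral_const_mul]
  ring

/-- The Trotter-type expansion of a Gaussian average weighted by `exp (-s ^ 2 W)`. -/
theorem exists_norm_integral_gaussianWeight_exp_sub_le (hb : 0 < b)
    {ι : Type*} [Fintype ι] (v : OrthonormalBasis ι ℝ E) {f : E → ℂ} (hf : ContDiff ℝ ∞ f)
    {M : ℝ} (hM : ∀ x, ‖f x‖ ≤ M) {W : E → ℝ} (hW : ContDiff ℝ ∞ W) {K : ℝ}
    (hK : ∀ x, ‖W x‖ ≤ K) :
    ∃ C, ∀ s : ℝ, s ^ 2 * K ≤ 1 → s ^ 2 ≤ 1 →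
      ‖(∫ u, gaussianWeight b u • (Complex.exp (-(s ^ 2 * W (s • u) : ℝ)) * f (s • u))) - f 0 -
        ((s ^ 2 / (4 * b)) • ∑ i, fderiv ℝ (fderiv ℝ f) 0 (v i) (v i) -
          (s ^ 2) • (W 0 * f 0))‖ ≤ C * s ^ 4 := by
  have hK0 : 0 ≤ K := (norm_nonneg _).trans (hK 0)
  have hM0 : 0 ≤ M := (norm_nonneg _).trans (hM 0)
  have hWf : ContDiff ℝ ∞ fun x => (W x : ℂ) * f x :=
    (Complex.ofRealCLM.contDiff.comp hW).mul hf
  have hWfM : ∀ x, ‖(W x : ℂ) * f x‖ ≤ K * M := fun x => by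
    rw [norm_mul, Complex.norm_real]
    gcongr
    exacts [hK x, hM x]
  obtain ⟨C₁, hC₁⟩ := exists_norm_integral_gaussianWeight_sub_le hb v hf hM
  obtain ⟨C₂, hC₂⟩ := exists_norm_integral_gaussianWeight_sub_le hb v hWf hWfM
  set T₁ := ∑ i, fderiv ℝ (fderiv ℝ f) 0 (v i) (v i)
  set T₂ := ∑ i, fderiv ℝ (fderiv ℝ fun x => (W x : ℂ) * f x) 0 (v i) (v i)
  refine ⟨C₁ + (‖T₂‖ / (4 * b) + |C₂|) + K ^ 2 * M, fun s hs hs1 => ?_⟩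
  have hWs : Continuous fun u => W (s • u) := hW.continuous.comp (by fun_prop)
  have hfs : Continuous fun u => f (s • u) := hf.continuous.comp (by fun_prop)
  have hint₁ : Integrable fun u => gaussianWeight b u • f (s • u) :=
    integrable_gaussianWeight_smul_of_bounded hb hfs fun u => hM _
  have hint₂ : Integrable fun u => gaussianWeight b u • ((W (s • u) : ℂ) * f (s • u)) :=
    integrable_gaussianWeight_smul_of_bounded hb (by fun_prop) fun u => hWfM _
  let ρ : E → ℂ := fun u => (Complex.exp (-(s ^ 2 * W (s • u) : ℝ)) - 1 -
    (-(s ^ 2 * W (s • u) : ℝ))) * f (s • u)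
  have hρ : ∀ u, ‖ρ u‖ ≤ K ^ 2 * M * s ^ 4 := fun u => by
    have hz : ‖(-(s ^ 2 * W (s • u) : ℝ) : ℂ)‖ ≤ s ^ 2 * K := by
      rw [norm_neg, Complex.norm_real, norm_mul, norm_of_nonneg (sq_nonneg s)]
      gcongr
      exact hK _
    have he := Complex.norm_exp_sub_one_sub_id_le (hz.trans hs)
    calc ‖ρ u‖ ≤ (s ^ 2 * K) ^ 2 * M := by
          rw [norm_mul]
          gcongr
          exacts [he.trans (by gcongr), hM _]
      _ = K ^ 2 * M * s ^ 4 := by ring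
  have hint₃ : Integrable fun u => gaussianWeight b u • ρ u :=
    integrable_gaussianWeight_smul_of_bounded hb (by fun_prop) hρ
  have hρint : ‖∫ u, gaussianWeight b u • ρ u‖ ≤ K ^ 2 * M * s ^ 4 := by
    have hw := (integrable_gaussianWeight_smul_of_bounded (E := E) hb continuous_const
      (fun _ => le_rfl (a := ‖(1 : ℝ)‖)))
    simp only [smul_eq_mul, mul_one] at hw
    calc ‖∫ u, gaussianWeight b u • ρ u‖
        ≤ ∫ u : E, gaussianWeight b u * (K ^ 2 * M * s ^ 4) := by
          refine norm_integral_le_of_norm_le (hw.mul_const _) (.of_forall fun u => ?_)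
          rw [norm_smul, norm_of_nonneg (gaussianWeight_nonneg hb u)]
          exact mul_le_mul_of_nonneg_left (hρ u) (gaussianWeight_nonneg hb u)
      _ = K ^ 2 * M * s ^ 4 := by rw [integral_mul_const, integral_gaussianWeight hb, one_mul]
  have hsplit : ∀ u, gaussianWeight b u • (Complex.exp (-(s ^ 2 * W (s • u) : ℝ)) * f (s • u)) =
      gaussianWeight b u • f (s • u) - (s ^ 2) • gaussianWeight b u • ((W (s • u) : ℂ) * f (s • u))
        + gaussianWeight b u • ρ u := fun u => by
    simp only [ρ, Complex.real_smul]
    push_cast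
    ring
  have hint₁₂ : Integrable fun u => gaussianWeight b u • f (s • u) -
      (s ^ 2) • gaussianWeight b u • ((W (s • u) : ℂ) * f (s • u)) :=
    hint₁.sub (hint₂.fun_smul _)
  simp_rw [hsplit]
  rw [integral_add hint₁₂ hint₃, integral_sub hint₁ (hint₂.fun_smul _), integral_smul]
  set I₁ := ∫ u, gaussianWeight b u • f (s • u)
  set I₂ := ∫ u, gaussianWeight b u • ((W (s • u) : ℂ) * f (s • u))
  have hI₂ : ‖I₂ - W 0 * f 0‖ ≤ (‖T₂‖ / (4 * b) + |C₂|) * s ^ 2 := by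
    have h := norm_add_le (I₂ - W 0 * f 0 - (s ^ 2 / (4 * b)) • T₂) ((s ^ 2 / (4 * b)) • T₂)
    rw [sub_add_cancel, norm_smul, norm_of_nonneg (by positivity : 0 ≤ s ^ 2 / (4 * b))] at h
    have h2 : C₂ * s ^ 4 ≤ |C₂| * s ^ 2 := by
      have h4 : s ^ 4 ≤ s ^ 2 := by nlinarith [sq_nonneg s]
      exact mul_le_mul (le_abs_self _) h4 (by positivity) (abs_nonneg _)
    calc _ ≤ _ := h
      _ ≤ |C₂| * s ^ 2 + s ^ 2 / (4 * b) * ‖T₂‖ := by gcongr; exact (hC₂ s).trans h2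
      _ = _ := by ring
  have hfinal : I₁ - s ^ 2 • I₂ + (∫ u, gaussianWeight b u • ρ u) - f 0 -
      ((s ^ 2 / (4 * b)) • T₁ - s ^ 2 • (W 0 * f 0)) =
      (I₁ - f 0 - (s ^ 2 / (4 * b)) • T₁) - s ^ 2 • (I₂ - W 0 * f 0) +
        ∫ u, gaussianWeight b u • ρ u := by
    rw [smul_sub]
    abel
  rw [hfinal]
  have hsmul : ‖s ^ 2 • (I₂ - W 0 * f 0)‖ ≤ (‖T₂‖ / (4 * b) + |C₂|) * s ^ 4 := by
    rw [norm_smul, norm_of_nonneg (sq_nonneg s)]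
    calc _ ≤ s ^ 2 * ((‖T₂‖ / (4 * b) + |C₂|) * s ^ 2) := by gcongr
      _ = _ := by ring
  calc _ ≤ _ := norm_add_le _ _
    _ ≤ C₁ * s ^ 4 + (‖T₂‖ / (4 * b) + |C₂|) * s ^ 4 + K ^ 2 * M * s ^ 4 := by
      gcongr
      exact (norm_sub_le _ _).trans (add_le_add (hC₁ s) hsmul)
    _ = _ := by ring

end Expansion

section Phase

open scoped ContDiff

variable {E : Type*} [NormedAddCommGroup E]

theorem fderiv_fderiv_apply_apply [NormedSpace ℝ E] {F : Type*} [NormedAddCommGroup F]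
    [NormedSpace ℝ F] {f : E → F} (hf : ContDiff ℝ ∞ f) (x v w : E) :
    fderiv ℝ (fun y => fderiv ℝ f y v) x w = fderiv ℝ (fderiv ℝ f) x w v := by
  have h1 : ContDiff ℝ ∞ (fderiv ℝ f) := hf.fderiv_right le_rfl
  rw [fderiv_clm_apply (h1.differentiable (by simp) x) (by fun_prop)]
  simp

theorem fderiv_fderiv_cexp_mul [NormedSpace ℝ E] {φ g : E → ℂ} (hφ : ContDiff ℝ ∞ φ)
    (hg : ContDiff ℝ ∞ g) {x : E} (hx : φ x = 0) (v : E) :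
    fderiv ℝ (fderiv ℝ fun y => Complex.exp (φ y) * g y) x v v =
      fderiv ℝ (fderiv ℝ φ) x v v * g x + (fderiv ℝ φ x v) ^ 2 * g x +
        2 * (fderiv ℝ φ x v * fderiv ℝ g x v) + fderiv ℝ (fderiv ℝ g) x v v := by
  have hφ1 := hφ.differentiable (by simp)
  have hg1 := hg.differentiable (by simp)
  have hφ2 : Differentiable ℝ (fderiv ℝ φ) :=
    (hφ.fderiv_right le_rfl).differentiable (n := ∞) (by simp)
  have hg2 : Differentiable ℝ (fderiv ℝ g) :=
    (hg.fderiv_right le_rfl).differentiable (n := ∞) (by simp)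
  have hfst : (fun y => fderiv ℝ (fun y => Complex.exp (φ y) * g y) y v) =
      fun y => Complex.exp (φ y) * (fderiv ℝ φ y v * g y + fderiv ℝ g y v) := by
    funext y
    rw [((hφ1 y).hasFDerivAt.cexp.fun_mul (hg1 y).hasFDerivAt).fderiv]
    simp
    ring
  rw [← fderiv_fderiv_apply_apply (by fun_prop), hfst]
  have hp : HasFDerivAt (fun y => fderiv ℝ φ y v) (fderiv ℝ (fun y => fderiv ℝ φ y v) x) x :=
    DifferentiableAt.hasFDerivAt (by fun_prop)
  have hq : HasFDerivAt (fun y => fderiv ℝ g y v) (fderiv ℝ (fun y => fderiv ℝ g y v) x) x :=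
    DifferentiableAt.hasFDerivAt (by fun_prop)
  rw [((hφ1 x).hasFDerivAt.cexp.fun_mul ((hp.fun_mul (hg1 x).hasFDerivAt).fun_add hq)).fderiv]
  simp [hx, fderiv_fderiv_apply_apply hφ, fderiv_fderiv_apply_apply hg]
  ring

theorem fderiv_const_mul_ofReal_apply [NormedSpace ℝ E] (z : ℂ) {q : E → ℝ} {y : E}
    (hq : DifferentiableAt ℝ q y) (w : E) :
    fderiv ℝ (fun y => z * (q y : ℂ)) y w = z * (fderiv ℝ q y w : ℝ) := by
  have h : HasFDerivAt (fun y => z * (q y : ℂ)) (z • Complex.ofRealCLM.comp (fderiv ℝ q y)) y :=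
    (Complex.ofRealCLM.hasFDerivAt.comp y hq.hasFDerivAt).const_mul z
  rw [h.fderiv]
  simp

variable [InnerProductSpace ℝ E] {a : E → E}

theorem fderiv_inner_self_apply (ha : ContDiff ℝ ∞ a) (y v : E) :
    fderiv ℝ (fun y => ⟪y, a y⟫) y v = ⟪y, fderiv ℝ a y v⟫ + ⟪v, a y⟫ := by
  rw [fderiv_inner_apply ℝ differentiableAt_fun_id (ha.differentiable (by simp) y)]
  simp

theorem fderiv_fderiv_inner_self_zero (ha : ContDiff ℝ ∞ a) (v : E) :
    fderiv ℝ (fderiv ℝ fun y => ⟪y, a y⟫) 0 v v = 2 * ⟪v, fderiv ℝ a 0 v⟫ := by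
  have ha1 := ha.differentiable (by simp)
  have ha2 : Differentiable ℝ (fderiv ℝ a) :=
    (ha.fderiv_right le_rfl).differentiable (n := ∞) (by simp)
  rw [← fderiv_fderiv_apply_apply (contDiff_fun_id.inner ℝ ha)]
  simp_rw [fderiv_inner_self_apply ha]
  have hav : DifferentiableAt ℝ (fun y => fderiv ℝ a y v) 0 := by fun_prop
  rw [fderiv_fun_add (differentiableAt_fun_id.inner ℝ hav)
      ((differentiableAt_const v).inner ℝ (ha1 0)), add_apply,
    fderiv_inner_apply ℝ differentiableAt_fun_id hav,
    fderiv_inner_apply ℝ (differentiableAt_const v) (ha1 0)]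
  simp
  ring

/-- The wave function seen from `x`, multiplied by the midpoint electromagnetic phase. -/
def phasedWave (k : ℝ) (A : E → E) (ψ : E → ℂ) (x y : E) : ℂ :=
  Complex.exp (-Complex.I * k * (⟪y, A (x + (2 : ℝ)⁻¹ • y)⟫ : ℝ)) * ψ (x + y)

theorem contDiff_phase {A : E → E} (hA : ContDiff ℝ ∞ A) (k : ℝ) (x : E) :
    ContDiff ℝ ∞ fun y => -Complex.I * k * ((⟪y, A (x + (2 : ℝ)⁻¹ • y)⟫ : ℝ) : ℂ) :=
  contDiff_const.mul (Complex.ofRealCLM.contDiff.comp (contDiff_fun_id.inner ℝ (by fun_prop)))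

theorem contDiff_phasedWave {A : E → E} (hA : ContDiff ℝ ∞ A) {ψ : E → ℂ} (hψ : ContDiff ℝ ∞ ψ)
    (k : ℝ) (x : E) : ContDiff ℝ ∞ (phasedWave k A ψ x) :=
  (contDiff_phase hA k x).cexp.mul (by fun_prop)

theorem norm_phasedWave (k : ℝ) (A : E → E) (ψ : E → ℂ) (x y : E) :
    ‖phasedWave k A ψ x y‖ = ‖ψ (x + y)‖ := by
  rw [phasedWave, norm_mul, Complex.norm_exp]
  simp

theorem phasedWave_zero (k : ℝ) (A : E → E) (ψ : E → ℂ) (x : E) :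
    phasedWave k A ψ x 0 = ψ x := by
  simp [phasedWave]

theorem fderiv_fderiv_phasedWave {A : E → E} (hA : ContDiff ℝ ∞ A) {ψ : E → ℂ}
    (hψ : ContDiff ℝ ∞ ψ) (k : ℝ) (x v : E) :
    fderiv ℝ (fderiv ℝ (phasedWave k A ψ x)) 0 v v =
      fderiv ℝ (fderiv ℝ ψ) x v v - (k ^ 2 * ⟪v, A x⟫ ^ 2 : ℝ) * ψ x -
        Complex.I * k * (2 * (⟪v, A x⟫ * fderiv ℝ ψ x v) + (⟪fderiv ℝ A x v, v⟫ : ℝ) * ψ x) := by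
  have ha : ContDiff ℝ ∞ fun y => A (x + (2 : ℝ)⁻¹ • y) := by fun_prop
  have hq : ContDiff ℝ ∞ fun y => ⟪y, A (x + (2 : ℝ)⁻¹ • y)⟫ :=
    contDiff_fun_id.inner ℝ ha
  have hq1 := hq.differentiable (by simp)
  have hda : fderiv ℝ (fun y => A (x + (2 : ℝ)⁻¹ • y)) 0 = (2 : ℝ)⁻¹ • fderiv ℝ A x := by
    have := fderiv_comp_smul (𝕜 := ℝ) (f := fun y => A (x + y)) (x := (0 : E)) (2 : ℝ)⁻¹
    rw [this, smul_zero, fderiv_comp_add_left, add_zero]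
  have hphase : ∀ y w, fderiv ℝ (fun y => -Complex.I * k *
      ((⟪y, A (x + (2 : ℝ)⁻¹ • y)⟫ : ℝ) : ℂ)) y w =
        -Complex.I * k * (fderiv ℝ (fun y => ⟪y, A (x + (2 : ℝ)⁻¹ • y)⟫) y w : ℝ) := fun y w =>
    fderiv_const_mul_ofReal_apply _ (hq1 y) w
  have hphase2 : fderiv ℝ (fderiv ℝ (fun y => -Complex.I * k *
      ((⟪y, A (x + (2 : ℝ)⁻¹ • y)⟫ : ℝ) : ℂ))) 0 v v =
        -Complex.I * k * (⟪fderiv ℝ A x v, v⟫ : ℝ) := by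
    rw [← fderiv_fderiv_apply_apply (contDiff_phase hA k x)]
    simp_rw [hphase]
    have hd : DifferentiableAt ℝ
        (fun y => fderiv ℝ (fun y => ⟪y, A (x + (2 : ℝ)⁻¹ • y)⟫) y v) 0 :=
      (((hq.fderiv_right le_rfl).clm_apply contDiff_const).differentiable (n := ∞) (by simp)) 0
    have h2 : fderiv ℝ (fun y => fderiv ℝ (fun y => ⟪y, A (x + (2 : ℝ)⁻¹ • y)⟫) y v) 0 v =
        ⟪fderiv ℝ A x v, v⟫ := by
      rw [fderiv_fderiv_apply_apply hq, fderiv_fderiv_inner_self_zero ha, hda]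
      simp [real_inner_smul_right, real_inner_comm]
    rw [fderiv_const_mul_ofReal_apply _ hd, h2]
  unfold phasedWave
  have hψ1 : fderiv ℝ (fun y => ψ (x + y)) = fun y => fderiv ℝ ψ (x + y) :=
    funext fun y => fderiv_comp_add_left x
  rw [fderiv_fderiv_cexp_mul (contDiff_phase hA k x) (by fun_prop) (by simp), hphase2, hphase,
    fderiv_inner_self_apply ha, hψ1, fderiv_comp_add_left]
  simp
  ring_nf
  simp
  ring

end Phase

theorem sum_fderiv_fderiv_phasedWave {A : E3 → E3} (hA : ContDiff ℝ (⊤ : ℕ∞) A) {ψ : E3 → ℂ}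
    (hψ : ContDiff ℝ (⊤ : ℕ∞) ψ) (k : ℝ) (x : E3) :
    ∑ i, fderiv ℝ (fderiv ℝ (phasedWave k A ψ x)) 0 (EuclideanSpace.basisFun (Fin 3) ℝ i)
        (EuclideanSpace.basisFun (Fin 3) ℝ i) =
      lap3 ψ x - (k ^ 2 * ‖A x‖ ^ 2 : ℝ) * ψ x -
        Complex.I * k * (2 * fderiv ℝ ψ x (A x) + (div3 A x : ℝ) * ψ x) := by
  set v := EuclideanSpace.basisFun (Fin 3) ℝ with hv
  have hnorm : ‖A x‖ ^ 2 = ∑ i, ⟪v i, A x⟫ ^ 2 := (v.sum_sq_inner_right (A x)).symm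
  have hfd : fderiv ℝ ψ x (A x) = ∑ i, ⟪v i, A x⟫ * fderiv ℝ ψ x (v i) := by
    conv_lhs => rw [← v.sum_repr' (A x)]
    simp
  have hlap : lap3 ψ x = ∑ i, fderiv ℝ (fderiv ℝ ψ) x (v i) (v i) := by
    simp only [lap3, hv, EuclideanSpace.basisFun_apply]
    exact Finset.sum_congr rfl fun i _ => fderiv_fderiv_apply_apply hψ _ _ _
  have hdiv : div3 A x = ∑ i, ⟪fderiv ℝ A x (v i), v i⟫ := by
    simp [div3, hv]
  rw [hnorm, hfd, hlap, hdiv]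
  simp only [fderiv_fderiv_phasedWave hA hψ, Finset.sum_sub_distrib, Finset.sum_add_distrib,
    Finset.mul_sum, Finset.sum_mul, Complex.ofReal_sum, mul_add]

theorem integral_kernel_mul_eq {m ℏ ε : ℝ} (hm : 0 < m) (hℏ : 0 < ℏ) (hε : 0 < ε) (e c : ℝ)
    (V : E3 → ℝ) (A : E3 → E3) (ψ : E3 → ℂ) (x : E3) :
    ∫ x', (((m / (2 * Real.pi * ℏ * ε)) ^ ((3 : ℝ) / 2) : ℝ) : ℂ) *
        Complex.exp (-(((ε / ℏ : ℝ)) : ℂ) *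
          (((m * ‖x - x'‖ ^ 2 / (2 * ε ^ 2) + V ((2 : ℝ)⁻¹ • (x + x')) : ℝ) : ℂ) -
            Complex.I *
              (((e / c) * ⟪ε⁻¹ • (x - x'), A ((2 : ℝ)⁻¹ • (x + x'))⟫ : ℝ) : ℂ))) * ψ x' =
      ∫ u, gaussianWeight (m / (2 * ℏ)) u •
        (Complex.exp (-(√ε ^ 2 * (V (x + (2 : ℝ)⁻¹ • √ε • u) / ℏ) : ℝ)) *
          phasedWave (e / (ℏ * c)) A ψ x (√ε • u)) := by
  have hs : 0 < √ε := Real.sqrt_pos.2 hε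
  have hs2 : √ε ^ 2 = ε := Real.sq_sqrt hε.le
  rw [← integral_add_left_eq_self _ x]
  have hscale := Measure.integral_comp_smul_of_nonneg (volume : Measure E3) (fun y : E3 =>
    (((m / (2 * Real.pi * ℏ * ε)) ^ ((3 : ℝ) / 2) : ℝ) : ℂ) *
        Complex.exp (-(((ε / ℏ : ℝ)) : ℂ) *
          (((m * ‖x - (x + y)‖ ^ 2 / (2 * ε ^ 2) + V ((2 : ℝ)⁻¹ • (x + (x + y))) : ℝ) : ℂ) -
            Complex.I * (((e / c) *
              ⟪ε⁻¹ • (x - (x + y)), A ((2 : ℝ)⁻¹ • (x + (x + y)))⟫ : ℝ) : ℂ))) * ψ (x + y))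
    √ε (hR := hs.le)
  rw [finrank_euclideanSpace, Fintype.card_fin, eq_inv_smul_iff₀ (by positivity)] at hscale
  rw [← hscale, ← integral_smul]
  congr 1 with u
  have hmid : (2 : ℝ)⁻¹ • (x + (x + √ε • u)) = x + (2 : ℝ)⁻¹ • √ε • u := by module
  have hcoef : √ε ^ 3 * (m / (2 * π * ℏ * ε)) ^ ((3 : ℝ) / 2) =
      (m / (2 * ℏ) / π) ^ ((3 : ℝ) / 2) := by
    have h3 : √ε ^ 3 = ε ^ ((3 : ℝ) / 2) := by
      rw [Real.sqrt_eq_rpow, ← Real.rpow_natCast, ← Real.rpow_mul hε.le]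
      norm_num
    rw [h3, ← Real.mul_rpow hε.le (by positivity)]
    congr 1
    field_simp
  rw [hmid, sub_add_cancel_left, phasedWave, gaussianWeight, finrank_euclideanSpace,
    Fintype.card_fin, norm_neg, norm_smul, smul_neg, inner_neg_left, real_inner_smul_left,
    norm_of_nonneg hs.le, mul_pow, hs2,
    Nat.cast_ofNat, ← hcoef, Complex.real_smul, Complex.real_smul,
    Complex.ofReal_mul (√ε ^ 3 * _), Complex.ofReal_mul (√ε ^ 3), Complex.ofReal_exp]
  have hregroup : ∀ a p z w z₁ z₂ z₃ : ℂ, z = z₁ * z₂ * z₃ →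
      a * (p * z * w) = a * p * z₁ * (z₂ * (z₃ * w)) := by
    rintro a p _ w z₁ z₂ z₃ rfl
    ring
  apply hregroup
  rw [← Complex.exp_add, ← Complex.exp_add]
  congr 1
  push_cast
  have hεC : (ε : ℂ) ≠ 0 := by exact_mod_cast hε.ne'
  have hℏC : (ℏ : ℂ) ≠ 0 := by exact_mod_cast hℏ.ne'
  field_simp
  ring

/-- the electromagnetic kernel reproduces, to first order in
`ε`, the right-hand side of the Schrödinger equation of a charged particle in
an electromagnetic field, with `O(ε²)` error as `ε → 0⁺`. -/
theorem stmt12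
    (m ℏ e c : ℝ) (hm : 0 < m) (hℏ : 0 < ℏ) (he : 0 < e) (hc : 0 < c)
    (V : E3 → ℝ) (A : E3 → E3)
    (hV : ContDiff ℝ (⊤ : ℕ∞) V) (hA : ContDiff ℝ (⊤ : ℕ∞) A)
    (hVb : ∀ i : ℕ, i ≤ 2 → ∃ C, ∀ x, ‖iteratedFDeriv ℝ i V x‖ ≤ C)
    (hAb : ∀ i : ℕ, i ≤ 2 → ∃ C, ∀ x, ‖iteratedFDeriv ℝ i A x‖ ≤ C)
    (ψ : SchwartzMap E3 ℂ)
    (C' : ℝ → E3 → E3 → ℂ)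
    (hC : ∀ ε x x', C' ε x x' =
      (((m / (2 * Real.pi * ℏ * ε)) ^ ((3 : ℝ) / 2) : ℝ) : ℂ) *
        Complex.exp (-(((ε / ℏ : ℝ)) : ℂ) *
          (((m * ‖x - x'‖ ^ 2 / (2 * ε ^ 2) + V ((2 : ℝ)⁻¹ • (x + x')) : ℝ) : ℂ) -
            Complex.I *
              (((e / c) * ⟪ε⁻¹ • (x - x'), A ((2 : ℝ)⁻¹ • (x + x'))⟫ : ℝ) : ℂ)))) :
    ∀ x : E3,
      (fun ε : ℝ =>
          (∫ x', C' ε x x' * ψ x') - ψ x -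
            ((ε / ℏ : ℝ) : ℂ) *
              (((ℏ ^ 2 / (2 * m) : ℝ) : ℂ) *
                  (lap3 (fun y => ψ y) x -
                    (((e / (ℏ * c)) ^ 2 * ‖A x‖ ^ 2 : ℝ) : ℂ) * ψ x -
                    Complex.I * ((e / (ℏ * c) : ℝ) : ℂ) *
                      (2 * fderiv ℝ (fun y => ψ y) x (A x) +
                        ((div3 A x : ℝ) : ℂ) * ψ x)) -
                ((V x : ℝ) : ℂ) * ψ x))
        =O[nhdsWithin 0 (Set.Ioi 0)] (fun ε : ℝ => ε ^ 2) := by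
  intro x
  obtain ⟨K, hK⟩ := hVb 0 (by norm_num)
  obtain ⟨M, hM⟩ : ∃ M, ∀ y, ‖ψ y‖ ≤ M := by
    obtain ⟨M, hM⟩ := ψ.decay 0 0
    exact ⟨M, fun y => by simpa using hM.2 y⟩
  have hψ : ContDiff ℝ (⊤ : ℕ∞) ψ := ψ.smooth _
  obtain ⟨C, hbound⟩ := exists_norm_integral_gaussianWeight_exp_sub_le
    (b := m / (2 * ℏ)) (by positivity) (EuclideanSpace.basisFun (Fin 3) ℝ)
    (contDiff_phasedWave hA hψ (e / (ℏ * c)) x)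
    (fun y => (norm_phasedWave _ _ _ _ y).trans_le (hM _))
    (W := fun y => V (x + (2 : ℝ)⁻¹ • y) / ℏ) (by fun_prop) (K := K / ℏ) (fun y => by
      rw [norm_div, norm_of_nonneg hℏ.le]
      gcongr
      simpa using hK (x + (2 : ℝ)⁻¹ • y))
  refine IsBigO.of_bound C ?_
  have hsmall : ∀ᶠ ε : ℝ in nhdsWithin 0 (Set.Ioi 0), ε * (K / ℏ) < 1 :=
    ((continuous_mul_const (K / ℏ)).tendsto' 0 0 (zero_mul _)).eventually_lt_const one_pos
      |>.filter_mono nhdsWithin_le_nhds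
  have hone : ∀ᶠ ε : ℝ in nhdsWithin 0 (Set.Ioi 0), ε < 1 :=
    (eventually_lt_nhds one_pos).filter_mono nhdsWithin_le_nhds
  filter_upwards [self_mem_nhdsWithin, hsmall, hone] with ε hε hεK hε1
  rw [Set.mem_Ioi] at hε
  have hs2 : √ε ^ 2 = ε := Real.sq_sqrt hε.le
  have h := hbound √ε (by rw [hs2]; exact hεK.le) (by rw [hs2]; exact hε1.le)
  rw [← integral_kernel_mul_eq hm hℏ hε, sum_fderiv_fderiv_phasedWave hA hψ, phasedWave_zero,
    show √ε ^ 4 = (√ε ^ 2) ^ 2 by ring, hs2] at h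
  simp only [hC]
  rw [norm_of_nonneg (sq_nonneg ε)]
  refine (congrArg norm ?_).trans_le h
  congr 1
  simp only [smul_zero, add_zero, Complex.real_smul]
  push_cast
  have hmC : (m : ℂ) ≠ 0 := by exact_mod_cast hm.ne'
  have hℏC : (ℏ : ℂ) ≠ 0 := by exact_mod_cast hℏ.ne'
  field_simp
  ring

end
end

section
/- Let m, ℏ, e, c > 0 be real constants, let V : ℝ³ → ℝ and A : ℝ³ → ℝ³ be smooth functions all of whose derivatives up to order 2 are bounded, and let ψ : ℝ³ → ℂ be a Schwartz function. For ε > 0 and x, x′ ∈ ℝ³ set z(x, x′) := (e/(ℏ·c))·(x − x′)·A((x + x′)/2) (Euclidean inner product), H⁰(x, x′) := m·‖x − x′‖²/(2·ε²) + V((x + x′)/2), and define the two real kernels W̃(x, x′) := (m/(2·π·ℏ·ε))^{3/2} · exp(−(ε/ℏ)·H⁰(x, x′)) · (cos z(x, x′) − sin z(x, x′)) and W(x, x′) := (m/(2·π·ℏ·ε))^{3/2} · exp(−(ε/ℏ)·H⁰(x, x′)) · exp(−z(x, x′) − z(x, x′)²). Then for every x ∈ ℝ³, the function ε ↦ (∫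 W̃(x, x′)·ψ(x′) dx′) − (∫ W(x, x′)·ψ(x′) dx′) is O(ε²) as ε → 0 from the right. -/
open MeasureTheory Asymptotics Filter Real
open scoped RealInnerProductSpace

noncomputable section

local notation "E3" => EuclideanSpace ℝ (Fin 3)

/-- The difference between the oscillating factor and its positive replacement. -/
def phaseError (z : ℝ) : ℝ := Real.cos z - Real.sin z - Real.exp (-z - z ^ 2)

lemma continuous_phaseError : Continuous phaseError := by
  unfold phaseError; fun_prop

lemma exp_neg_sub_sq_le_three (z : ℝ) : Real.exp (-z - z ^ 2) ≤ 3 := by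
  have h1 : Real.exp (-z - z ^ 2) ≤ Real.exp 1 :=
    Real.exp_le_exp.2 (by nlinarith [sq_nonneg (z + 1 / 2)])
  linarith [Real.exp_one_lt_d9]

lemma abs_phaseError_le_five (z : ℝ) : |phaseError z| ≤ 5 := by
  have h1 := exp_neg_sub_sq_le_three z
  have h2 := Real.exp_pos (-z - z ^ 2)
  unfold phaseError
  rw [abs_le]
  constructor <;>
    linarith [Real.cos_le_one z, Real.neg_one_le_cos z, Real.sin_le_one z, Real.neg_one_le_sin z]

lemma abs_phaseError_add_cube_le (z : ℝ) :
    |phaseError z + 2 / 3 * z ^ 3| ≤ 100 * |z| ^ 4 := by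
  have hz0 := abs_nonneg z
  rcases le_or_gt |z| (1 / 2) with hz | hz
  · have hc := Real.cos_bound (x := z) (by linarith)
    have hs := Real.sin_bound (x := z) (by linarith)
    have hw : |-z - z ^ 2| ≤ 3 / 2 * |z| := by
      calc |-z - z ^ 2| ≤ |-z| + |z ^ 2| := abs_sub _ _
        _ = |z| + |z| * |z| := by rw [abs_neg, abs_pow]; ring
        _ ≤ 3 / 2 * |z| := by nlinarith
    have he := Real.exp_bound (x := -z - z ^ 2) (by linarith) (n := 4) (by norm_num)
    simp only [Finset.sum_range_succ, Finset.sum_range_zero, Nat.factorial] at he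
    norm_num at he
    have hw4 : |-z - z ^ 2| ^ 4 ≤ (3 / 2 * |z|) ^ 4 := pow_le_pow_left₀ (abs_nonneg _) hw 4
    have h5 : |z| ^ 5 ≤ |z| ^ 4 := by
      rw [pow_succ]; exact mul_le_of_le_one_right (by positivity) (by linarith)
    have h6 : |z| ^ 6 ≤ |z| ^ 4 := pow_le_pow_of_le_one hz0 (by linarith) (by norm_num)
    have a5 : |z ^ 5| = |z| ^ 5 := abs_pow z 5
    have a6 : |z ^ 6| = |z| ^ 6 := abs_pow z 6
    have l5 := abs_le.1 a5.le
    have l6 := abs_le.1 a6.le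
    rw [abs_le] at hc hs he
    unfold phaseError
    have h0 : 0 ≤ |z| ^ 4 := by positivity
    rw [abs_le]
    constructor <;> nlinarith
  · have h4 : (1 / 2 : ℝ) ^ 4 ≤ |z| ^ 4 := pow_le_pow_left₀ (by norm_num) hz.le 4
    have h3 : |z| ^ 3 ≤ 2 * |z| ^ 4 := by
      have : 0 ≤ |z| ^ 3 := by positivity
      nlinarith
    calc |phaseError z + 2 / 3 * z ^ 3| ≤ |phaseError z| + |2 / 3 * z ^ 3| := abs_add_le _ _
      _ = |phaseError z| + 2 / 3 * |z| ^ 3 := by rw [abs_mul, abs_pow]; norm_num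
      _ ≤ 100 * |z| ^ 4 := by linarith [abs_phaseError_le_five z]

lemma abs_phaseError_le_cube (z : ℝ) : |phaseError z| ≤ 101 * |z| ^ 3 := by
  have hz0 := abs_nonneg z
  rcases le_or_gt |z| 1 with hz | hz
  · have h4 : |z| ^ 4 ≤ |z| ^ 3 := pow_le_pow_of_le_one hz0 hz (by norm_num)
    calc |phaseError z| = |(phaseError z + 2 / 3 * z ^ 3) - 2 / 3 * z ^ 3| := by ring_nf
      _ ≤ |phaseError z + 2 / 3 * z ^ 3| + |2 / 3 * z ^ 3| := abs_sub _ _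
      _ = |phaseError z + 2 / 3 * z ^ 3| + 2 / 3 * |z| ^ 3 := by
        rw [abs_mul (2 / 3), abs_pow]; norm_num
      _ ≤ 101 * |z| ^ 3 := by
        linarith [abs_phaseError_add_cube_le z, pow_nonneg hz0 3]
  · have h3 : (1 : ℝ) ≤ |z| ^ 3 := one_le_pow₀ hz.le
    linarith [abs_phaseError_le_five z]

lemma abs_cube_sub_cube_le {z w R : ℝ} (hz : |z| ≤ R) (hw : |w| ≤ R) :
    |z ^ 3 - w ^ 3| ≤ 3 * R ^ 2 * |z - w| := by
  have h : |z ^ 2 + z * w + w ^ 2| ≤ 3 * R ^ 2 := by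
    have hR : 0 ≤ R := (abs_nonneg z).trans hz
    have h1 : |z ^ 2| ≤ R ^ 2 := by rw [abs_pow]; exact pow_le_pow_left₀ (abs_nonneg _) hz 2
    have h2 : |w ^ 2| ≤ R ^ 2 := by rw [abs_pow]; exact pow_le_pow_left₀ (abs_nonneg _) hw 2
    have h3 : |z * w| ≤ R ^ 2 := by
      rw [abs_mul, sq]; exact mul_le_mul hz hw (abs_nonneg _) hR
    linarith [abs_add_three (z ^ 2) (z * w) (w ^ 2)]
  calc |z ^ 3 - w ^ 3| = |z ^ 2 + z * w + w ^ 2| * |z - w| := by rw [← abs_mul]; ring_nf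
    _ ≤ _ := mul_le_mul_of_nonneg_right h (abs_nonneg _)

lemma norm_phaseError_mul_add_cube_le {z w η r s B D F P Q : ℝ} {p q : ℂ}
    (hz : |z| ≤ B * r) (hw : |w| ≤ B * r) (hzw : |z - w| ≤ D * r ^ 2)
    (hη : |η - 1| ≤ F * s ^ 2) (hp : ‖p‖ ≤ P) (hpq : ‖p - q‖ ≤ Q * r) :
    ‖((η * phaseError z : ℝ) : ℂ) * p + ((2 / 3 * w ^ 3 : ℝ) : ℂ) * q‖ ≤
      101 * F * B ^ 3 * P * (s ^ 2 * r ^ 3) +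
        (100 * B ^ 4 * P + 2 * B ^ 2 * D * P + 2 / 3 * B ^ 3 * Q) * r ^ 4 := by
  have hR : 0 ≤ B * r := (abs_nonneg z).trans hz
  have hP : 0 ≤ P := (norm_nonneg p).trans hp
  have e : ((η * phaseError z : ℝ) : ℂ) * p + ((2 / 3 * w ^ 3 : ℝ) : ℂ) * q =
      (((η - 1) * phaseError z : ℝ) : ℂ) * p + ((phaseError z + 2 / 3 * z ^ 3 : ℝ) : ℂ) * p
        + ((-(2 / 3) * (z ^ 3 - w ^ 3) : ℝ) : ℂ) * p
        + ((-(2 / 3) * w ^ 3 : ℝ) : ℂ) * (p - q) := by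
    push_cast; ring
  have hz3 : |z| ^ 3 ≤ (B * r) ^ 3 := pow_le_pow_left₀ (abs_nonneg _) hz 3
  have hz4 : |z| ^ 4 ≤ (B * r) ^ 4 := pow_le_pow_left₀ (abs_nonneg _) hz 4
  have hw3 : |w| ^ 3 ≤ (B * r) ^ 3 := pow_le_pow_left₀ (abs_nonneg _) hw 3
  have h1 : ‖(((η - 1) * phaseError z : ℝ) : ℂ) * p‖ ≤ F * s ^ 2 * (101 * (B * r) ^ 3) * P := by
    rw [norm_mul, Complex.norm_real, Real.norm_eq_abs, abs_mul]
    have hF : 0 ≤ F * s ^ 2 := (abs_nonneg _).trans hη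
    have := (abs_phaseError_le_cube z).trans (mul_le_mul_of_nonneg_left hz3 (by norm_num))
    gcongr
  have h2 : ‖((phaseError z + 2 / 3 * z ^ 3 : ℝ) : ℂ) * p‖ ≤ 100 * (B * r) ^ 4 * P := by
    rw [norm_mul, Complex.norm_real, Real.norm_eq_abs]
    have := (abs_phaseError_add_cube_le z).trans (mul_le_mul_of_nonneg_left hz4 (by norm_num))
    gcongr
  have h3 : ‖((-(2 / 3) * (z ^ 3 - w ^ 3) : ℝ) : ℂ) * p‖ ≤
      2 / 3 * (3 * (B * r) ^ 2 * (D * r ^ 2)) * P := by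
    rw [norm_mul, Complex.norm_real, Real.norm_eq_abs, abs_mul, abs_neg,
      abs_of_pos (by norm_num : (0 : ℝ) < 2 / 3)]
    have := (abs_cube_sub_cube_le hz hw).trans
      (mul_le_mul_of_nonneg_left hzw (by positivity))
    exact mul_le_mul (mul_le_mul_of_nonneg_left this (by norm_num)) hp (norm_nonneg _)
      (by linarith [(abs_nonneg _).trans this])
  have h4 : ‖((-(2 / 3) * w ^ 3 : ℝ) : ℂ) * (p - q)‖ ≤ 2 / 3 * (B * r) ^ 3 * (Q * r) := by
    rw [norm_mul, Complex.norm_real, Real.norm_eq_abs, abs_mul, abs_neg,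
      abs_of_pos (by norm_num : (0 : ℝ) < 2 / 3), abs_pow]
    gcongr
  rw [e]
  refine (norm_add_le _ _).trans ((add_le_add_left (norm_add₃_le) _).trans ?_)
  calc _ ≤ F * s ^ 2 * (101 * (B * r) ^ 3) * P + 100 * (B * r) ^ 4 * P
        + 2 / 3 * (3 * (B * r) ^ 2 * (D * r ^ 2)) * P + 2 / 3 * (B * r) ^ 3 * (Q * r) := by
        linarith
    _ = _ := by ring

lemma integrable_exp_neg_mul_norm_sq {a : ℝ} (ha : 0 < a) :
    Integrable (fun v : E3 => Real.exp (-a * ‖v‖ ^ 2)) := by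
  have h := (GaussianFourier.integrable_cexp_neg_mul_sq_norm_add (b := (a : ℂ)) (V := E3)
    (by simpa using ha) 0 0).norm
  refine h.congr (Eventually.of_forall fun v => ?_)
  simp only [zero_mul, add_zero, Complex.norm_exp]
  congr 1
  norm_cast

lemma integrable_exp_neg_mul_norm_sq_mul_pow {a : ℝ} (ha : 0 < a) :
    Integrable (fun v : E3 => Real.exp (-a * ‖v‖ ^ 2) * (‖v‖ ^ 3 + ‖v‖ ^ 4)) := by
  refine ((integrable_exp_neg_mul_norm_sq (half_pos ha)).const_mul (1 + 16 / a ^ 2)).mono'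
    (Continuous.aestronglyMeasurable (by fun_prop)) (Eventually.of_forall fun v => ?_)
  have ht : 0 ≤ ‖v‖ := norm_nonneg v
  have hq := Real.quadratic_le_exp_of_nonneg (x := a / 2 * ‖v‖ ^ 2) (by positivity)
  set E := Real.exp (a / 2 * ‖v‖ ^ 2) with hE
  have h1 : 1 ≤ E := by
    have : 0 ≤ a / 2 * ‖v‖ ^ 2 := by positivity
    nlinarith [sq_nonneg (a / 2 * ‖v‖ ^ 2)]
  have h4 : ‖v‖ ^ 4 ≤ 8 / a ^ 2 * E := by
    have : 0 ≤ a / 2 * ‖v‖ ^ 2 := by positivity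
    have h8 : (a / 2 * ‖v‖ ^ 2) ^ 2 / 2 ≤ E := by linarith
    calc ‖v‖ ^ 4 = 8 / a ^ 2 * ((a / 2 * ‖v‖ ^ 2) ^ 2 / 2) := by field_simp; ring
      _ ≤ _ := by gcongr
  have h3 : ‖v‖ ^ 3 ≤ 1 + ‖v‖ ^ 4 := by
    rcases le_or_gt ‖v‖ 1 with h | h
    · linarith [pow_le_one₀ ht h (n := 3), pow_nonneg ht 4]
    · linarith [pow_le_pow_right₀ h.le (show 3 ≤ 4 by norm_num)]
  have hsum : ‖v‖ ^ 3 + ‖v‖ ^ 4 ≤ (1 + 16 / a ^ 2) * E := by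
    have : 16 / a ^ 2 * E = 2 * (8 / a ^ 2 * E) := by ring
    linarith
  rw [Real.norm_eq_abs, abs_of_nonneg (by positivity)]
  calc Real.exp (-a * ‖v‖ ^ 2) * (‖v‖ ^ 3 + ‖v‖ ^ 4)
      ≤ Real.exp (-a * ‖v‖ ^ 2) * ((1 + 16 / a ^ 2) * E) := by gcongr
    _ = (1 + 16 / a ^ 2) * (Real.exp (-a * ‖v‖ ^ 2) * E) := by ring
    _ = (1 + 16 / a ^ 2) * Real.exp (-(a / 2) * ‖v‖ ^ 2) := by
      rw [hE, ← Real.exp_add]; congr 2; ring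

lemma integral_eq_pow_three_smul_integral_comp {F : E3 → ℂ} (x : E3) {s : ℝ} (hs : 0 < s) :
    ∫ y, F y = ((s ^ 3 : ℝ) : ℂ) * ∫ v, F (x + s • v) := by
  rw [Measure.integral_comp_smul volume (fun u => F (x + u)) s, integral_add_left_eq_self]
  have : |(s ^ 3)⁻¹| = (s ^ 3)⁻¹ := abs_of_pos (by positivity)
  rw [finrank_euclideanSpace_fin, this, Complex.real_smul, ← mul_assoc, ← Complex.ofReal_mul,
    mul_inv_cancel₀ (by positivity)]
  simp

lemma norm_sub_le_of_norm_iteratedFDeriv_one_le {F : Type*} [NormedAddCommGroup F]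
    [NormedSpace ℝ F] {f : E3 → F} {C : ℝ} (hf : ContDiff ℝ (⊤ : ℕ∞) f)
    (hC : ∀ x, ‖iteratedFDeriv ℝ 1 f x‖ ≤ C) (x y : E3) : ‖f y - f x‖ ≤ C * ‖y - x‖ :=
  Convex.norm_image_sub_le_of_norm_fderiv_le (𝕜 := ℝ)
    (fun u _ => (hf.differentiable (by simp)).differentiableAt)
    (fun u _ => by rw [← norm_iteratedFDeriv_one]; exact hC u)
    convex_univ (Set.mem_univ x) (Set.mem_univ y)

/-- replacing `cos z - sin z` by `exp(-z - z²)` in the real part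
decomposition of the electromagnetic kernel changes the integral against a
Schwartz function only by `O(ε²)` as `ε → 0⁺`. -/
theorem stmt14
    (m ℏ e c : ℝ) (hm : 0 < m) (hℏ : 0 < ℏ) (he : 0 < e) (hc : 0 < c)
    (V : E3 → ℝ) (A : E3 → E3)
    (hV : ContDiff ℝ (⊤ : ℕ∞) V) (hA : ContDiff ℝ (⊤ : ℕ∞) A)
    (hVb : ∀ i : ℕ, i ≤ 2 → ∃ C, ∀ x, ‖iteratedFDeriv ℝ i V x‖ ≤ C)
    (hAb : ∀ i : ℕ, i ≤ 2 → ∃ C, ∀ x, ‖iteratedFDeriv ℝ i A x‖ ≤ C)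
    (ψ : SchwartzMap E3 ℂ)
    (z : E3 → E3 → ℝ)
    (hz : ∀ x x', z x x' = (e / (ℏ * c)) * ⟪x - x', A ((2 : ℝ)⁻¹ • (x + x'))⟫)
    (H0 : ℝ → E3 → E3 → ℝ)
    (hH0 : ∀ ε x x', H0 ε x x' =
      m * ‖x - x'‖ ^ 2 / (2 * ε ^ 2) + V ((2 : ℝ)⁻¹ • (x + x')))
    (Wt W : ℝ → E3 → E3 → ℝ)
    (hWt : ∀ ε x x', Wt ε x x' =
      (m / (2 * Real.pi * ℏ * ε)) ^ ((3 : ℝ) / 2) *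
        Real.exp (-(ε / ℏ) * H0 ε x x') *
        (Real.cos (z x x') - Real.sin (z x x')))
    (hW : ∀ ε x x', W ε x x' =
      (m / (2 * Real.pi * ℏ * ε)) ^ ((3 : ℝ) / 2) *
        Real.exp (-(ε / ℏ) * H0 ε x x') *
        Real.exp (-(z x x') - (z x x') ^ 2)) :
    ∀ x : E3,
      (fun ε : ℝ =>
          (∫ x', (Wt ε x x' : ℂ) * ψ x') - ∫ x', (W ε x x' : ℂ) * ψ x')
        =O[nhdsWithin 0 (Set.Ioi 0)] (fun ε : ℝ => ε ^ 2) := by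
  intro x
  obtain ⟨MV, hMV⟩ := hVb 0 (by norm_num)
  obtain ⟨MA, hMA⟩ := hAb 0 (by norm_num)
  obtain ⟨LA, hLA⟩ := hAb 1 (by norm_num)
  obtain ⟨P, -, hP⟩ := ψ.decay 0 0
  obtain ⟨Q, -, hQ⟩ := ψ.decay 0 1
  simp only [norm_iteratedFDeriv_zero, pow_zero, one_mul] at hMV hMA hP hQ
  have hAlip := norm_sub_le_of_norm_iteratedFDeriv_one_le hA hLA
  have hψlip := norm_sub_le_of_norm_iteratedFDeriv_one_le (f := ψ) (ψ.smooth _) hQ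
  have hMV0 : 0 ≤ MV := (norm_nonneg _).trans (hMV 0)
  have hMA0 : 0 ≤ MA := (norm_nonneg _).trans (hMA 0)
  have hLA0 : 0 ≤ LA := (norm_nonneg _).trans (hLA 0)
  have hP0 : 0 ≤ P := (norm_nonneg _).trans (hP 0)
  have hQ0 : 0 ≤ Q := (norm_nonneg _).trans (hQ 0)
  have hVc : Continuous V := hV.continuous
  have hAc : Continuous A := hA.continuous
  have hzc : Continuous (z x) := by
    have : z x = fun x' => (e / (ℏ * c)) * ⟪x - x', A ((2 : ℝ)⁻¹ • (x + x'))⟫ := funext (hz x)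
    rw [this]; fun_prop
  set κ := e / (ℏ * c) with hκ
  have hκ0 : 0 < κ := by positivity
  set a := m / (2 * ℏ) with ha
  have ha0 : 0 < a := by positivity
  set K : ℝ := (m / (2 * Real.pi * ℏ)) ^ ((3 : ℝ) / 2) with hK
  have hK0 : 0 ≤ K := by positivity
  set B := κ * MA with hB
  set D := κ * LA / 2 with hD
  set F := 2 * (MV / ℏ) with hF
  set C := 101 * F * B ^ 3 * P + (100 * B ^ 4 * P + 2 * B ^ 2 * D * P + 2 / 3 * B ^ 3 * Q) with hC
  have hgint := integrable_exp_neg_mul_norm_sq_mul_pow ha0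
  set I := ∫ v : E3, Real.exp (-a * ‖v‖ ^ 2) * (‖v‖ ^ 3 + ‖v‖ ^ 4) with hI
  have hδ : 0 < min 1 (ℏ / (MV + 1)) := lt_min one_pos (by positivity)
  refine IsBigO.of_bound (K * (C * I)) ?_
  filter_upwards [Ioo_mem_nhdsGT hδ] with ε hε
  obtain ⟨hε0, hε1⟩ := hε
  have hεle1 : ε ≤ 1 := (hε1.trans_le (min_le_left _ _)).le
  have hεV : ε * (MV / ℏ) ≤ 1 := by
    have h := (hε1.trans_le (min_le_right _ _)).le
    rw [le_div_iff₀ (by positivity)] at h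
    rw [← mul_div_assoc, div_le_one hℏ]
    nlinarith
  obtain ⟨s, hs0, rfl⟩ : ∃ s : ℝ, 0 < s ∧ s ^ 2 = ε :=
    ⟨√ε, Real.sqrt_pos.2 hε0, Real.sq_sqrt hε0.le⟩
  have hs1 : s ≤ 1 := by nlinarith
  have hpref : s ^ 3 * (m / (2 * Real.pi * ℏ * s ^ 2)) ^ ((3 : ℝ) / 2) = K := by
    have h1 : m / (2 * Real.pi * ℏ * s ^ 2) = m / (2 * Real.pi * ℏ) / s ^ 2 := by
      rw [div_div]
    have h2 : (s ^ 2) ^ ((3 : ℝ) / 2) = s ^ 3 := by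
      rw [← Real.rpow_natCast s 2, ← Real.rpow_mul hs0.le, ← Real.rpow_natCast s 3]
      norm_num
    rw [h1, Real.div_rpow (by positivity) (by positivity), h2, hK]
    field_simp
  set K' := (m / (2 * Real.pi * ℏ * s ^ 2)) ^ ((3 : ℝ) / 2) with hK'
  have hK'0 : 0 ≤ K' := by positivity
  have hHc : Continuous (H0 (s ^ 2) x) := by
    have : H0 (s ^ 2) x = fun x' =>
      m * ‖x - x'‖ ^ 2 / (2 * (s ^ 2) ^ 2) + V ((2 : ℝ)⁻¹ • (x + x')) := funext (hH0 _ x)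
    rw [this]; fun_prop
  have hweight : ∀ x', K' * Real.exp (-(s ^ 2 / ℏ) * H0 (s ^ 2) x x') ≤
      K' * Real.exp (s ^ 2 / ℏ * MV) := by
    intro x'
    refine mul_le_mul_of_nonneg_left (Real.exp_le_exp.2 ?_) hK'0
    rw [neg_mul, ← mul_neg]
    refine mul_le_mul_of_nonneg_left ?_ (by positivity)
    rw [hH0]
    have h1 := neg_abs_le (V ((2 : ℝ)⁻¹ • (x + x')))
    have h2 := hMV ((2 : ℝ)⁻¹ • (x + x'))
    rw [Real.norm_eq_abs] at h2
    have h3 : 0 ≤ m * ‖x - x'‖ ^ 2 / (2 * (s ^ 2) ^ 2) := by positivity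
    linarith
  have hkernel : ∀ f : ℝ → ℝ, Continuous f → (∀ t, |f t| ≤ 5) →
      Integrable (fun x' => ((K' * Real.exp (-(s ^ 2 / ℏ) * H0 (s ^ 2) x x') * f (z x x') : ℝ) : ℂ)
        * ψ x') := by
    intro f hf hfb
    refine ψ.integrable.bdd_mul (c := K' * Real.exp (s ^ 2 / ℏ * MV) * 5)
      (Continuous.aestronglyMeasurable (by fun_prop)) (Eventually.of_forall fun x' => ?_)
    rw [Complex.norm_real, norm_mul, Real.norm_eq_abs, Real.norm_eq_abs,
      abs_of_nonneg (by positivity)]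
    exact mul_le_mul (hweight x') (hfb _) (abs_nonneg _) (by positivity)
  have hWt_int : Integrable (fun x' => (Wt (s ^ 2) x x' : ℂ) * ψ x') := by
    simp only [hWt]
    refine hkernel (fun t => Real.cos t - Real.sin t) (by fun_prop) fun t => ?_
    rw [abs_le]
    constructor <;>
      linarith [Real.cos_le_one t, Real.neg_one_le_cos t, Real.sin_le_one t,
        Real.neg_one_le_sin t]
  have hW_int : Integrable (fun x' => (W (s ^ 2) x x' : ℂ) * ψ x') := by
    simp only [hW]
    refine hkernel (fun t => Real.exp (-t - t ^ 2)) (by fun_prop) fun t => ?_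
    rw [abs_of_pos (Real.exp_pos _)]
    linarith [exp_neg_sub_sq_le_three t]
  have hdiff : ∀ x', (Wt (s ^ 2) x x' : ℂ) * ψ x' - (W (s ^ 2) x x' : ℂ) * ψ x' =
      ((K' * Real.exp (-(s ^ 2 / ℏ) * H0 (s ^ 2) x x') * phaseError (z x x') : ℝ) : ℂ) * ψ x' := by
    intro x'
    rw [hWt, hW, phaseError]
    push_cast
    ring
  rw [← integral_sub hWt_int hW_int]
  simp only [hdiff]
  have hΦ_int := hkernel phaseError continuous_phaseError abs_phaseError_le_five
  rw [integral_eq_pow_three_smul_integral_comp x hs0]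
  have hΦ_int' := (hΦ_int.comp_add_left x).comp_smul hs0.ne'
  set η : E3 → ℝ := fun v => Real.exp (-(s ^ 2 / ℏ) * V ((2 : ℝ)⁻¹ • (x + (x + s • v)))) with hη
  have hscale : ∀ v : E3,
      ((K' * Real.exp (-(s ^ 2 / ℏ) * H0 (s ^ 2) x (x + s • v)) * phaseError (z x (x + s • v)) : ℝ)
        : ℂ) * ψ (x + s • v) =
      (K' : ℂ) * ((Real.exp (-a * ‖v‖ ^ 2) : ℂ) *
        (((η v * phaseError (z x (x + s • v)) : ℝ) : ℂ) * ψ (x + s • v))) := by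
    intro v
    have : Real.exp (-(s ^ 2 / ℏ) * H0 (s ^ 2) x (x + s • v)) =
        Real.exp (-a * ‖v‖ ^ 2) * η v := by
      rw [hη, ← Real.exp_add, hH0]
      congr 1
      have : ‖x - (x + s • v)‖ = s * ‖v‖ := by
        rw [sub_add_cancel_left, norm_neg, norm_smul, Real.norm_eq_abs, abs_of_pos hs0]
      rw [this, ha]
      field_simp
      ring
    rw [this]
    push_cast
    ring
  simp only [hscale] at hΦ_int' ⊢
  rw [integral_const_mul, ← mul_assoc, ← Complex.ofReal_mul, hpref]
  set w : E3 → ℝ := fun v => -(κ * (s * ⟪v, A x⟫)) with hw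
  set T : E3 → ℂ := fun v => (Real.exp (-a * ‖v‖ ^ 2) : ℂ) * (((2 / 3 * w v ^ 3 : ℝ) : ℂ) * ψ x)
    with hT
  have hT_zero : ∫ v, T v = 0 := by
    have h1 := integral_neg_eq_self T volume
    have h2 : ∀ v, T (-v) = - T v := by
      intro v
      simp only [hT, hw, norm_neg, inner_neg_left]
      push_cast
      ring
    simp only [h2, integral_neg] at h1
    exact self_eq_neg.1 h1.symm
  have hw_le : ∀ v, |w v| ≤ B * (s * ‖v‖) := by
    intro v
    rw [hw, abs_neg, abs_mul, abs_mul, abs_of_pos hκ0, abs_of_pos hs0]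
    have := (abs_real_inner_le_norm v (A x)).trans
      (mul_le_mul_of_nonneg_left (hMA x) (norm_nonneg v))
    calc κ * (s * |⟪v, A x⟫|) ≤ κ * (s * (‖v‖ * MA)) := by gcongr
      _ = _ := by rw [hB]; ring
  have hzs : ∀ v, z x (x + s • v) =
      -(κ * (s * ⟪v, A ((2 : ℝ)⁻¹ • (x + (x + s • v)))⟫)) := by
    intro v
    rw [hz, sub_add_cancel_left, inner_neg_left, real_inner_smul_left]
    ring
  have hz_le : ∀ v, |z x (x + s • v)| ≤ B * (s * ‖v‖) := by
    intro v
    rw [hzs, abs_neg, abs_mul, abs_mul, abs_of_pos hκ0, abs_of_pos hs0]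
    have := (abs_real_inner_le_norm v (A ((2 : ℝ)⁻¹ • (x + (x + s • v))))).trans
      (mul_le_mul_of_nonneg_left (hMA _) (norm_nonneg v))
    calc κ * (s * |⟪v, A ((2 : ℝ)⁻¹ • (x + (x + s • v)))⟫|) ≤ κ * (s * (‖v‖ * MA)) := by gcongr
      _ = _ := by rw [hB]; ring
  have hzw : ∀ v, |z x (x + s • v) - w v| ≤ D * (s * ‖v‖) ^ 2 := by
    intro v
    have h1 : z x (x + s • v) - w v =
        -(κ * (s * ⟪v, A ((2 : ℝ)⁻¹ • (x + (x + s • v))) - A x⟫)) := by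
      rw [hzs, hw, inner_sub_right]; ring
    have h2 : ‖(2 : ℝ)⁻¹ • (x + (x + s • v)) - x‖ = s * ‖v‖ / 2 := by
      have : (2 : ℝ)⁻¹ • (x + (x + s • v)) - x = (s / 2) • v := by module
      rw [this, norm_smul, Real.norm_eq_abs, abs_of_pos (by positivity)]; ring
    have h3 := hAlip x ((2 : ℝ)⁻¹ • (x + (x + s • v)))
    rw [h2] at h3
    have h4 := (abs_real_inner_le_norm v (A ((2 : ℝ)⁻¹ • (x + (x + s • v))) - A x)).trans
      (mul_le_mul_of_nonneg_left h3 (norm_nonneg v))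
    rw [h1, abs_neg, abs_mul, abs_mul, abs_of_pos hκ0, abs_of_pos hs0]
    calc _ ≤ κ * (s * (‖v‖ * (LA * (s * ‖v‖ / 2)))) := by gcongr
      _ = _ := by rw [hD]; ring
  have hη_le : ∀ v, |η v - 1| ≤ F * s ^ 2 := by
    intro v
    have h1 : |-(s ^ 2 / ℏ) * V ((2 : ℝ)⁻¹ • (x + (x + s • v)))| ≤ s ^ 2 * (MV / ℏ) := by
      rw [abs_mul, abs_neg, abs_of_pos (by positivity)]
      calc _ ≤ s ^ 2 / ℏ * MV := by gcongr; exact hMV _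
        _ = _ := by ring
    have h2 := Real.abs_exp_sub_one_le (h1.trans hεV)
    calc |η v - 1| ≤ _ := h2
      _ ≤ 2 * (s ^ 2 * (MV / ℏ)) := by gcongr
      _ = _ := by rw [hF]; ring
  have hψ_le : ∀ v : E3, ‖ψ (x + s • v) - ψ x‖ ≤ Q * (s * ‖v‖) := by
    intro v
    have := hψlip x (x + s • v)
    rwa [add_sub_cancel_left, norm_smul, Real.norm_eq_abs, abs_of_pos hs0] at this
  have hT_int : Integrable T := by
    refine (hgint.mul_const (B ^ 3 * P)).mono' (Continuous.aestronglyMeasurable (by fun_prop))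
      (Eventually.of_forall fun v => ?_)
    have h1 : |w v| ^ 3 ≤ (B * ‖v‖) ^ 3 := by
      refine pow_le_pow_left₀ (abs_nonneg _) ((hw_le v).trans ?_) 3
      gcongr
      exact mul_le_of_le_one_left (norm_nonneg v) hs1
    rw [hT, norm_mul, norm_mul, Complex.norm_real, Complex.norm_real, Real.norm_eq_abs,
      Real.norm_eq_abs, abs_of_pos (Real.exp_pos _), abs_mul, abs_pow,
      abs_of_pos (by norm_num : (0 : ℝ) < 2 / 3), mul_assoc (Real.exp _)]
    refine mul_le_mul_of_nonneg_left ?_ (Real.exp_pos _).le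
    calc 2 / 3 * |w v| ^ 3 * ‖ψ x‖ ≤ 1 * (B * ‖v‖) ^ 3 * P := by
          gcongr
          · norm_num
          · exact hP x
      _ = ‖v‖ ^ 3 * (B ^ 3 * P) := by ring
      _ ≤ (‖v‖ ^ 3 + ‖v‖ ^ 4) * (B ^ 3 * P) := by
          gcongr
          exact le_add_of_nonneg_right (by positivity)
  have hK'pos : 0 < K' := by positivity
  have hG_int : Integrable (fun v : E3 => (Real.exp (-a * ‖v‖ ^ 2) : ℂ) *
      (((η v * phaseError (z x (x + s • v)) : ℝ) : ℂ) * ψ (x + s • v))) :=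
    (integrable_const_mul_iff (Complex.ofReal_ne_zero.2 hK'pos.ne').isUnit _).1 hΦ_int'
  rw [← add_zero (∫ v : E3, _), ← hT_zero, ← integral_add hG_int hT_int, norm_mul,
    Complex.norm_real, Real.norm_eq_abs, abs_of_nonneg hK0, mul_assoc]
  refine mul_le_mul_of_nonneg_left ?_ hK0
  have hbound := norm_integral_le_of_norm_le (hgint.const_mul (C * s ^ 4))
    (f := fun v : E3 => (Real.exp (-a * ‖v‖ ^ 2) : ℂ) *
      (((η v * phaseError (z x (x + s • v)) : ℝ) : ℂ) * ψ (x + s • v)) + T v)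
    (Eventually.of_forall fun v => by
      have h := norm_phaseError_mul_add_cube_le (hz_le v) (hw_le v) (hzw v) (hη_le v)
        (hP (x + s • v)) (hψ_le v)
      have h5 : s ^ 5 ≤ s ^ 4 := pow_le_pow_of_le_one hs0.le hs1 (by norm_num)
      rw [hT, ← mul_add, norm_mul, Complex.norm_real, Real.norm_eq_abs,
        abs_of_pos (Real.exp_pos _), mul_left_comm]
      refine mul_le_mul_of_nonneg_left (h.trans ?_) (Real.exp_pos _).le
      have e1 : s ^ 2 * (s * ‖v‖) ^ 3 ≤ s ^ 4 * (‖v‖ ^ 3 + ‖v‖ ^ 4) := by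
        calc s ^ 2 * (s * ‖v‖) ^ 3 = s ^ 5 * ‖v‖ ^ 3 := by ring
          _ ≤ s ^ 4 * (‖v‖ ^ 3 + ‖v‖ ^ 4) := by
            gcongr
            exact le_add_of_nonneg_right (by positivity)
      have e2 : (s * ‖v‖) ^ 4 ≤ s ^ 4 * (‖v‖ ^ 3 + ‖v‖ ^ 4) := by
        rw [mul_pow]
        gcongr
        exact le_add_of_nonneg_left (by positivity)
      rw [hC, mul_assoc (_ + _), add_mul (101 * F * B ^ 3 * P)]
      gcongr)
  refine hbound.trans_eq ?_
  rw [integral_const_mul, ← hI, Real.norm_eq_abs, abs_of_nonneg (by positivity)]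
  ring


end
end

section
/- Let m, ℏ, e, c > 0 be real constants, let V : ℝ³ → ℝ and A : ℝ³ → ℝ³ be smooth functions all of whose derivatives up to order 2 are bounded, and let ψ : ℝ³ → ℂ be a Schwartz function. For ε > 0 and x, x′ ∈ ℝ³ set B(x, x′) := (e/c)·((x − x′)/ε)·A((x + x′)/2) (Euclidean inner product) and define the two real non-negative kernels W(x, x′) := (m/(2·π·ℏ·ε))^{3/2} · exp( −(ε/ℏ)·[ m·‖x − x′‖²/(2·ε²) + V((x + x′)/2) + B(x, x′) + (ε/ℏ)·B(x, x′)² ] ) and K(x, x′) := (m/(2·π·ℏ·ε))^{3/2} · exp( −(ε/ℏ)·[ m·‖x − x′‖²/(2·ε²) + V((x + x′)/2) + B(x, x′) + (e²/(m·c²))·‖A((x + x′)/2)‖² ] ). Then for every x ∈ ℝ³, the function ε ↦ (∫ W(x, x′)·ψ(x′) dx′) − (∫ K(x, x′)·ψ(x′) dx′) is O(ε²) as ε → 0 from the right. -/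
open MeasureTheory Asymptotics Filter Real
open scoped RealInnerProductSpace

noncomputable section

local notation "E3" => EuclideanSpace ℝ (Fin 3)

section SymmExpansion

variable {E F G H : Type*} [NormedAddCommGroup E]
  [NormedAddCommGroup F] [NormedSpace ℝ F] [NormedAddCommGroup G] [NormedSpace ℝ G]
  [NormedAddCommGroup H] [NormedSpace ℝ H]

/-- `K` grows at most exponentially in the norm of its argument. -/
def ExpGrowth (K : E → ℝ) : Prop := ∃ C : ℝ, ∀ y, |K y| ≤ C * exp (C * ‖y‖)

theorem ExpGrowth.of_le {K : E → ℝ} {a b : ℝ} (ha : 0 ≤ a)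
    (h : ∀ y, |K y| ≤ a * exp (b * ‖y‖)) : ExpGrowth K := by
  refine ⟨max a b, fun y => (h y).trans ?_⟩
  have : 0 ≤ max a b := ha.trans (le_max_left _ _)
  gcongr
  · exact le_max_left _ _
  · exact le_max_right _ _

theorem expGrowth_const (a : ℝ) : ExpGrowth fun _ : E => a :=
  .of_le (b := 0) (abs_nonneg a) fun _ => by simp

theorem expGrowth_norm : ExpGrowth fun y : E => ‖y‖ :=
  .of_le (a := 1) (b := 1) zero_le_one fun y => by
    have := add_one_le_exp ‖y‖
    rw [abs_norm, one_mul, one_mul]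
    linarith

theorem expGrowth_exp (a : ℝ) : ExpGrowth fun y : E => exp (a * ‖y‖) :=
  .of_le (a := 1) (b := a) zero_le_one fun y => by simp

theorem ExpGrowth.mul {K L : E → ℝ} (hK : ExpGrowth K) (hL : ExpGrowth L) :
    ExpGrowth fun y => K y * L y := by
  obtain ⟨C, hC⟩ := hK
  obtain ⟨D, hD⟩ := hL
  have h0 : 0 ≤ C * exp (C * ‖(0 : E)‖) := (abs_nonneg _).trans (hC 0)
  have h1 : 0 ≤ D * exp (D * ‖(0 : E)‖) := (abs_nonneg _).trans (hD 0)
  simp only [norm_zero, mul_zero, exp_zero, mul_one] at h0 h1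
  refine .of_le (a := C * D) (b := C + D) (by positivity) fun y => ?_
  rw [abs_mul, add_mul, exp_add]
  calc |K y| * |L y| ≤ (C * exp (C * ‖y‖)) * (D * exp (D * ‖y‖)) := by
        gcongr
        · exact hC y
        · exact hD y
    _ = _ := by ring

theorem ExpGrowth.add {K L : E → ℝ} (hK : ExpGrowth K) (hL : ExpGrowth L) :
    ExpGrowth fun y => K y + L y := by
  obtain ⟨C, hC⟩ := hK
  obtain ⟨D, hD⟩ := hL
  have h0 : 0 ≤ C * exp (C * ‖(0 : E)‖) := (abs_nonneg _).trans (hC 0)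
  have h1 : 0 ≤ D * exp (D * ‖(0 : E)‖) := (abs_nonneg _).trans (hD 0)
  simp only [norm_zero, mul_zero, exp_zero, mul_one] at h0 h1
  refine .of_le (a := C + D) (b := C + D) (by positivity) fun y => ?_
  calc |K y + L y| ≤ C * exp (C * ‖y‖) + D * exp (D * ‖y‖) :=
        (abs_add_le _ _).trans (add_le_add (hC y) (hD y))
    _ ≤ C * exp ((C + D) * ‖y‖) + D * exp ((C + D) * ‖y‖) := by
        gcongr <;> linarith
    _ = _ := by ring

/-- `f s y` agrees with `f 0 y` up to `O(s)`, and up to `O(s ^ 2)` after averaging over `± s`,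
with constants growing at most exponentially in `y`. -/
def HasSymmExpansion (f : ℝ → E → F) : Prop :=
  ∃ K : E → ℝ, ExpGrowth K ∧ (∀ y, 0 ≤ K y) ∧ ∀ s y, |s| ≤ 1 →
    ‖f 0 y‖ ≤ K y ∧ ‖f s y - f 0 y‖ ≤ |s| * K y ∧
      ‖f s y + f (-s) y - (2 : ℝ) • f 0 y‖ ≤ s ^ 2 * K y

theorem HasSymmExpansion.exists_bound {f : ℝ → E → F} (hf : HasSymmExpansion f) :
    ∃ K : E → ℝ, ExpGrowth K ∧ (∀ y, 0 ≤ K y) ∧ ∀ s y, |s| ≤ 1 → ‖f s y‖ ≤ K y := by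
  obtain ⟨K, hK, hK0, h⟩ := hf
  refine ⟨fun y => K y + K y, hK.add hK, fun y => add_nonneg (hK0 y) (hK0 y), fun s y hs => ?_⟩
  obtain ⟨h1, h2, -⟩ := h s y hs
  have h3 : |s| * K y ≤ 1 * K y := mul_le_mul_of_nonneg_right hs (hK0 y)
  have h4 := norm_add_le (f s y - f 0 y) (f 0 y)
  rw [sub_add_cancel] at h4
  linarith

theorem HasSymmExpansion.bilin {f : ℝ → E → F} {g : ℝ → E → G} (hf : HasSymmExpansion f)
    (hg : HasSymmExpansion g) (L : F →L[ℝ] G →L[ℝ] H) :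
    HasSymmExpansion fun s y => L (f s y) (g s y) := by
  obtain ⟨K, hK, hK0, hf⟩ := hf
  obtain ⟨M, hM, hM0, hg⟩ := hg
  have hL : ∀ (a : F) (b : G) (p q : ℝ), ‖a‖ ≤ p → ‖b‖ ≤ q → ‖L a b‖ ≤ ‖L‖ * p * q := by
    intro a b p q ha hb
    have := (norm_nonneg a).trans ha
    refine (L.le_opNorm₂ a b).trans ?_
    gcongr
  refine ⟨fun y => 4 * ‖L‖ * (K y * M y), (expGrowth_const _).mul (hK.mul hM), fun y => ?_,
    fun s y hs => ?_⟩
  · have := hK0 y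
    have := hM0 y
    positivity
  obtain ⟨f0, f1, f2⟩ := hf s y hs
  obtain ⟨g0, g1, g2⟩ := hg s y hs
  obtain ⟨-, f3, -⟩ := hf (-s) y (by rwa [abs_neg])
  obtain ⟨-, g3, -⟩ := hg (-s) y (by rwa [abs_neg])
  rw [abs_neg] at f3 g3
  have hP : 0 ≤ ‖L‖ * (K y * M y) := by
    have := hK0 y
    have := hM0 y
    positivity
  have hs0 := abs_nonneg s
  have hss : |s| * |s| = s ^ 2 := by rw [← sq, sq_abs]
  refine ⟨?_, ?_, ?_⟩
  · have := hL _ _ _ _ f0 g0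
    nlinarith
  · have e : L (f s y) (g s y) - L (f 0 y) (g 0 y) = L (f s y - f 0 y) (g 0 y)
        + L (f 0 y) (g s y - g 0 y) + L (f s y - f 0 y) (g s y - g 0 y) := by
      simp only [map_sub, sub_apply]; abel
    rw [e]
    refine norm_add₃_le.trans ?_
    have a1 := hL _ _ _ _ f1 g0
    have a2 := hL _ _ _ _ f0 g1
    have a3 := hL _ _ _ _ f1 g1
    have a4 : |s| * |s| * (‖L‖ * (K y * M y)) ≤ |s| * (‖L‖ * (K y * M y)) := by
      gcongr
      nlinarith
    nlinarith
  · have e : L (f s y) (g s y) + L (f (-s) y) (g (-s) y) - (2 : ℝ) • L (f 0 y) (g 0 y)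
        = L (f s y + f (-s) y - (2 : ℝ) • f 0 y) (g 0 y)
        + L (f 0 y) (g s y + g (-s) y - (2 : ℝ) • g 0 y)
        + (L (f s y - f 0 y) (g s y - g 0 y) + L (f (-s) y - f 0 y) (g (-s) y - g 0 y)) := by
      simp only [map_sub, map_add, map_smul, sub_apply,
        add_apply, smul_apply]
      module
    rw [e]
    refine norm_add₃_le.trans ?_
    have a1 := hL _ _ _ _ f2 g0
    have a2 := hL _ _ _ _ f0 g2
    have a3 := hL _ _ _ _ f1 g1
    have a4 := hL _ _ _ _ f3 g3
    have a5 := norm_add_le (L (f s y - f 0 y) (g s y - g 0 y))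
      (L (f (-s) y - f 0 y) (g (-s) y - g 0 y))
    have a6 : ‖L‖ * (|s| * K y) * (|s| * M y) = s ^ 2 * (‖L‖ * (K y * M y)) := by
      rw [← hss]; ring
    linarith

theorem HasSymmExpansion.add {f g : ℝ → E → F} (hf : HasSymmExpansion f)
    (hg : HasSymmExpansion g) : HasSymmExpansion fun s y => f s y + g s y := by
  obtain ⟨K, hK, hK0, hf⟩ := hf
  obtain ⟨M, hM, hM0, hg⟩ := hg
  refine ⟨fun y => K y + M y, hK.add hM, fun y => add_nonneg (hK0 y) (hM0 y), fun s y hs => ?_⟩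
  obtain ⟨f0, f1, f2⟩ := hf s y hs
  obtain ⟨g0, g1, g2⟩ := hg s y hs
  refine ⟨(norm_add_le _ _).trans (add_le_add f0 g0), ?_, ?_⟩
  · rw [add_sub_add_comm, mul_add]
    exact (norm_add_le _ _).trans (add_le_add f1 g1)
  · rw [mul_add, show f s y + g s y + (f (-s) y + g (-s) y) - (2 : ℝ) • (f 0 y + g 0 y) =
      (f s y + f (-s) y - (2 : ℝ) • f 0 y) + (g s y + g (-s) y - (2 : ℝ) • g 0 y) by module]
    exact (norm_add_le _ _).trans (add_le_add f2 g2)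

theorem hasSymmExpansion_of_growth {f : E → F} {K : E → ℝ} (hK : ExpGrowth K)
    (h : ∀ y, ‖f y‖ ≤ K y) : HasSymmExpansion fun _ y => f y := by
  refine ⟨K, hK, fun y => (norm_nonneg _).trans (h y), fun s y _ => ⟨h y, ?_, ?_⟩⟩
  · have := (norm_nonneg _).trans (h y)
    simp only [sub_self, norm_zero]
    positivity
  · have := (norm_nonneg _).trans (h y)
    simp only [← two_smul ℝ, sub_self, norm_zero]
    positivity

theorem hasSymmExpansion_const (a : F) : HasSymmExpansion fun (_ : ℝ) (_ : E) => a :=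
  hasSymmExpansion_of_growth (expGrowth_const ‖a‖) fun _ => le_rfl

theorem hasSymmExpansion_parameter : HasSymmExpansion fun (s : ℝ) (_ : E) => s :=
  ⟨fun _ => 1, expGrowth_const 1, fun _ => zero_le_one, fun s y _ => by
    simp only [norm_zero, sub_zero, norm_eq_abs, mul_one, smul_zero, add_neg_cancel]
    exact ⟨zero_le_one, le_rfl, sq_nonneg s⟩⟩

theorem HasSymmExpansion.smul {f : ℝ → E → ℝ} {g : ℝ → E → F} (hf : HasSymmExpansion f)
    (hg : HasSymmExpansion g) : HasSymmExpansion fun s y => f s y • g s y :=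
  hf.bilin hg (ContinuousLinearMap.lsmul ℝ ℝ)

theorem HasSymmExpansion.mul {f g : ℝ → E → ℝ} (hf : HasSymmExpansion f)
    (hg : HasSymmExpansion g) : HasSymmExpansion fun s y => f s y * g s y :=
  hf.smul hg

theorem HasSymmExpansion.const_mul {f : ℝ → E → ℝ} (hf : HasSymmExpansion f) (a : ℝ) :
    HasSymmExpansion fun s y => a * f s y :=
  (hasSymmExpansion_const a).mul hf

theorem Real.abs_exp_sub_one_le_mul_exp (x : ℝ) : |exp x - 1| ≤ |x| * exp |x| := by
  have h := Complex.norm_exp_sub_sum_le_norm_mul_exp (x : ℂ) 1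
  rw [Finset.sum_range_one, pow_zero, pow_one, Nat.factorial_zero, Nat.cast_one, div_one,
    ← Complex.ofReal_exp, ← Complex.ofReal_one, ← Complex.ofReal_sub, Complex.norm_real,
    Complex.norm_real, norm_eq_abs, norm_eq_abs] at h
  exact h

theorem Real.abs_exp_sub_one_sub_le_sq_mul_exp (x : ℝ) :
    |exp x - 1 - x| ≤ x ^ 2 * exp |x| := by
  have h := Complex.norm_exp_sub_sum_le_norm_mul_exp (x : ℂ) 2
  rw [Finset.sum_range_succ, Finset.sum_range_one, pow_zero, pow_one, Nat.factorial_zero,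
    Nat.factorial_one, Nat.cast_one, div_one, div_one, ← sub_sub, ← Complex.ofReal_exp,
    ← Complex.ofReal_one, ← Complex.ofReal_sub, ← Complex.ofReal_sub, Complex.norm_real,
    Complex.norm_real, norm_eq_abs, norm_eq_abs, sq_abs] at h
  exact h

theorem HasSymmExpansion.rexp {w : ℝ → E → ℝ} (hw : HasSymmExpansion w) (h0 : ∀ y, w 0 y = 0)
    {C : ℝ} (hC : ∀ s y, |s| ≤ 1 → |w s y| ≤ C * (1 + ‖y‖)) :
    HasSymmExpansion fun s y => Real.exp (w s y) := by
  obtain ⟨K, hK, hK0, hw⟩ := hw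
  have hG : ExpGrowth fun y : E => Real.exp (C * (1 + ‖y‖)) := by
    simpa only [mul_add, exp_add] using (expGrowth_const (E := E) (Real.exp (C * 1))).mul
      (expGrowth_exp C)
  refine ⟨fun y => 1 + (K y * Real.exp (C * (1 + ‖y‖)) +
      (K y + 2 * (K y * K y) * Real.exp (C * (1 + ‖y‖)))),
    (expGrowth_const 1).add ((hK.mul hG).add
      (hK.add (((expGrowth_const 2).mul (hK.mul hK)).mul hG))), fun y => ?_, fun s y hs => ?_⟩
  · have := hK0 y
    positivity
  obtain ⟨-, f1, f2⟩ := hw s y hs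
  obtain ⟨-, f3, -⟩ := hw (-s) y (by rwa [abs_neg])
  simp only [h0, sub_zero, smul_zero, norm_eq_abs, abs_neg] at f1 f2 f3
  set X := Real.exp (C * (1 + ‖y‖))
  have hk := hK0 y
  have hX0 : 0 < X := exp_pos _
  have x1 : Real.exp |w s y| ≤ X := exp_le_exp.2 (hC s y hs)
  have x2 : Real.exp |w (-s) y| ≤ X := exp_le_exp.2 (hC (-s) y (by rwa [abs_neg]))
  have sq_le : ∀ v : ℝ, |v| ≤ |s| * K y → v ^ 2 ≤ s ^ 2 * (K y * K y) := fun v hv => by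
    rw [← sq_abs v, ← sq_abs s]
    calc |v| ^ 2 ≤ (|s| * K y) ^ 2 := by gcongr
      _ = _ := by ring
  simp only [h0, exp_zero, norm_eq_abs, abs_one, smul_eq_mul, mul_one]
  refine ⟨?_, ?_, ?_⟩
  · have : 0 ≤ K y * X + (K y + 2 * (K y * K y) * X) := by positivity
    linarith
  · calc |Real.exp (w s y) - 1| ≤ |w s y| * Real.exp |w s y| := abs_exp_sub_one_le_mul_exp _
      _ ≤ (|s| * K y) * X := by gcongr
      _ = |s| * (K y * X) := by ring
      _ ≤ _ := by
        gcongr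
        have : 0 ≤ K y + 2 * (K y * K y) * X := by positivity
        linarith
  · have a1 := abs_exp_sub_one_sub_le_sq_mul_exp (w s y)
    have a2 := abs_exp_sub_one_sub_le_sq_mul_exp (w (-s) y)
    have b1 : w s y ^ 2 * Real.exp |w s y| ≤ s ^ 2 * (K y * K y) * X := by
      gcongr
      exact sq_le _ f1
    have b2 : w (-s) y ^ 2 * Real.exp |w (-s) y| ≤ s ^ 2 * (K y * K y) * X := by
      gcongr
      exact sq_le _ f3
    have e : Real.exp (w s y) + Real.exp (w (-s) y) - 2 = (w s y + w (-s) y) +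
      (Real.exp (w s y) - 1 - w s y) + (Real.exp (w (-s) y) - 1 - w (-s) y) := by ring
    rw [e]
    refine (abs_add_three _ _ _).trans ?_
    have : 0 ≤ s ^ 2 * (1 + K y * X) := by positivity
    linarith

end SymmExpansion

section Taylor

variable {E F : Type*} [NormedAddCommGroup E] [NormedSpace ℝ E]
  [NormedAddCommGroup F] [NormedSpace ℝ F]

theorem norm_sub_sub_fderiv_le_of_iteratedFDeriv_two_le {f : E → F} (hf : ContDiff ℝ 2 f) {C : ℝ}
    (hC : ∀ x, ‖iteratedFDeriv ℝ 2 f x‖ ≤ C) (x v : E) :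
    ‖f (x + v) - f x - fderiv ℝ f x v‖ ≤ C * ‖v‖ ^ 2 := by
  have hd : Differentiable ℝ (fderiv ℝ f) :=
    (hf.fderiv_right (m := 1) (by norm_num)).differentiable (by norm_num)
  have hlip (y : E) : ‖fderiv ℝ f y - fderiv ℝ f x‖ ≤ C * ‖y - x‖ :=
    convex_univ.norm_image_sub_le_of_norm_fderiv_le (fun z _ => hd z)
      (fun z _ => by rw [← norm_iteratedFDeriv_one, norm_iteratedFDeriv_fderiv]; exact hC z)
      (Set.mem_univ x) (Set.mem_univ y)
  have hC0 : 0 ≤ C := (norm_nonneg _).trans (hC x)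
  have := (convex_closedBall x ‖v‖).norm_image_sub_le_of_norm_fderiv_le' (𝕜 := ℝ) (f := f)
    (φ := fderiv ℝ f x) (C := C * ‖v‖) (x := x) (y := x + v)
    (fun z _ => hf.differentiable (by norm_num) z)
    (fun z hz => (hlip z).trans (by
      rw [mem_closedBall_iff_norm] at hz
      gcongr))
    (Metric.mem_closedBall_self (norm_nonneg v)) (by simp)
  rw [add_sub_cancel_left] at this
  rwa [sq, ← mul_assoc]

theorem hasSymmExpansion_of_iteratedFDeriv_le {f : E → F} (hf : ContDiff ℝ 2 f)
    (hb : ∀ i : ℕ, i ≤ 2 → ∃ C, ∀ x, ‖iteratedFDeriv ℝ i f x‖ ≤ C) (x : E) (a : ℝ) :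
    HasSymmExpansion fun s y => f (x + s • a • y) := by
  obtain ⟨C₀, h0⟩ := hb 0 (by norm_num)
  obtain ⟨C₁, h1⟩ := hb 1 (by norm_num)
  obtain ⟨C₂, h2⟩ := hb 2 le_rfl
  have p0 : 0 ≤ C₀ := (norm_nonneg _).trans (h0 x)
  have p1 : 0 ≤ C₁ := (norm_nonneg _).trans (h1 x)
  have p2 : 0 ≤ C₂ := (norm_nonneg _).trans (h2 x)
  refine ⟨fun y => C₀ + (C₁ * |a| * ‖y‖ + 2 * C₂ * a ^ 2 * (‖y‖ * ‖y‖)),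
    (expGrowth_const _).add (((expGrowth_const _).mul expGrowth_norm).add
      ((expGrowth_const _).mul (expGrowth_norm.mul expGrowth_norm))),
    fun y => by positivity, fun s y hs => ?_⟩
  have q1 : 0 ≤ C₁ * |a| * ‖y‖ := by positivity
  have q2 : 0 ≤ 2 * C₂ * a ^ 2 * (‖y‖ * ‖y‖) := by positivity
  simp only [zero_smul, add_zero]
  refine ⟨?_, ?_, ?_⟩
  · have := h0 x
    rw [norm_iteratedFDeriv_zero] at this
    linarith
  · have h := convex_univ.norm_image_sub_le_of_norm_fderiv_le (𝕜 := ℝ) (f := f)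
      (fun z _ => hf.differentiable (by norm_num) z)
      (fun z _ => by rw [← norm_iteratedFDeriv_one]; exact h1 z)
      (Set.mem_univ x) (Set.mem_univ (x + s • a • y))
    rw [add_sub_cancel_left, norm_smul, norm_smul, norm_eq_abs, norm_eq_abs] at h
    calc _ ≤ _ := h
      _ = |s| * (C₁ * |a| * ‖y‖) := by ring
      _ ≤ _ := by
        gcongr
        linarith
  · have e : f (x + s • a • y) + f (x + (-s) • a • y) - (2 : ℝ) • f x =
        (f (x + s • a • y) - f x - fderiv ℝ f x (s • a • y)) +
        (f (x + (-s) • a • y) - f x - fderiv ℝ f x ((-s) • a • y)) := by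
      rw [neg_smul, map_neg]
      module
    have n1 := norm_sub_sub_fderiv_le_of_iteratedFDeriv_two_le hf h2 x (s • a • y)
    have n2 := norm_sub_sub_fderiv_le_of_iteratedFDeriv_two_le hf h2 x ((-s) • a • y)
    simp only [norm_smul, norm_eq_abs, abs_neg, mul_pow, sq_abs] at n1 n2
    rw [e]
    refine (norm_add_le _ _).trans ?_
    have : 0 ≤ s ^ 2 * (C₀ + C₁ * |a| * ‖y‖) := by positivity
    linarith

end Taylor

section Gaussian

variable {E F : Type*} [NormedAddCommGroup E] [InnerProductSpace ℝ E] [FiniteDimensional ℝ E]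
  [MeasurableSpace E] [BorelSpace E] [NormedAddCommGroup F] [NormedSpace ℝ F]
  {β : ℝ}

theorem integrable_exp_neg_mul_sq_norm (hβ : 0 < β) :
    Integrable fun y : E => exp (-β * ‖y‖ ^ 2) := by
  have h := (GaussianFourier.integrable_cexp_neg_mul_sq_norm_add (V := E) (b := β)
    (by simpa using hβ) 0 0).norm
  refine h.congr (.of_forall fun y => ?_)
  simp only [zero_mul, add_zero]
  rw [← Complex.ofReal_pow, ← Complex.ofReal_neg, ← Complex.ofReal_mul, ← Complex.ofReal_exp,
    Complex.norm_real, norm_eq_abs, abs_exp]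

theorem ExpGrowth.integrable_gaussian_mul {K : E → ℝ} (hK : ExpGrowth K) (hβ : 0 < β)
    {f : E → F} (hf : Continuous f) (hfK : ∀ y, ‖f y‖ ≤ K y) :
    Integrable fun y => exp (-β * ‖y‖ ^ 2) • f y := by
  obtain ⟨C, hC⟩ := hK
  refine ((integrable_exp_neg_mul_sq_norm (E := E) (half_pos hβ)).const_mul
    (C * exp (C ^ 2 / (2 * β)))).mono' (by fun_prop) (.of_forall fun y => ?_)
  have h1 := (hfK y).trans ((le_abs_self _).trans (hC y))
  rw [norm_smul, norm_eq_abs, abs_exp]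
  have hC0 : 0 ≤ C := by
    have := (norm_nonneg _).trans h1
    exact nonneg_of_mul_nonneg_left this (exp_pos _)
  calc exp (-β * ‖y‖ ^ 2) * ‖f y‖ ≤ exp (-β * ‖y‖ ^ 2) * (C * exp (C * ‖y‖)) := by gcongr
    _ = C * exp (-β * ‖y‖ ^ 2 + C * ‖y‖) := by rw [exp_add]; ring
    _ ≤ C * exp (C ^ 2 / (2 * β) + -(β / 2) * ‖y‖ ^ 2) := by
      refine mul_le_mul_of_nonneg_left (exp_le_exp.2 ?_) hC0
      have : C ^ 2 / (2 * β) + -(β / 2) * ‖y‖ ^ 2 - (-β * ‖y‖ ^ 2 + C * ‖y‖) =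
        (C - β * ‖y‖) ^ 2 / (2 * β) := by field_simp; ring
      have : 0 ≤ (C - β * ‖y‖) ^ 2 / (2 * β) := by positivity
      linarith
    _ = _ := by rw [exp_add]; ring

theorem ExpGrowth.exists_norm_integral_gaussian_le {K : E → ℝ} (hK : ExpGrowth K) (hβ : 0 < β) :
    ∃ C, ∀ (f : E → F) (r : ℝ), 0 ≤ r → (∀ y, ‖f y‖ ≤ r * K y) →
      ‖∫ y, exp (-β * ‖y‖ ^ 2) • f y‖ ≤ r * C := by
  obtain ⟨D, hD⟩ := hK
  have hL : ExpGrowth fun y : E => D * exp (D * ‖y‖) := (expGrowth_const D).mul (expGrowth_exp D)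
  have hi := hL.integrable_gaussian_mul hβ (f := fun y : E => D * exp (D * ‖y‖)) (by fun_prop)
    fun y => (norm_of_nonneg ((abs_nonneg _).trans (hD y))).le
  refine ⟨∫ y : E, exp (-β * ‖y‖ ^ 2) • (D * exp (D * ‖y‖)), fun f r hr hf => ?_⟩
  rw [← integral_const_mul]
  refine norm_integral_le_of_norm_le (hi.const_mul r) (.of_forall fun y => ?_)
  rw [norm_smul, norm_eq_abs, abs_exp, smul_eq_mul, mul_left_comm]
  gcongr
  exact (hf y).trans (mul_le_mul_of_nonneg_left ((le_abs_self _).trans (hD y)) hr)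

theorem integrable_exp_neg_mul_sq_norm_mul_inner_sq (hβ : 0 < β) (a : E) :
    Integrable fun y : E => exp (-β * ‖y‖ ^ 2) * ⟪y, a⟫ ^ 2 := by
  have hl : ExpGrowth fun y : E => ‖y‖ * ‖a‖ := expGrowth_norm.mul (expGrowth_const _)
  refine (hl.mul hl).integrable_gaussian_mul hβ (by fun_prop) fun y => ?_
  rw [norm_pow, sq]
  have := norm_inner_le_norm (𝕜 := ℝ) y a
  gcongr

/-- Second moments of an isotropic Gaussian. -/
theorem integral_exp_neg_mul_sq_norm_mul_inner_sq (hβ : 0 < β) (a : E) :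
    ∫ y, exp (-β * ‖y‖ ^ 2) * ⟪y, a⟫ ^ 2 =
      ‖a‖ ^ 2 / (2 * β) * ∫ y : E, exp (-β * ‖y‖ ^ 2) := by
  have hf (y : E) : HasFDerivAt (fun y : E => ⟪a, y⟫) (innerSL ℝ a) y := (innerSL ℝ a).hasFDerivAt
  have hg (y : E) : HasFDerivAt (fun y : E => exp (-β * ‖y‖ ^ 2))
      (exp (-β * ‖y‖ ^ 2) • -β • (2 • innerSL ℝ y)) y :=
    ((hasStrictFDerivAt_norm_sq y).hasFDerivAt.const_mul (-β)).exp
  have hin : ∀ y : E, ‖⟪a, y⟫‖ ≤ ‖a‖ * ‖y‖ := fun y => norm_inner_le_norm a y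
  have hl : ExpGrowth fun y : E => ‖a‖ * ‖y‖ := (expGrowth_const _).mul expGrowth_norm
  have i1 := (expGrowth_const ‖‖a‖ ^ 2‖).integrable_gaussian_mul hβ (E := E)
    (f := fun _ => ‖a‖ ^ 2) (by fun_prop) fun _ => le_rfl
  have i2 := hl.integrable_gaussian_mul hβ (f := fun y => ⟪a, y⟫) (by fun_prop) hin
  have key := integral_mul_fderiv_eq_neg_fderiv_mul_of_integrable (μ := (volume : Measure E))
    (f := fun y : E => ⟪a, y⟫) (g := fun y : E => exp (-β * ‖y‖ ^ 2)) (v := a)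
    (i1.congr (.of_forall fun y => by
      simp [(hf y).fderiv, mul_comm]))
    (((integrable_exp_neg_mul_sq_norm_mul_inner_sq hβ a).const_mul (-2 * β)).congr
      (.of_forall fun y => by
      simp only [(hg y).fderiv, smul_apply, innerSL_apply_apply, smul_eq_mul,
        real_inner_comm a y, nsmul_eq_mul]
      ring))
    (i2.congr (.of_forall fun y => by simp [mul_comm]))
    (fun y _ => (hf y).differentiableAt) (fun y _ => (hg y).differentiableAt)
  have e1 : ∫ y : E, ⟪a, y⟫ * fderiv ℝ (fun y : E => exp (-β * ‖y‖ ^ 2)) y a =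
      (-2 * β) * ∫ y, exp (-β * ‖y‖ ^ 2) * ⟪y, a⟫ ^ 2 := by
    rw [← integral_const_mul]
    congr 1 with y
    simp only [(hg y).fderiv, smul_apply, innerSL_apply_apply, smul_eq_mul,
        real_inner_comm a y, nsmul_eq_mul]
    ring
  have e2 : ∫ y : E, fderiv ℝ (fun y : E => ⟪a, y⟫) y a * exp (-β * ‖y‖ ^ 2) =
      ‖a‖ ^ 2 * ∫ y : E, exp (-β * ‖y‖ ^ 2) := by
    rw [← integral_const_mul]
    congr 1 with y
    simp [(hf y).fderiv]
  rw [e1, e2] at key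
  rw [div_mul_eq_mul_div, eq_div_iff (by positivity)]
  linarith

theorem HasSymmExpansion.exists_norm_integral_gaussian_le {h : ℝ → E → F}
    (hh : HasSymmExpansion h) (hβ : 0 < β) (hcont : ∀ s, Continuous (h s))
    (hneg : ∀ s y, h s (-y) = h (-s) y) (h0 : ∫ y, exp (-β * ‖y‖ ^ 2) • h 0 y = 0) :
    ∃ C, ∀ s, |s| ≤ 1 → ‖∫ y, exp (-β * ‖y‖ ^ 2) • h s y‖ ≤ s ^ 2 * C := by
  obtain ⟨M, hM, -, hb⟩ := hh.exists_bound
  obtain ⟨K, hK, hK0, hk⟩ := hh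
  obtain ⟨C, hC⟩ := hK.exists_norm_integral_gaussian_le hβ (F := F)
  have hi {s : ℝ} (hs : |s| ≤ 1) : Integrable fun y => exp (-β * ‖y‖ ^ 2) • h s y :=
    hM.integrable_gaussian_mul hβ (hcont s) fun y => hb s y hs
  have hsymm (s : ℝ) : ∫ y, exp (-β * ‖y‖ ^ 2) • h (-s) y = ∫ y, exp (-β * ‖y‖ ^ 2) • h s y := by
    rw [← integral_neg_eq_self]
    simp only [norm_neg, hneg, neg_neg]
  refine ⟨C / 2, fun s hs => ?_⟩
  have hs' : |-s| ≤ 1 := by rwa [abs_neg]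
  have hsum : ∫ y, exp (-β * ‖y‖ ^ 2) • (h s y + h (-s) y - (2 : ℝ) • h 0 y) =
      (2 : ℝ) • ∫ y, exp (-β * ‖y‖ ^ 2) • h s y := by
    have h1 := integral_sub ((hi hs).add (hi hs')) ((hi (s := 0) (by simp)).smul (2 : ℝ))
    simp only [Pi.add_apply, Pi.smul_apply] at h1
    rw [integral_add (hi hs) (hi hs'), integral_smul, h0, hsymm, smul_zero, sub_zero,
      ← two_smul ℝ] at h1
    rw [← h1]
    congr 1 with y
    module
  have := hC (fun y => h s y + h (-s) y - (2 : ℝ) • h 0 y) (s ^ 2) (sq_nonneg s)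
    fun y => (hk s y hs).2.2
  rw [hsum, norm_smul, norm_two] at this
  linarith

theorem Real.abs_exp_neg_sub_one_add_le_sq {t : ℝ} (ht : 0 ≤ t) : |exp (-t) - 1 + t| ≤ t ^ 2 := by
  have h1 := add_one_le_exp (-t)
  have h2 : exp (-t) ≤ 1 - t + t ^ 2 := by
    rw [exp_neg, inv_le_iff_one_le_mul₀ (exp_pos t)]
    calc 1 ≤ (1 - t + t ^ 2) * (t + 1) := by nlinarith [pow_nonneg ht 3]
      _ ≤ (1 - t + t ^ 2) * exp t :=
        mul_le_mul_of_nonneg_left (add_one_le_exp t) (by nlinarith [sq_nonneg (t - 1)])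
  rw [abs_le]
  constructor <;> nlinarith

theorem exists_norm_integral_gaussian_exp_sub_exp_le {p q : ℝ → E → ℝ} {φ : ℝ → E → F}
    (hp : HasSymmExpansion p) (hq : HasSymmExpansion q) (hφ : HasSymmExpansion φ) (hβ : 0 < β)
    (hp0 : ∀ s y, 0 ≤ p s y) (hq0 : ∀ s y, 0 ≤ q s y)
    (hpc : ∀ s, Continuous (p s)) (hqc : ∀ s, Continuous (q s)) (hφc : ∀ s, Continuous (φ s))
    (hpn : ∀ s y, p s (-y) = p (-s) y) (hqn : ∀ s y, q s (-y) = q (-s) y)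
    (hφn : ∀ s y, φ s (-y) = φ (-s) y)
    (h0 : ∫ y, exp (-β * ‖y‖ ^ 2) • (q 0 y - p 0 y) • φ 0 y = 0) :
    ∃ C, ∀ s, |s| ≤ 1 → ‖(∫ y, exp (-β * ‖y‖ ^ 2) • exp (-(s ^ 2 * p s y)) • φ s y) -
      ∫ y, exp (-β * ‖y‖ ^ 2) • exp (-(s ^ 2 * q s y)) • φ s y‖ ≤ s ^ 4 * C := by
  have hh : HasSymmExpansion fun s y => (q s y - p s y) • φ s y := by
    simpa only [neg_one_mul, ← sub_eq_add_neg] using (hq.add (hp.const_mul (-1))).smul hφ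
  obtain ⟨C, hC⟩ := hh.exists_norm_integral_gaussian_le hβ
    (fun s => ((hqc s).sub (hpc s)).smul (hφc s)) (fun s y => by rw [hpn, hqn, hφn]) h0
  obtain ⟨H, hH, -, hHb⟩ := hh.exists_bound
  obtain ⟨P, hP, hP0, hPb⟩ := hp.exists_bound
  obtain ⟨Q, hQ, hQ0, hQb⟩ := hq.exists_bound
  obtain ⟨Φ, hΦ, -, hΦb⟩ := hφ.exists_bound
  obtain ⟨D, hD⟩ := (((hP.mul hP).add (hQ.mul hQ)).mul hΦ).exists_norm_integral_gaussian_le hβ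
    (F := F)
  have hi {r : ℝ → E → ℝ} (hr0 : ∀ s y, 0 ≤ r s y) (hrc : ∀ s, Continuous (r s)) {s : ℝ}
      (hs : |s| ≤ 1) :
      Integrable fun y => exp (-β * ‖y‖ ^ 2) • exp (-(s ^ 2 * r s y)) • φ s y := by
    refine hΦ.integrable_gaussian_mul hβ (by have := hrc s; have := hφc s; fun_prop) fun y => ?_
    rw [norm_smul, norm_eq_abs, abs_exp]
    have : exp (-(s ^ 2 * r s y)) ≤ 1 :=
      exp_le_one_iff.2 (neg_nonpos.2 (mul_nonneg (sq_nonneg s) (hr0 s y)))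
    nlinarith [hΦb s y hs, norm_nonneg (φ s y)]
  refine ⟨C + D, fun s hs => ?_⟩
  have hHi : Integrable fun y => exp (-β * ‖y‖ ^ 2) • (q s y - p s y) • φ s y :=
    hH.integrable_gaussian_mul hβ (((hqc s).sub (hpc s)).smul (hφc s)) fun y => hHb s y hs
  have hrem := hD (fun y => (exp (-(s ^ 2 * p s y)) - exp (-(s ^ 2 * q s y)) -
    s ^ 2 * (q s y - p s y)) • φ s y) (s ^ 4) (by positivity) fun y => by
      have a1 := abs_exp_neg_sub_one_add_le_sq (mul_nonneg (sq_nonneg s) (hp0 s y))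
      have a2 := abs_exp_neg_sub_one_add_le_sq (mul_nonneg (sq_nonneg s) (hq0 s y))
      have b1 : (s ^ 2 * p s y) ^ 2 ≤ s ^ 4 * (P y * P y) := by
        have h1 := hp0 s y
        have h2 := (le_abs_self _).trans (hPb s y hs)
        calc (s ^ 2 * p s y) ^ 2 = s ^ 4 * (p s y * p s y) := by ring
          _ ≤ _ := by gcongr; exact hP0 y
      have b2 : (s ^ 2 * q s y) ^ 2 ≤ s ^ 4 * (Q y * Q y) := by
        have h1 := hq0 s y
        have h2 := (le_abs_self _).trans (hQb s y hs)
        calc (s ^ 2 * q s y) ^ 2 = s ^ 4 * (q s y * q s y) := by ring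
          _ ≤ _ := by gcongr; exact hQ0 y
      have e : exp (-(s ^ 2 * p s y)) - exp (-(s ^ 2 * q s y)) - s ^ 2 * (q s y - p s y) =
        (exp (-(s ^ 2 * p s y)) - 1 + s ^ 2 * p s y) -
        (exp (-(s ^ 2 * q s y)) - 1 + s ^ 2 * q s y) := by ring
      have a3 := abs_sub (exp (-(s ^ 2 * p s y)) - 1 + s ^ 2 * p s y)
        (exp (-(s ^ 2 * q s y)) - 1 + s ^ 2 * q s y)
      rw [← e] at a3
      rw [norm_smul, norm_eq_abs, ← mul_assoc]
      exact mul_le_mul (by linarith) (hΦb s y hs) (norm_nonneg _)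
        (mul_nonneg (by positivity) (add_nonneg (mul_self_nonneg _) (mul_self_nonneg _)))
  have hsplit : (∫ y, exp (-β * ‖y‖ ^ 2) • exp (-(s ^ 2 * p s y)) • φ s y) -
      (∫ y, exp (-β * ‖y‖ ^ 2) • exp (-(s ^ 2 * q s y)) • φ s y) =
      s ^ 2 • (∫ y, exp (-β * ‖y‖ ^ 2) • (q s y - p s y) • φ s y) +
      ∫ y, exp (-β * ‖y‖ ^ 2) • (exp (-(s ^ 2 * p s y)) - exp (-(s ^ 2 * q s y)) -
        s ^ 2 * (q s y - p s y)) • φ s y := by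
    rw [← sub_eq_iff_eq_add', ← integral_smul, ← integral_sub (hi hp0 hpc hs) (hi hq0 hqc hs)]
    refine (integral_sub ((hi hp0 hpc hs).sub (hi hq0 hqc hs)) (hHi.smul (s ^ 2))).symm.trans ?_
    congr 1 with y
    simp only [Pi.sub_apply, Pi.smul_apply]
    module
  rw [hsplit]
  refine (norm_add_le _ _).trans ?_
  rw [norm_smul, norm_eq_abs, abs_of_nonneg (sq_nonneg s)]
  have := mul_le_mul_of_nonneg_left (hC s hs) (sq_nonneg s)
  linarith

/-- Substitution `x' = x - s • y`. -/
theorem integral_eq_smul_integral_comp_sub_smul (f : E → F) (x : E) {s : ℝ} (hs : 0 < s) :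
    ∫ x', f x' = s ^ Module.finrank ℝ E • ∫ y, f (x - s • y) := by
  rw [Measure.integral_comp_smul_of_nonneg volume (fun u => f (x - u)) s (hR := hs.le),
    smul_smul, mul_inv_cancel₀ (by positivity), one_smul, integral_sub_left_eq_self f volume x]

end Gaussian

/-- replacing the `ℏ`-dependent term `(ε/ℏ) B²` in the exponent
of the kernel `W` by the `ℏ`-independent term `(e²/(m c²)) ‖A‖²` (giving the
kernel `K`) changes the integral against a Schwartz function only by `O(ε²)`
as `ε → 0⁺`. -/
theorem stmt15
    (m ℏ e c : ℝ) (hm : 0 < m) (hℏ : 0 < ℏ) (he : 0 < e) (hc : 0 < c)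
    (V : E3 → ℝ) (A : E3 → E3)
    (hV : ContDiff ℝ (⊤ : ℕ∞) V) (hA : ContDiff ℝ (⊤ : ℕ∞) A)
    (hVb : ∀ i : ℕ, i ≤ 2 → ∃ C, ∀ x, ‖iteratedFDeriv ℝ i V x‖ ≤ C)
    (hAb : ∀ i : ℕ, i ≤ 2 → ∃ C, ∀ x, ‖iteratedFDeriv ℝ i A x‖ ≤ C)
    (ψ : SchwartzMap E3 ℂ)
    (B : ℝ → E3 → E3 → ℝ)
    (hB : ∀ ε x x', B ε x x' =
      (e / c) * ⟪ε⁻¹ • (x - x'), A ((2 : ℝ)⁻¹ • (x + x'))⟫)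
    (W K : ℝ → E3 → E3 → ℝ)
    (hW : ∀ ε x x', W ε x x' =
      (m / (2 * Real.pi * ℏ * ε)) ^ ((3 : ℝ) / 2) *
        Real.exp (-(ε / ℏ) *
          (m * ‖x - x'‖ ^ 2 / (2 * ε ^ 2) + V ((2 : ℝ)⁻¹ • (x + x')) +
            B ε x x' + (ε / ℏ) * (B ε x x') ^ 2)))
    (hK : ∀ ε x x', K ε x x' =
      (m / (2 * Real.pi * ℏ * ε)) ^ ((3 : ℝ) / 2) *
        Real.exp (-(ε / ℏ) *
          (m * ‖x - x'‖ ^ 2 / (2 * ε ^ 2) + V ((2 : ℝ)⁻¹ • (x + x')) +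
            B ε x x' + (e ^ 2 / (m * c ^ 2)) * ‖A ((2 : ℝ)⁻¹ • (x + x'))‖ ^ 2))) :
    ∀ x : E3,
      (fun ε : ℝ =>
          (∫ x', (W ε x x' : ℂ) * ψ x') - ∫ x', (K ε x x' : ℂ) * ψ x')
        =O[nhdsWithin 0 (Set.Ioi 0)] (fun ε : ℝ => ε ^ 2) := by
  intro x
  have hz (s : ℝ) (y : E3) : (2 : ℝ)⁻¹ • (x + (x - s • y)) = x + s • (-2⁻¹ : ℝ) • y := by module
  have hψz (s : ℝ) (y : E3) : x - s • y = x + s • (-1 : ℝ) • y := by module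
  set b : ℝ := e / (c * ℏ) with hb
  set β : ℝ := m / (2 * ℏ) with hβ_def
  have hβ : 0 < β := by positivity
  set κ : ℝ := e ^ 2 / (m * c ^ 2 * ℏ) with hκ
  set M : ℝ := (m / (2 * π * ℏ)) ^ ((3 : ℝ) / 2) with hM
  let z : ℝ → E3 → E3 := fun s y => x + s • (-2⁻¹ : ℝ) • y
  have hz_neg (s : ℝ) (y : E3) : z s (-y) = z (-s) y := by simp only [z]; module
  have hAc := hA.continuous
  have hVc := hV.continuous
  have hψc := ψ.continuous
  have h2 : (2 : WithTop ℕ∞) ≤ ((⊤ : ℕ∞) : WithTop ℕ∞) := 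
    WithTop.coe_le_coe.2 (le_top : (2 : ℕ∞) ≤ ⊤)
  have hAe : HasSymmExpansion fun s y => A (z s y) :=
    hasSymmExpansion_of_iteratedFDeriv_le (hA.of_le h2) hAb x _
  have hVe : HasSymmExpansion fun s y => V (z s y) :=
    hasSymmExpansion_of_iteratedFDeriv_le (hV.of_le h2) hVb x _
  have hψe : HasSymmExpansion fun s y => ψ (x + s • (-1 : ℝ) • y) :=
    hasSymmExpansion_of_iteratedFDeriv_le (ψ.smooth 2)
      (fun i _ => (ψ.decay 0 i).imp fun C h => by simpa using h.2) x _
  have hye : HasSymmExpansion fun (_ : ℝ) (y : E3) => y :=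
    hasSymmExpansion_of_growth expGrowth_norm fun _ => le_rfl
  have hIe : HasSymmExpansion fun s y => ⟪y, A (z s y)⟫ := hye.bilin hAe (innerSL ℝ)
  have hNe : HasSymmExpansion fun s y => ‖A (z s y)‖ ^ 2 := by
    simp_rw [← real_inner_self_eq_norm_sq]
    exact hAe.bilin hAe (innerSL ℝ)
  let w : ℝ → E3 → ℝ := fun s y => s ^ 2 * (-ℏ⁻¹ * V (z s y)) + s * (-b * ⟪y, A (z s y)⟫)
  have hwe : HasSymmExpansion w := by
    have := ((hasSymmExpansion_parameter.mul hasSymmExpansion_parameter).mul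
      (hVe.const_mul (-ℏ⁻¹))).add (hasSymmExpansion_parameter.mul (hIe.const_mul (-b)))
    simpa only [w, sq] using this
  obtain ⟨CV, hCV⟩ := hVb 0 (by norm_num)
  obtain ⟨CA, hCA⟩ := hAb 0 (by norm_num)
  simp only [norm_iteratedFDeriv_zero] at hCV hCA
  have hw (s : ℝ) (y : E3) (hs : |s| ≤ 1) : |w s y| ≤ (ℏ⁻¹ * CV + b * CA) * (1 + ‖y‖) := by
    have hb0 : 0 < b := by positivity
    have hCV0 : 0 ≤ CV := (norm_nonneg _).trans (hCV 0)
    have hCA0 : 0 ≤ CA := (norm_nonneg _).trans (hCA 0)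
    have i1 : |⟪y, A (z s y)⟫| ≤ ‖y‖ * CA :=
      (abs_real_inner_le_norm _ _).trans (by gcongr; exact hCA _)
    have i2 : |V (z s y)| ≤ CV := hCV _
    refine (abs_add_le _ _).trans ?_
    simp only [abs_mul, abs_neg, abs_pow, abs_of_pos (inv_pos.2 hℏ), abs_of_pos hb0]
    calc |s| ^ 2 * (ℏ⁻¹ * |V (z s y)|) + |s| * (b * |⟪y, A (z s y)⟫|)
        ≤ 1 ^ 2 * (ℏ⁻¹ * CV) + 1 * (b * (‖y‖ * CA)) := by gcongr
      _ ≤ _ := by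
        have : 0 ≤ ℏ⁻¹ * CV * ‖y‖ + b * CA := by positivity
        linarith
  have hexp := hwe.rexp (fun y => by simp [w]) hw
  have hzc (s : ℝ) : Continuous (z s) := by fun_prop
  have hmoment : ∫ y, exp (-β * ‖y‖ ^ 2) • (κ * ‖A (z 0 y)‖ ^ 2 - b ^ 2 * ⟪y, A (z 0 y)⟫ ^ 2) •
      (exp (w 0 y) • ψ (x + (0 : ℝ) • (-1 : ℝ) • y)) = 0 := by
    simp only [w, z, zero_smul, add_zero]
    have hg := (integrable_exp_neg_mul_sq_norm (E := E3) hβ).const_mul (κ * ‖A x‖ ^ 2)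
    have hg' := (integrable_exp_neg_mul_sq_norm_mul_inner_sq hβ (A x)).const_mul (b ^ 2)
    have hint : ∫ y : E3, (κ * ‖A x‖ ^ 2 * exp (-β * ‖y‖ ^ 2) -
        b ^ 2 * (exp (-β * ‖y‖ ^ 2) * ⟪y, A x⟫ ^ 2)) = 0 := by
      rw [integral_sub hg hg', integral_const_mul, integral_const_mul,
        integral_exp_neg_mul_sq_norm_mul_inner_sq hβ]
      simp only [hb, hβ_def, hκ]
      field_simp
      ring
    calc _ = ∫ y : E3, (κ * ‖A x‖ ^ 2 * exp (-β * ‖y‖ ^ 2) -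
          b ^ 2 * (exp (-β * ‖y‖ ^ 2) * ⟪y, A x⟫ ^ 2)) • ψ x := by
          congr 1 with y
          rw [zero_pow two_ne_zero, zero_mul, zero_mul, add_zero, exp_zero, one_smul, smul_smul]
          ring_nf
      _ = 0 := by rw [integral_smul_const, hint, zero_smul]
  obtain ⟨C, hC⟩ := exists_norm_integral_gaussian_exp_sub_exp_le (β := β)
    (p := fun s y => b ^ 2 * ⟪y, A (z s y)⟫ ^ 2) (q := fun s y => κ * ‖A (z s y)‖ ^ 2)
    (φ := fun s y => exp (w s y) • ψ (x + s • (-1 : ℝ) • y))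
    (by simp only [sq ⟪_, _⟫]; exact (hIe.mul hIe).const_mul _) (hNe.const_mul κ)
    (hexp.smul hψe) hβ (fun s y => by positivity) (fun s y => by positivity)
    (fun s => by have := hzc s; fun_prop) (fun s => by have := hzc s; fun_prop)
    (fun s => by have := hzc s; fun_prop)
    (fun s y => by simp only [hz_neg, inner_neg_left, neg_sq])
    (fun s y => by simp only [hz_neg])
    (fun s y => by simp only [w, hz_neg, inner_neg_left, smul_neg, neg_smul]; ring_nf)
    hmoment
  have hscale {s : ℝ} (hs : 0 < s) : s ^ 3 * (m / (2 * π * ℏ * s ^ 2)) ^ ((3 : ℝ) / 2) = M := by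
    rw [hM, ← div_div, div_rpow (by positivity) (by positivity), ← rpow_natCast s 2,
      ← rpow_mul hs.le]
    norm_num
    field_simp
  have hWi {s : ℝ} (hs : 0 < s) : ∫ x', (W (s ^ 2) x x' : ℂ) * ψ x' = M • ∫ y,
      exp (-β * ‖y‖ ^ 2) • exp (-(s ^ 2 * (b ^ 2 * ⟪y, A (z s y)⟫ ^ 2))) •
        (exp (w s y) • ψ (x + s • (-1 : ℝ) • y)) := by
    rw [integral_eq_smul_integral_comp_sub_smul _ x hs, finrank_euclideanSpace_fin, ← hscale hs,
      mul_smul]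
    refine congrArg (s ^ 3 • ·) ?_
    rw [← integral_smul]
    refine integral_congr_ae (.of_forall fun y => ?_)
    beta_reduce
    rw [← hψz, ← Complex.real_smul, hW, hB, hz, mul_smul]
    refine congrArg ((m / (2 * π * ℏ * s ^ 2)) ^ ((3 : ℝ) / 2) • ·) ?_
    rw [← mul_smul (exp (-β * ‖y‖ ^ 2)), ← mul_smul (exp _ * exp _), ← exp_add, ← exp_add]
    refine congrArg (fun t => exp t • ψ (x - s • y)) ?_
    rw [sub_sub_cancel, real_inner_smul_left, real_inner_smul_left, norm_smul, norm_of_nonneg hs.le]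
    simp only [w, z, hb, hβ_def]
    field_simp
    ring
  have hKi {s : ℝ} (hs : 0 < s) : ∫ x', (K (s ^ 2) x x' : ℂ) * ψ x' = M • ∫ y,
      exp (-β * ‖y‖ ^ 2) • exp (-(s ^ 2 * (κ * ‖A (z s y)‖ ^ 2))) •
        (exp (w s y) • ψ (x + s • (-1 : ℝ) • y)) := by
    rw [integral_eq_smul_integral_comp_sub_smul _ x hs, finrank_euclideanSpace_fin, ← hscale hs,
      mul_smul]
    refine congrArg (s ^ 3 • ·) ?_
    rw [← integral_smul]
    refine integral_congr_ae (.of_forall fun y => ?_)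
    beta_reduce
    rw [← hψz, ← Complex.real_smul, hK, hB, hz, mul_smul]
    refine congrArg ((m / (2 * π * ℏ * s ^ 2)) ^ ((3 : ℝ) / 2) • ·) ?_
    rw [← mul_smul (exp (-β * ‖y‖ ^ 2)), ← mul_smul (exp _ * exp _), ← exp_add, ← exp_add]
    refine congrArg (fun t => exp t • ψ (x - s • y)) ?_
    rw [sub_sub_cancel, real_inner_smul_left, real_inner_smul_left, norm_smul, norm_of_nonneg hs.le]
    simp only [w, z, hb, hβ_def, hκ]
    field_simp
    ring
  refine IsBigO.of_bound (M * C) ?_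
  filter_upwards [Ioc_mem_nhdsGT zero_lt_one] with ε hε
  obtain ⟨s, hs, rfl⟩ : ∃ s : ℝ, 0 < s ∧ s ^ 2 = ε := ⟨√ε, sqrt_pos.2 hε.1, sq_sqrt hε.1.le⟩
  have hs1 : |s| ≤ 1 := (sq_le_one_iff_abs_le_one s).1 hε.2
  have hM0 : 0 ≤ M := by positivity
  rw [hWi hs, hKi hs, ← smul_sub, norm_smul, norm_of_nonneg hM0, norm_of_nonneg (by positivity)]
  calc _ ≤ M * (s ^ 4 * C) := mul_le_mul_of_nonneg_left (hC s hs1) hM0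
    _ = _ := by ring

end
end

section
/- Let X be a finite type, let n ≥ 1, and let F_ℓ : X → X → ℝ be non-negative functions for 0 ≤ ℓ ≤ n−1. Define the partition function Z := Σ over all paths (x_0, …, x_n) ∈ X^{n+1} of ∏_{ℓ=0}^{n−1} F_ℓ(x_{ℓ+1}, x_ℓ), assume Z > 0, and define the path distribution 𝓟(x_0, …, x_n) := Z⁻¹ · ∏_{ℓ=0}^{n−1} F_ℓ(x_{ℓ+1}, x_ℓ). For 0 ≤ ℓ ≤ n define the partial partition functions Z_→ℓ(y) := Σ over (x_0, …, x_ℓ) with x_ℓ = y of ∏_{ℓ′=0}^{ℓ−1} F_{ℓ′}(x_{ℓ′+1}, x_{ℓ′}) and Z_ℓ←(y) := Σ over (x_ℓ, …, x_n) with x_ℓ = y of ∏_{ℓ′=ℓ}^{n−1} F_{ℓ′}(x_{ℓ′+1}, x_{ℓ′}) (empty products equal 1). Then: (i) for every 0 ≤ ℓ ≤ n−1 and every x, x′ ∈ X, the pairwise marginal Σ over all paths with x_ℓ = x and x_{ℓ+1} = x′ of 𝓟 equals Z⁻¹ · F_ℓ(x′, x) · Z_→ℓ(x) · Z_{ℓ+1}←(x′);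 and (ii) for every 0 ≤ ℓ ≤ n and every x ∈ X, the single-site marginal p_ℓ(x) := Σ over all paths with x_ℓ = x of 𝓟 equals Z⁻¹ · Z_→ℓ(x) · Z_ℓ←(x). -/
open Finset

/-- Weight of a path `x₀ → x₁ → ⋯ → xₙ`: `∏_{ℓ=0}^{n-1} F_ℓ(x_{ℓ+1}, x_ℓ)`. -/
def pathWeight {X : Type*} (n : ℕ) (F : ℕ → X → X → ℝ) (p : Fin (n + 1) → X) : ℝ :=
  ∏ j : Fin n, F j.val (p j.succ) (p j.castSucc)

/-- Forward partial partition function `Z_→ℓ(y)`: sum over partial paths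
`(x₀, …, x_ℓ)` with `x_ℓ = y` of `∏_{ℓ' = 0}^{ℓ-1} F_{ℓ'}(x_{ℓ'+1}, x_{ℓ'})`. -/
def Zfwd {X : Type*} [Fintype X] [DecidableEq X]
    (F : ℕ → X → X → ℝ) (ℓ : ℕ) (y : X) : ℝ :=
  ∑ q : Fin (ℓ + 1) → X,
    if q (Fin.last ℓ) = y then
      ∏ j : Fin ℓ, F j.val (q j.succ) (q j.castSucc) else 0

/-- Backward partial partition function `Z_ℓ←(y)`: sum over partial paths
`(x_ℓ, …, x_n)` with `x_ℓ = y` of `∏_{ℓ' = ℓ}^{n-1} F_{ℓ'}(x_{ℓ'+1}, x_{ℓ'})`. -/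
def Zbwd {X : Type*} [Fintype X] [DecidableEq X]
    (n : ℕ) (F : ℕ → X → X → ℝ) (ℓ : ℕ) (y : X) : ℝ :=
  ∑ q : Fin (n - ℓ + 1) → X,
    if q 0 = y then
      ∏ j : Fin (n - ℓ), F (ℓ + j.val) (q j.succ) (q j.castSucc) else 0

theorem Zbwd_eq_sum_of_sub_eq {X : Type*} [Fintype X] [DecidableEq X]
    {n ℓ m : ℕ} (h : n - ℓ = m) (F : ℕ → X → X → ℝ) (y : X) :
    Zbwd n F ℓ y = ∑ q : Fin (m + 1) → X,
      if q 0 = y then ∏ j : Fin m, F (ℓ + j.val) (q j.succ) (q j.castSucc) else 0 := by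
  subst h
  rfl

/-- The backward partition function at the right end of the chain is an empty product. -/
theorem Zbwd_self {X : Type*} [Fintype X] [DecidableEq X]
    (n : ℕ) (F : ℕ → X → X → ℝ) (y : X) : Zbwd n F n y = 1 := by
  rw [Zbwd_eq_sum_of_sub_eq (Nat.sub_self n),
    ← (Equiv.funUnique (Fin 1) X).symm.sum_comp]
  simp

/-- The backward message-passing recursion. -/
theorem Zbwd_eq_sum_succ {X : Type*} [Fintype X] [DecidableEq X]
    {n ℓ : ℕ} (hℓ : ℓ + 1 ≤ n) (F : ℕ → X → X → ℝ) (y : X) :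
    Zbwd n F ℓ y = ∑ x', F ℓ x' y * Zbwd n F (ℓ + 1) x' := by
  obtain ⟨m, rfl⟩ := Nat.exists_eq_add_of_le hℓ
  rw [Zbwd_eq_sum_of_sub_eq (m := m + 1) (by omega),
    ← (Fin.consEquiv fun _ => X).sum_comp, Fintype.sum_prod_type]
  simp only [Zbwd_eq_sum_of_sub_eq (n := ℓ + 1 + m) (ℓ := ℓ + 1) (m := m) (by omega)]
  simp only [Fin.consEquiv_apply, Fin.cons_zero, Finset.mul_sum]
  rw [Finset.sum_comm, Finset.sum_comm (s := Finset.univ (α := X))]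
  refine Finset.sum_congr rfl fun q _ => ?_
  simp [Fin.prod_univ_succ, add_assoc, add_comm 1]

/-- Cutting the edge `ℓ` splits a path weight into a left part, the factor of that edge and a
right part. -/
theorem pathWeight_append {X : Type*} (ℓ m : ℕ) (F : ℕ → X → X → ℝ)
    (q : Fin (ℓ + 1) → X) (r : Fin (m + 1) → X) :
    pathWeight (ℓ + 1 + m) F (Fin.append q r :) =
      (∏ j : Fin ℓ, F j.val (q j.succ) (q j.castSucc)) * F ℓ (r 0) (q (Fin.last ℓ)) *
        ∏ j : Fin m, F (ℓ + 1 + j.val) (r j.succ) (r j.castSucc) := by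
  rw [pathWeight, Fin.prod_univ_add, Fin.prod_univ_castSucc]
  congr 1
  · congr 1
    · refine Finset.prod_congr rfl fun j _ => ?_
      exact congrArg₂ (F j) (Fin.append_left q r j.succ) (Fin.append_left q r j.castSucc)
    · exact congrArg₂ (F ℓ) (Fin.append_right q r 0) (Fin.append_left q r (Fin.last ℓ))
  · refine Finset.prod_congr rfl fun j _ => ?_
    exact congrArg₂ (F (ℓ + 1 + j)) (Fin.append_right q r j.succ)
      (Fin.append_right q r j.castSucc)

theorem sum_pathWeight_edge {X : Type*} [Fintype X] [DecidableEq X]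
    {n ℓ : ℕ} (hℓ : ℓ + 1 ≤ n) (F : ℕ → X → X → ℝ) (x x' : X) :
    (∑ p : Fin (n + 1) → X,
        if p ⟨ℓ, Nat.lt_succ_of_lt hℓ⟩ = x ∧ p ⟨ℓ + 1, Nat.lt_succ_of_le hℓ⟩ = x' then
          pathWeight n F p else 0) =
      F ℓ x' x * Zfwd F ℓ x * Zbwd n F (ℓ + 1) x' := by
  obtain ⟨m, rfl⟩ := Nat.exists_eq_add_of_le hℓ
  rw [Zbwd_eq_sum_of_sub_eq (m := m) (by omega), Zfwd, mul_assoc,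
    Finset.sum_mul_sum, ← Fintype.sum_prod_type', Finset.mul_sum]
  refine ((Fin.appendEquiv (α := X) (ℓ + 1) (m + 1)).sum_comp _).symm.trans ?_
  refine Finset.sum_congr rfl fun ⟨q, r⟩ _ => ?_
  have hq : Fin.append q r ⟨ℓ, Nat.lt_succ_of_lt hℓ⟩ = q (Fin.last ℓ) := Fin.append_left q r (Fin.last ℓ)
  have hr : Fin.append q r ⟨ℓ + 1, Nat.lt_succ_of_le hℓ⟩ = r 0 := Fin.append_right q r 0
  change (if Fin.append q r ⟨ℓ, _⟩ = x ∧ Fin.append q r ⟨ℓ + 1, _⟩ = x' then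
    pathWeight (ℓ + 1 + m) F (Fin.append q r :) else 0) = _
  rw [hq, hr, pathWeight_append]
  by_cases h₁ : q (Fin.last ℓ) = x <;> by_cases h₂ : r 0 = x' <;> simp [h₁, h₂]
  ring

theorem sum_pathWeight_site {X : Type*} [Fintype X] [DecidableEq X]
    {n ℓ : ℕ} (hℓ : ℓ ≤ n) (F : ℕ → X → X → ℝ) (x : X) :
    (∑ p : Fin (n + 1) → X, if p ⟨ℓ, Nat.lt_succ_of_le hℓ⟩ = x then pathWeight n F p else 0) =
      Zfwd F ℓ x * Zbwd n F ℓ x := by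
  obtain rfl | hlt := hℓ.eq_or_lt
  · rw [Zbwd_self, mul_one]
    rfl
  · have hsum : Zfwd F ℓ x * Zbwd n F ℓ x =
        ∑ x', F ℓ x' x * Zfwd F ℓ x * Zbwd n F (ℓ + 1) x' := by
      rw [Zbwd_eq_sum_succ hlt, Finset.mul_sum]
      exact Finset.sum_congr rfl fun _ _ => by ring
    simp only [hsum, ← sum_pathWeight_edge hlt]
    rw [Finset.sum_comm]
    refine Finset.sum_congr rfl fun p _ => ?_
    simp [ite_and]

/-- exactness of the cavity method (belief propagation) on a
chain: the pairwise and single-site marginals of the path distribution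
`𝓟 = Z⁻¹ ∏ F_ℓ` factorize through the partial partition functions. -/
theorem stmt17 {X : Type*} [Fintype X] [DecidableEq X]
    (n : ℕ) (hn : 1 ≤ n) (F : ℕ → X → X → ℝ)
    (hF : ∀ ℓ, ℓ < n → ∀ x x', 0 ≤ F ℓ x x')
    (Z : ℝ) (hZdef : Z = ∑ p : Fin (n + 1) → X, pathWeight n F p) (hZ : 0 < Z)
    (𝓟 : (Fin (n + 1) → X) → ℝ)
    (h𝓟 : ∀ p, 𝓟 p = Z⁻¹ * pathWeight n F p) :
    (∀ ℓ, ∀ hℓ : ℓ + 1 ≤ n, ∀ x x' : X,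
      (∑ p : Fin (n + 1) → X,
          if p ⟨ℓ, by omega⟩ = x ∧ p ⟨ℓ + 1, by omega⟩ = x' then 𝓟 p else 0)
        = Z⁻¹ * F ℓ x' x * Zfwd F ℓ x * Zbwd n F (ℓ + 1) x') ∧
    (∀ ℓ, ∀ hℓ : ℓ ≤ n, ∀ x : X,
      (∑ p : Fin (n + 1) → X, if p ⟨ℓ, by omega⟩ = x then 𝓟 p else 0)
        = Z⁻¹ * Zfwd F ℓ x * Zbwd n F ℓ x) := by
  simp only [h𝓟, ← mul_ite_zero, ← Finset.mul_sum]
  refine ⟨fun ℓ hℓ x x' => ?_, fun ℓ hℓ x => ?_⟩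
  · rw [sum_pathWeight_edge hℓ]
    ring
  · rw [sum_pathWeight_site hℓ]
    ring
end

section
/- Let X be a finite type, let n ≥ 1, let F_ℓ : X → X → ℝ be non-negative functions for 0 ≤ ℓ ≤ n−1, and let F̃ : X → X → ℝ be non-negative. Define Z := Σ over all (x_0, …, x_n) ∈ X^{n+1} of F̃(x_0, x_n) · ∏_{ℓ=0}^{n−1} F_ℓ(x_{ℓ+1}, x_ℓ), assume Z > 0, and define the closed-path distribution 𝓟(x_0, …, x_n) := Z⁻¹ · F̃(x_0, x_n) · ∏_{ℓ=0}^{n−1} F_ℓ(x_{ℓ+1}, x_ℓ). Regard F_ℓ and F̃ as X×X real matrices with entries (M_ℓ)_{x′,x} = F_ℓ(x′, x) and (M̃)_{x,y} = F̃(x, y), and for 0 ≤ ℓ ≤ n define the probability matrix P_ℓ := Z⁻¹ · (M_{ℓ−1} ⋯ M_0) · M̃ · (M_{n−1} ⋯ M_ℓ) (empty products are the identity). Then for every 0 ≤ ℓ ≤ n and every x ∈ X, the diagonal entry (P_ℓ)_{x,x} equals the marginal p_ℓ(x) := Σ over all (x_0, …, x_n) with x_ℓ = x of 𝓟. -/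
open Matrix Finset

/-- Descending product `M (b-1) * M (b-2) * ⋯ * M a` (identity if `b ≤ a`). -/
def prodDesc {X : Type*} [Fintype X] [DecidableEq X]
    (M : ℕ → Matrix X X ℝ) (a b : ℕ) : Matrix X X ℝ :=
  (((List.range' a (b - a)).reverse).map M).prod

theorem prodDesc_self {X : Type*} [Fintype X] [DecidableEq X]
    (M : ℕ → Matrix X X ℝ) (a : ℕ) : prodDesc M a a = 1 := by
  simp [prodDesc]

theorem prodDesc_succ {X : Type*} [Fintype X] [DecidableEq X]
    (M : ℕ → Matrix X X ℝ) {a b : ℕ} (h : a ≤ b) :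
    prodDesc M a (b + 1) = M b * prodDesc M a b := by
  unfold prodDesc
  rw [show b + 1 - a = (b - a) + 1 by omega, List.range'_concat]
  simp [show a + (b - a) = b by omega]

theorem pathWeight_snoc {X : Type*} (n : ℕ) (F : ℕ → X → X → ℝ)
    (q : Fin (n + 1) → X) (y : X) :
    pathWeight (n + 1) F (Fin.snoc q y : Fin (n + 2) → X) =
      F n y (q (Fin.last n)) * pathWeight n F q := by
  unfold pathWeight
  rw [Fin.prod_univ_castSucc, mul_comm]
  congr 1
  · rw [Fin.succ_last, Fin.snoc_last, Fin.snoc_castSucc]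
    rfl
  · refine Finset.prod_congr rfl fun j _ => ?_
    rw [Fin.succ_castSucc, Fin.snoc_castSucc, Fin.snoc_castSucc]
    rfl

theorem sum_snoc {X : Type*} [Fintype X] (n : ℕ) (f : (Fin (n + 2) → X) → ℝ) :
    ∑ p, f p = ∑ y : X, ∑ q : Fin (n + 1) → X, f (Fin.snoc q y : Fin (n + 2) → X) := by
  rw [← (Fin.snocEquiv fun _ : Fin (n + 2) => X).sum_comp, Fintype.sum_prod_type]
  rfl

/-- The product of the transfer matrices before and after time `ℓ` sums the weights of the paths
with prescribed endpoints and prescribed position at time `ℓ`. -/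
theorem prodDesc_mul_prodDesc_eq_sum {X : Type*} [Fintype X] [DecidableEq X]
    (M : ℕ → Matrix X X ℝ) (n ℓ : ℕ) (hℓ : ℓ ≤ n) (u v x : X) :
    prodDesc M 0 ℓ x u * prodDesc M ℓ n v x =
      ∑ p : Fin (n + 1) → X,
        if p 0 = u ∧ p (Fin.last n) = v ∧ p ⟨ℓ, Nat.lt_succ_of_le hℓ⟩ = x then pathWeight n M p else 0 := by
  induction n generalizing ℓ v x with
  | zero =>
    obtain rfl : ℓ = 0 := by omega
    rw [← (Equiv.funUnique (Fin 1) X).symm.sum_comp]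
    simp only [prodDesc_self, Matrix.one_apply, pathWeight]
    by_cases h1 : x = u
    · subst h1
      by_cases h2 : v = x
      · subst h2
        simp
      · have h : ∀ a : X, ¬(a = x ∧ a = v ∧ a = x) := fun a h => h2 (h.2.1.symm.trans h.1)
        simp [h2, h]
    · have h : ∀ a : X, ¬(a = u ∧ a = v ∧ a = x) := fun a h => h1 (h.2.2.symm.trans h.1)
      simp [h1, h]
  | succ n ih =>
    have h0 : ∀ (q : Fin (n + 1) → X) (y : X), (Fin.snoc q y : Fin (n + 2) → X) 0 = q 0 :=
      fun q y => Fin.snoc_castSucc (α := fun _ => X) y q 0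
    have hw : ∀ (q : Fin (n + 1) → X) (y : X), pathWeight (n + 1) M (Fin.snoc q y) =
        M n y (q (Fin.last n)) * pathWeight n M q := pathWeight_snoc n M
    rw [sum_snoc]
    simp only [h0, Fin.snoc_last]
    rcases Nat.lt_or_ge n ℓ with hlt | hle
    · obtain rfl : ℓ = n + 1 := by omega
      have hl : ∀ (q : Fin (n + 1) → X) (y : X),
          (Fin.snoc q y : Fin (n + 2) → X) ⟨n + 1, Nat.lt_succ_self _⟩ = y :=
        fun q y => Fin.snoc_last (α := fun _ => X) y q
      simp only [hl]
      rw [prodDesc_self, prodDesc_succ M (Nat.zero_le n), Matrix.mul_apply, Matrix.one_apply]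
      have key : ∀ w, prodDesc M 0 n w u = ∑ p : Fin (n + 1) → X,
          if p 0 = u ∧ p (Fin.last n) = w then pathWeight n M p else 0 := fun w => by
        have h := ih n le_rfl w w
        rw [prodDesc_self, Matrix.one_apply_eq, mul_one] at h
        rw [h]
        refine Finset.sum_congr rfl fun p _ => ?_
        have : (⟨n, Nat.lt_succ_self n⟩ : Fin (n + 1)) = Fin.last n := rfl
        simp only [this, and_self]
      simp only [key, Finset.mul_sum]
      rw [Finset.sum_comm, Finset.sum_mul, Finset.sum_comm]
      refine Finset.sum_congr rfl fun q _ => ?_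
      by_cases hu : q 0 = u <;> by_cases hv : v = x <;>
        simp [hu, hv, ite_and, hw]
    · have hl : ∀ (q : Fin (n + 1) → X) (y : X),
          (Fin.snoc q y : Fin (n + 2) → X) ⟨ℓ, Nat.lt_succ_of_le hℓ⟩ = q ⟨ℓ, Nat.lt_succ_of_le hle⟩ :=
        fun q y => Fin.snoc_castSucc (α := fun _ => X) y q ⟨ℓ, Nat.lt_succ_of_le hle⟩
      simp only [hl]
      rw [prodDesc_succ M hle, Matrix.mul_apply, Finset.mul_sum]
      simp only [mul_left_comm (prodDesc M 0 ℓ x u), ih ℓ hle, Finset.mul_sum]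
      rw [Finset.sum_comm]
      conv_rhs => rw [Finset.sum_comm]
      refine Finset.sum_congr rfl fun q _ => ?_
      by_cases hu : q 0 = u <;> by_cases hv : q ⟨ℓ, Nat.lt_succ_of_le hle⟩ = x <;>
        simp [hu, hv, hw]

/-- for a factor-graph distribution on a cycle, the diagonal
entries of the cyclically permuted matrix products `P_ℓ` are the single-time
marginals. -/
theorem stmt18 {X : Type*} [Fintype X] [DecidableEq X]
    (n : ℕ) (hn : 1 ≤ n) (F : ℕ → X → X → ℝ) (Ftil : X → X → ℝ)
    (hF : ∀ ℓ, ℓ < n → ∀ x x', 0 ≤ F ℓ x x') (hFtil : ∀ x y, 0 ≤ Ftil x y)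
    (Z : ℝ)
    (hZdef : Z = ∑ p : Fin (n + 1) → X,
      Ftil (p 0) (p (Fin.last n)) * pathWeight n F p)
    (hZ : 0 < Z)
    (𝓟 : (Fin (n + 1) → X) → ℝ)
    (h𝓟 : ∀ p, 𝓟 p = Z⁻¹ * (Ftil (p 0) (p (Fin.last n)) * pathWeight n F p))
    (M : ℕ → Matrix X X ℝ) (hM : ∀ ℓ x' x, M ℓ x' x = F ℓ x' x)
    (Mtil : Matrix X X ℝ) (hMtil : ∀ x y, Mtil x y = Ftil x y)
    (P : ℕ → Matrix X X ℝ)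
    (hP : ∀ ℓ, ℓ ≤ n → P ℓ = Z⁻¹ • (prodDesc M 0 ℓ * Mtil * prodDesc M ℓ n)) :
    ∀ ℓ, ∀ hℓ : ℓ ≤ n, ∀ x : X,
      P ℓ x x = ∑ p : Fin (n + 1) → X, if p ⟨ℓ, by omega⟩ = x then 𝓟 p else 0 := by
  intro ℓ hℓ x
  obtain rfl : M = F := by
    funext k x' x
    exact hM k x' x
  obtain rfl : Mtil = Ftil := by
    funext x y
    exact hMtil x y
  have hterm : ∀ u v, prodDesc M 0 ℓ x u * Mtil u v * prodDesc M ℓ n v x =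
      ∑ p : Fin (n + 1) → X,
        if p 0 = u ∧ p (Fin.last n) = v ∧ p ⟨ℓ, Nat.lt_succ_of_le hℓ⟩ = x then
          Mtil u v * pathWeight n M p else 0 := fun u v => by
    rw [mul_right_comm, prodDesc_mul_prodDesc_eq_sum M n ℓ hℓ, mul_comm, Finset.mul_sum]
    simp only [mul_ite, mul_zero]
  rw [hP ℓ hℓ, Matrix.smul_apply, Matrix.mul_apply]
  simp only [Matrix.mul_apply, Finset.sum_mul, hterm, smul_eq_mul]
  rw [Finset.sum_congr rfl fun v _ => Finset.sum_comm, Finset.sum_comm, Finset.mul_sum]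
  refine Finset.sum_congr rfl fun p _ => ?_
  rw [h𝓟]
  by_cases hx : p ⟨ℓ, Nat.lt_succ_of_le hℓ⟩ = x <;> simp [hx, ite_and]
end
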